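/- Let Ω ⊂ ℝⁿ be open, σ ∈ L^∞(Ω, ℝⁿ) with Div σ ≤ 0 in the sense of distributions, and u ∈ BV_loc(Ω) ∩ L^∞_loc(Ω). Then the distribution ⟨σ, Du⁺⟩ := Div(uσ) − u⁺ Div σ is a signed Radon measure on Ω, and its total variation satisfies |⟨σ, Du⁺⟩| ≤ ‖σ‖_{L^∞(Ω,ℝⁿ)} |Du| as measures on Ω, where |Du| is the total variation measure of the BV gradient of u. -/

import Mathlib

open MeasureTheory Set Filter Topology Metric
open scoped RealInnerProductSpace ENNReal

noncomputable section

/-- Euclidean space `ℝⁿ`. -/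
abbrev Eu (n : ℕ) : Type := EuclideanSpace ℝ (Fin n)

/-- `(n-1)`-dimensional Hausdorff measure on `ℝⁿ`. -/
def hm (n : ℕ) : Measure (Eu n) := μH[(n : ℝ) - 1]

/-- Smooth test functions compactly supported in `Ω`. -/
def IsTest {n : ℕ} (Ω : Set (Eu n)) (φ : Eu n → ℝ) : Prop :=
  ContDiff ℝ (⊤ : ℕ∞) φ ∧ HasCompactSupport φ ∧ tsupport φ ⊆ Ω

/-- `σ ∈ L^∞(Ω, ℝⁿ)` with `‖σ‖ ≤ C` a.e. on `Ω`. -/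
def Bdd {n : ℕ} (Ω : Set (Eu n)) (σ : Eu n → Eu n) (C : ℝ) : Prop :=
  AEStronglyMeasurable σ (volume.restrict Ω) ∧ ∀ᵐ x ∂(volume.restrict Ω), ‖σ x‖ ≤ C

/-- `σ ∈ L^∞_loc(Ω, ℝⁿ)`. -/
def LocBdd {n : ℕ} (Ω : Set (Eu n)) (σ : Eu n → Eu n) : Prop :=
  AEStronglyMeasurable σ (volume.restrict Ω) ∧
  ∀ K : Set (Eu n), K ⊆ Ω → IsCompact K → ∃ C : ℝ, ∀ᵐ x ∂(volume.restrict K), ‖σ x‖ ≤ C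

/-- scalar `u ∈ L^∞_loc(Ω)`. -/
def LocBddFun {n : ℕ} (Ω : Set (Eu n)) (u : Eu n → ℝ) : Prop :=
  AEStronglyMeasurable u (volume.restrict Ω) ∧
  ∀ K : Set (Eu n), K ⊆ Ω → IsCompact K → ∃ C : ℝ, ∀ᵐ x ∂(volume.restrict K), |u x| ≤ C

/-- scalar `u ∈ L^∞(Ω)` with bound `C`. -/
def BddFun {n : ℕ} (Ω : Set (Eu n)) (u : Eu n → ℝ) (C : ℝ) : Prop :=
  AEStronglyMeasurable u (volume.restrict Ω) ∧ ∀ᵐ x ∂(volume.restrict Ω), |u x| ≤ C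

/-- A measure carried by `Ω` which is finite on compact subsets of `Ω` (Radon on `Ω`). -/
def LocFinOn {n : ℕ} (Ω : Set (Eu n)) (μ : Measure (Eu n)) : Prop :=
  (∀ K : Set (Eu n), K ⊆ Ω → IsCompact K → μ K < ⊤) ∧ μ Ωᶜ = 0

/-- A finite measure carried by `Ω`. -/
def FinOn {n : ℕ} (Ω : Set (Eu n)) (μ : Measure (Eu n)) : Prop :=
  μ univ < ⊤ ∧ μ Ωᶜ = 0

/-- The (signed) measure `μp - μn` represents `-Div σ` on `Ω`: for every test function `φ`
compactly supported in `Ω` one has `∫_Ω σ·∇φ dx = ∫ φ dμp - ∫ φ dμn`. -/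
def RepNegDiv {n : ℕ} (Ω : Set (Eu n)) (σ : Eu n → Eu n) (μp μn : Measure (Eu n)) : Prop :=
  ∀ φ : Eu n → ℝ, IsTest Ω φ →
    ∫ x in Ω, ⟪σ x, gradient φ x⟫ = (∫ x, φ x ∂μp) - ∫ x, φ x ∂μn

/-- `Div σ ≤ 0` in the sense of distributions on `Ω`. -/
def DivNonpos {n : ℕ} (Ω : Set (Eu n)) (σ : Eu n → Eu n) : Prop :=
  ∀ φ : Eu n → ℝ, IsTest Ω φ → (∀ x, 0 ≤ φ x) → 0 ≤ ∫ x in Ω, ⟪σ x, gradient φ x⟫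

/-- The set `A` has Lebesgue density zero at the point `x`. -/
def DensityZeroAt {n : ℕ} (A : Set (Eu n)) (x : Eu n) : Prop :=
  Tendsto (fun r : ℝ => volume (A ∩ ball x r) / volume (ball x r)) (𝓝[>] 0) (𝓝 0)

/-- The upper (approximate) representative `u⁺`: Lebesgue value at approximate continuity
points, larger jump value at approximate jump points. -/
def upperRep {n : ℕ} (u : Eu n → ℝ) (x : Eu n) : ℝ :=
  sInf {t : ℝ | DensityZeroAt {y | t < u y} x}

/-- The lower (approximate) representative `u⁻`. -/
def lowerRep {n : ℕ} (u : Eu n → ℝ) (x : Eu n) : ℝ :=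
  sSup {t : ℝ | DensityZeroAt {y | u y < t} x}

/-- The precise (mean-value) representative `u* = (u⁺ + u⁻)/2`. -/
def preciseRep {n : ℕ} (u : Eu n → ℝ) (x : Eu n) : ℝ := (upperRep u x + lowerRep u x) / 2

/-- `Du = θ·ν` is the gradient measure of `u` on `Ω` with total variation `ν` and
polar vector `θ` (so `ν = |Du|`). -/
def HasGradMeasure {n : ℕ} (Ω : Set (Eu n)) (u : Eu n → ℝ) (ν : Measure (Eu n))
    (θ : Eu n → Eu n) : Prop :=
  (∀ᵐ x ∂ν, ‖θ x‖ = 1) ∧ ν Ωᶜ = 0 ∧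
  ∀ φ : Eu n → ℝ, IsTest Ω φ → ∫ x in Ω, u x • gradient φ x = - ∫ x, φ x • θ x ∂ν

/-- `u ∈ BV_loc(Ω)`. -/
def MemBVLoc {n : ℕ} (Ω : Set (Eu n)) (u : Eu n → ℝ) : Prop :=
  LocallyIntegrableOn u Ω ∧
  ∃ ν θ, LocFinOn Ω ν ∧ HasGradMeasure Ω u ν θ

/-- `g` is the weak (Sobolev) gradient of `u ∈ W^{1,1}(Ω)`. -/
def HasSobGrad {n : ℕ} (Ω : Set (Eu n)) (u : Eu n → ℝ) (g : Eu n → Eu n) : Prop :=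
  IntegrableOn g Ω ∧
  ∀ φ : Eu n → ℝ, IsTest Ω φ → ∫ x in Ω, u x • gradient φ x = - ∫ x in Ω, φ x • g x

/-- `u ∈ W^{1,1}(Ω)`. -/
def MemW11 {n : ℕ} (Ω : Set (Eu n)) (u : Eu n → ℝ) : Prop :=
  IntegrableOn u Ω ∧ ∃ g, HasSobGrad Ω u g

/-- `u ∈ W^{1,1}_loc(Ω)` with weak gradient `g`. -/
def HasSobGradLoc {n : ℕ} (Ω : Set (Eu n)) (u : Eu n → ℝ) (g : Eu n → Eu n) : Prop :=
  LocallyIntegrableOn g Ω ∧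
  ∀ φ : Eu n → ℝ, IsTest Ω φ → ∫ x in Ω, u x • gradient φ x = - ∫ x in Ω, φ x • g x

def MemW11Loc {n : ℕ} (Ω : Set (Eu n)) (u : Eu n → ℝ) : Prop :=
  LocallyIntegrableOn u Ω ∧ ∃ g, HasSobGradLoc Ω u g

/-- `T` is the interior trace of `u` on `∂Ω`, characterized `H^{n-1}`-a.e. on `∂Ω`
by convergence of interior mean values. -/
def IsIntTrace {n : ℕ} (Ω : Set (Eu n)) (u T : Eu n → ℝ) : Prop :=
  ∀ᵐ x ∂((hm n).restrict (frontier Ω)),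
    Tendsto (fun r : ℝ => (∫ y in Ω ∩ ball x r, |u y - T x|) / (volume (ball x r)).toReal)
      (𝓝[>] 0) (𝓝 0)

/-- The domain assumption `H^{n-1}(∂Ω) = P(Ω) < ∞`, in the equivalent form
`𝟙_Ω ∈ BV(ℝⁿ)` with `|D𝟙_Ω| = H^{n-1}⌞∂Ω`. -/
def DomainAssum {n : ℕ} (Ω : Set (Eu n)) : Prop :=
  hm n (frontier Ω) < ⊤ ∧
  ∃ θ, HasGradMeasure (univ : Set (Eu n)) (Ω.indicator fun _ => (1 : ℝ))
    ((hm n).restrict (frontier Ω)) θ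

/-- `g` is the normal trace `σ_n*` of `σ` on `∂Ω`, characterized by the Gauss–Green
formula for `W^{1,1} ∩ L^∞` functions; here `μ = -Div σ ≥ 0`. -/
def IsNormalTrace {n : ℕ} (Ω : Set (Eu n)) (σ : Eu n → Eu n) (μ : Measure (Eu n))
    (g : Eu n → ℝ) : Prop :=
  ∀ (v : Eu n → ℝ) (gv : Eu n → Eu n) (T : Eu n → ℝ),
    MemW11 Ω v → (∃ C, BddFun Ω v C) → HasSobGrad Ω v gv → IsIntTrace Ω v T →
    ∀ φ : Eu n → ℝ, IsTest (univ : Set (Eu n)) φ →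
      (- ∫ x in Ω, v x * ⟪σ x, gradient φ x⟫) + (∫ x, φ x * preciseRep v x ∂μ)
        = (∫ x in Ω, φ x * ⟪σ x, gv x⟫) + ∫ x in frontier Ω, φ x * T x * g x ∂(hm n)

/-- Weakly super-1-harmonic: there is `σ ∈ L^∞` with `|σ| ≤ 1` a.e., `Div σ ≤ 0`,
and `⟨σ, Du⁺⟩ = |Du|` as measures on `Ω`. -/
def SuperOneHarmonic {n : ℕ} (Ω : Set (Eu n)) (u : Eu n → ℝ) : Prop :=
  MemBVLoc Ω u ∧ LocBddFun Ω u ∧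
  ∃ σ : Eu n → Eu n, ∃ μ : Measure (Eu n),
    Bdd Ω σ 1 ∧ DivNonpos Ω σ ∧ RepNegDiv Ω σ μ 0 ∧ LocFinOn Ω μ ∧
    ∃ ν θ, LocFinOn Ω ν ∧ HasGradMeasure Ω u ν θ ∧
      ∀ φ : Eu n → ℝ, IsTest Ω φ →
        (- ∫ x in Ω, u x * ⟪σ x, gradient φ x⟫) + (∫ x, φ x * upperRep u x ∂μ)
          = ∫ x, φ x ∂ν

/-! ### Divergence of vector fields -/

/-- The divergence of a vector field. -/
def dv {n : ℕ} (X : Eu n → Eu n) (x : Eu n) : ℝ :=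
  ∑ i, (fderiv ℝ X x (EuclideanSpace.single i 1)) i

/-- `C¹` vector fields compactly supported in `O`. -/
def IsTestField {n : ℕ} (O : Set (Eu n)) (X : Eu n → Eu n) : Prop :=
  ContDiff ℝ 1 X ∧ HasCompactSupport X ∧ tsupport X ⊆ O

/-- The variation of `f` on `O` with respect to the weight `w` is at most `M`. -/
def VarLe {n : ℕ} (f : Eu n → ℝ) (O : Set (Eu n)) (w : Eu n → ℝ) (M : ℝ) : Prop :=
  ∀ X : Eu n → Eu n, IsTestField O X → (∀ x, ‖X x‖ ≤ w x) → ∫ x, f x * dv X x ≤ M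

section Divergence

variable {n : ℕ}

lemma dv_add {X Y : Eu n → Eu n} (hX : Differentiable ℝ X) (hY : Differentiable ℝ Y)
    (x : Eu n) : dv (fun x => X x + Y x) x = dv X x + dv Y x := by
  unfold dv
  rw [← Finset.sum_add_distrib]
  refine Finset.sum_congr rfl fun i _ => ?_
  rw [fderiv_fun_add (hX x) (hY x)]
  simp

lemma dv_const_smul (c : ℝ) (X : Eu n → Eu n) (x : Eu n) :
    dv (fun x => c • X x) x = c * dv X x := by
  unfold dv
  rw [Finset.mul_sum]
  refine Finset.sum_congr rfl fun i _ => ?_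
  have : (fun x => c • X x) = c • X := rfl
  rw [this, fderiv_const_smul_field]
  simp

lemma map_eq_sum_single (f : Eu n →L[ℝ] ℝ) (v : Eu n) :
    f v = ∑ i, f (EuclideanSpace.single i 1) * v i := by
  conv_lhs => rw [← (EuclideanSpace.basisFun (Fin n) ℝ).sum_repr v]
  rw [map_sum]
  refine Finset.sum_congr rfl fun i _ => ?_
  simp [mul_comm]

lemma dv_smul {g : Eu n → ℝ} {X : Eu n → Eu n} (hg : Differentiable ℝ g)
    (hX : Differentiable ℝ X) (x : Eu n) :
    dv (fun x => g x • X x) x = g x * dv X x + fderiv ℝ g x (X x) := by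
  unfold dv
  rw [map_eq_sum_single (fderiv ℝ g x) (X x), Finset.mul_sum, ← Finset.sum_add_distrib]
  refine Finset.sum_congr rfl fun i _ => ?_
  rw [fderiv_fun_smul (hg x) (hX x)]
  simp

lemma dv_smul_const {g : Eu n → ℝ} (hg : Differentiable ℝ g) (v : Eu n) (x : Eu n) :
    dv (fun x => g x • v) x = fderiv ℝ g x v := by
  have := dv_smul (X := fun _ => v) hg (differentiable_const v) x
  rw [this]
  simp [dv]

lemma dv_continuous {X : Eu n → Eu n} (hX : ContDiff ℝ 1 X) : Continuous (dv X) := by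
  unfold dv
  have := hX.continuous_fderiv one_ne_zero
  fun_prop

lemma dv_eq_zero_of_notMem {X : Eu n → Eu n} {x : Eu n} (hx : x ∉ tsupport X) : dv X x = 0 := by
  have h : fderiv ℝ X x = 0 := by
    by_contra h
    exact hx (support_fderiv_subset ℝ h)
  simp [dv, h]

lemma dv_support {X : Eu n → Eu n} : Function.support (dv X) ⊆ tsupport X := by
  intro x hx
  by_contra h
  exact hx (dv_eq_zero_of_notMem h)

lemma dv_hasCompactSupport {X : Eu n → Eu n} (hX : HasCompactSupport X) :
    HasCompactSupport (dv X) :=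
  HasCompactSupport.of_support_subset_isCompact hX dv_support

lemma IsTestField.differentiable {O : Set (Eu n)} {X : Eu n → Eu n} (h : IsTestField O X) :
    Differentiable ℝ X := h.1.differentiable one_ne_zero

lemma IsTestField.mono {O O' : Set (Eu n)} {X : Eu n → Eu n} (h : IsTestField O X)
    (hO : O ⊆ O') : IsTestField O' X := ⟨h.1, h.2.1, h.2.2.trans hO⟩

lemma IsTestField.integrable_dv {O : Set (Eu n)} {X : Eu n → Eu n} (h : IsTestField O X) :
    Integrable (dv X) :=
  (dv_continuous h.1).integrable_of_hasCompactSupport (dv_hasCompactSupport h.2.1)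

lemma IsTestField.exists_dv_bound {O : Set (Eu n)} {X : Eu n → Eu n} (h : IsTestField O X) :
    ∃ B, 0 < B ∧ ∀ x, |dv X x| ≤ B := by
  obtain ⟨B, hB⟩ := (dv_continuous h.1).bounded_above_of_compact_support
    (dv_hasCompactSupport h.2.1)
  exact ⟨max B 1, by positivity, fun x => (hB x).trans (le_max_left _ _)⟩

lemma IsTestField.smul {O : Set (Eu n)} {X : Eu n → Eu n} (h : IsTestField O X)
    {g : Eu n → ℝ} (hg : ContDiff ℝ 1 g) : IsTestField O (fun x => g x • X x) := by
  refine ⟨hg.smul h.1, HasCompactSupport.smul_left (f := g) h.2.1, ?_⟩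
  exact (tsupport_smul_subset_right g X).trans h.2.2

lemma IsTestField.const_smul {O : Set (Eu n)} {X : Eu n → Eu n} (h : IsTestField O X)
    (c : ℝ) : IsTestField O (fun x => c • X x) :=
  h.smul contDiff_const

lemma IsTestField.add {O : Set (Eu n)} {X Y : Eu n → Eu n} (h : IsTestField O X)
    (h' : IsTestField O Y) : IsTestField O (fun x => X x + Y x) := by
  refine ⟨h.1.add h'.1, h.2.1.add h'.2.1, ?_⟩
  exact (tsupport_add X Y).trans (union_subset h.2.2 h'.2.2)

lemma isTestField_zero (O : Set (Eu n)) : IsTestField O (fun _ => (0 : Eu n)) := by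
  refine ⟨contDiff_const, HasCompactSupport.zero, ?_⟩
  have : tsupport (fun _ : Eu n => (0 : Eu n)) = ∅ := tsupport_eq_empty_iff.2 rfl
  rw [this]
  exact empty_subset _

lemma IsTestField.sum {O : Set (Eu n)} {ι : Type*} (s : Finset ι) {X : ι → Eu n → Eu n}
    (h : ∀ i ∈ s, IsTestField O (X i)) : IsTestField O (fun x => ∑ i ∈ s, X i x) := by
  classical
  induction s using Finset.induction_on with
  | empty => simpa using isTestField_zero O
  | insert a s ha ih =>
    simp only [Finset.sum_insert ha]
    exact (h a (by simp)).add (ih fun i hi => h i (by simp [hi]))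

lemma dv_sum {O : Set (Eu n)} {ι : Type*} (s : Finset ι) {X : ι → Eu n → Eu n}
    (h : ∀ i ∈ s, IsTestField O (X i)) (x : Eu n) :
    dv (fun x => ∑ i ∈ s, X i x) x = ∑ i ∈ s, dv (X i) x := by
  classical
  induction s using Finset.induction_on with
  | empty => simp [dv]
  | insert a s ha ih =>
    simp only [Finset.sum_insert ha]
    rw [dv_add (h a (by simp)).differentiable
      (IsTestField.sum s fun i hi => h i (by simp [hi])).differentiable,
      ih fun i hi => h i (by simp [hi])]

lemma integrable_mul_dv {f : Eu n → ℝ} (hf : Measurable f) {B : ℝ} (hB : ∀ x, |f x| ≤ B)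
    {O : Set (Eu n)} {X : Eu n → Eu n} (h : IsTestField O X) :
    Integrable (fun x => f x * dv X x) :=
  h.integrable_dv.bdd_mul hf.aestronglyMeasurable (ae_of_all _ hB)

/-- Integration by parts. -/
lemma integral_mul_dv {g : Eu n → ℝ} (hg : ContDiff ℝ 1 g) {O : Set (Eu n)}
    {X : Eu n → Eu n} (h : IsTestField O X) :
    ∫ x, g x * dv X x = - ∫ x, fderiv ℝ g x (X x) := by
  have hXi : ∀ i, ContDiff ℝ 1 (fun x => X x i) := fun i => by
    have := h.1
    fun_prop
  have hXs : ∀ i, HasCompactSupport (fun x => X x i) := fun i =>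
    h.2.1.comp_left (g := fun v : Eu n => v i) rfl
  have hfd : ∀ i x v, fderiv ℝ (fun x => X x i) x v = (fderiv ℝ X x v) i := by
    intro i x v
    have h1 : HasFDerivAt (fun x => X x i)
        ((EuclideanSpace.proj i : Eu n →L[ℝ] ℝ).comp (fderiv ℝ X x)) x :=
      (EuclideanSpace.proj i : Eu n →L[ℝ] ℝ).hasFDerivAt.comp x (h.differentiable x).hasFDerivAt
    rw [h1.fderiv]
    rfl
  have hgf := hg.continuous_fderiv one_ne_zero
  have e1 : ∀ i, Integrable (fun x => g x * (fderiv ℝ X x (EuclideanSpace.single i 1)) i) := by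
    intro i
    refine Continuous.integrable_of_hasCompactSupport ?_ ?_
    · have := h.1.continuous_fderiv one_ne_zero
      have := hg.continuous
      fun_prop
    · refine HasCompactSupport.mul_left (f := g) ?_
      exact (h.2.1.fderiv (𝕜 := ℝ)).comp_left
        (g := fun L : Eu n →L[ℝ] Eu n => (L (EuclideanSpace.single i 1)) i) (by simp)
  have e2 : ∀ i, Integrable (fun x => fderiv ℝ g x (EuclideanSpace.single i 1) * X x i) := by
    intro i
    have c1 : Continuous (fun x => fderiv ℝ g x (EuclideanSpace.single i 1)) := by fun_prop
    exact (c1.mul (hXi i).continuous).integrable_of_hasCompactSupport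
      (HasCompactSupport.mul_left (f := fun x => fderiv ℝ g x (EuclideanSpace.single i 1)) (hXs i))
  have e3 : ∀ i, ∫ x, g x * (fderiv ℝ X x (EuclideanSpace.single i 1)) i
      = - ∫ x, fderiv ℝ g x (EuclideanSpace.single i 1) * X x i := by
    intro i
    have := integral_mul_fderiv_eq_neg_fderiv_mul_of_integrable (μ := (volume : Measure (Eu n)))
      (f := g) (g := fun x => X x i) (v := EuclideanSpace.single i 1) (e2 i)
      (by simpa only [hfd] using e1 i)
      (((hg.continuous.mul (hXi i).continuous)).integrable_of_hasCompactSupport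
        (HasCompactSupport.mul_left (f := g) (hXs i))) (fun x _ => hg.differentiable one_ne_zero x)
      (fun x _ => (hXi i).differentiable one_ne_zero x)
    simpa only [hfd] using this
  calc ∫ x, g x * dv X x
      = ∫ x, ∑ i, g x * (fderiv ℝ X x (EuclideanSpace.single i 1)) i := by
        simp only [dv, Finset.mul_sum]
    _ = ∑ i, ∫ x, g x * (fderiv ℝ X x (EuclideanSpace.single i 1)) i :=
        integral_finsetSum _ fun i _ => e1 i
    _ = - ∑ i, ∫ x, fderiv ℝ g x (EuclideanSpace.single i 1) * X x i := by
        simp only [e3, Finset.sum_neg_distrib]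
    _ = - ∫ x, ∑ i, fderiv ℝ g x (EuclideanSpace.single i 1) * X x i := by
        rw [integral_finsetSum _ fun i _ => e2 i]
    _ = - ∫ x, fderiv ℝ g x (X x) := by
        congr 2
        ext x
        rw [map_eq_sum_single]

/-! ### Weighted variation -/

lemma VarLe.nonneg {f : Eu n → ℝ} {O : Set (Eu n)} {w : Eu n → ℝ} {M : ℝ}
    (h : VarLe f O w M) (hw : ∀ x, 0 ≤ w x) : 0 ≤ M := by
  have := h _ (isTestField_zero O) (by simpa using hw)
  simpa [dv] using this

lemma VarLe.mono_set {f : Eu n → ℝ} {O O' : Set (Eu n)} {w : Eu n → ℝ} {M : ℝ}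
    (h : VarLe f O w M) (hO : O' ⊆ O) : VarLe f O' w M :=
  fun X hX hXw => h X (hX.mono hO) hXw

lemma VarLe.le_mul {f : Eu n → ℝ} {O : Set (Eu n)} {w : Eu n → ℝ} {M : ℝ}
    (h : VarLe f O w M) {c : ℝ} (hc : 0 ≤ c) {X : Eu n → Eu n} (hX : IsTestField O X)
    (hXw : ∀ x, ‖X x‖ ≤ c * w x) : ∫ x, f x * dv X x ≤ c * M := by
  rcases hc.eq_or_lt with rfl | hc
  · have : X = fun _ => 0 := by
      ext1 x
      have := hXw x
      simpa using this
    simp [this, dv]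
  · have := h _ (hX.const_smul c⁻¹) (fun x => by
      rw [norm_smul, Real.norm_of_nonneg (by positivity)]
      rw [inv_mul_le_iff₀ hc]
      exact hXw x)
    simp only [dv_const_smul] at this
    have h2 : ∀ x, f x * (c⁻¹ * dv X x) = c⁻¹ * (f x * dv X x) := fun x => by ring
    simp only [h2, integral_const_mul] at this
    rwa [inv_mul_le_iff₀ hc] at this

end Divergence

/-! ### Convolution with a kernel and mollification -/

/-- Convolution of `f` with the scalar kernel `k`. -/
def kconv {n : ℕ} {F : Type*} [NormedAddCommGroup F] [NormedSpace ℝ F]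
    (k : Eu n → ℝ) (f : Eu n → F) (x : Eu n) : F := ∫ y, k (x - y) • f y

/-- The bump function underlying the mollifiers. -/
def mollBump (n j : ℕ) : ContDiffBump (0 : Eu n) where
  rIn := 1 / (2 * ((j : ℝ) + 1))
  rOut := 1 / ((j : ℝ) + 1)
  rIn_pos := by positivity
  rIn_lt_rOut := by
    have : (0 : ℝ) < (j : ℝ) + 1 := by positivity
    apply one_div_lt_one_div_of_lt this
    linarith

/-- The radius of the support of the `j`-th mollifier. -/
def mollRad (j : ℕ) : ℝ := 1 / ((j : ℝ) + 1)

/-- The `j`-th mollifier. -/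
def moll (n j : ℕ) : Eu n → ℝ := (mollBump n j).normed volume

lemma locallyIntegrable_of_bdd {n : ℕ} {F : Type*} [NormedAddCommGroup F] {f : Eu n → F} (hf : AEStronglyMeasurable f volume) {B : ℝ}
    (hB : ∀ x, ‖f x‖ ≤ B) : LocallyIntegrable f := by
  have : LocallyIntegrable (fun _ : Eu n => B) := locallyIntegrable_const B
  exact this.mono hf (ae_of_all _ fun x => (hB x).trans (le_abs_self B))

section Mollification

variable {n : ℕ} {F : Type*} [NormedAddCommGroup F] [NormedSpace ℝ F]

lemma kconv_eq_convolution (k : Eu n → ℝ) (f : Eu n → F) :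
    kconv k f = convolution f k (ContinuousLinearMap.lsmul ℝ ℝ).flip volume := by
  ext x
  rfl

lemma kconv_contDiff {k : Eu n → ℝ} (hk : ContDiff ℝ 1 k) (hks : HasCompactSupport k)
    {f : Eu n → F} (hf : LocallyIntegrable f) : ContDiff ℝ 1 (kconv k f) := by
  rw [kconv_eq_convolution]
  exact hks.contDiff_convolution_right (n := 1) _ hf hk

lemma integrable_kernel_smul {k : Eu n → ℝ} (hk : Continuous k) (hks : HasCompactSupport k)
    {f : Eu n → F} (hf : LocallyIntegrable f) (x : Eu n) :
    Integrable (fun y => k (x - y) • f y) := by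
  have h1 : Continuous (fun y => k (x - y)) := by fun_prop
  have h2 : HasCompactSupport (fun y => k (x - y)) :=
    hks.comp_homeomorph (Homeomorph.subLeft x)
  exact hf.integrable_smul_left_of_hasCompactSupport h1 h2

lemma kconv_fderiv {k : Eu n → ℝ} (hk : ContDiff ℝ 1 k) (hks : HasCompactSupport k)
    {f : Eu n → F} (hf : LocallyIntegrable f) (x v : Eu n) :
    fderiv ℝ (kconv k f) x v = ∫ y, fderiv ℝ k (x - y) v • f y := by
  rw [kconv_eq_convolution]
  rw [(hks.hasFDerivAt_convolution_right (ContinuousLinearMap.lsmul ℝ ℝ).flip hf hk x).fderiv]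
  have hintg : Integrable (fun t => ((ContinuousLinearMap.lsmul ℝ ℝ).flip.precompR (Eu n) (f t))
      (fderiv ℝ k (x - t))) :=
    (HasCompactSupport.convolutionExists_right _ (hks.fderiv (𝕜 := ℝ)) hf
      (hk.continuous_fderiv one_ne_zero)) x
  rw [convolution_def, ContinuousLinearMap.integral_apply hintg]
  rfl

lemma moll_nonneg (n j : ℕ) (x : Eu n) : 0 ≤ moll n j x := ContDiffBump.nonneg_normed _ _

lemma moll_contDiff (n j : ℕ) : ContDiff ℝ (⊤ : ℕ∞) (moll n j) := ContDiffBump.contDiff_normed _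

lemma moll_contDiff_one (n j : ℕ) : ContDiff ℝ 1 (moll n j) :=
  (moll_contDiff n j).of_le (by exact_mod_cast le_top)

lemma moll_continuous (n j : ℕ) : Continuous (moll n j) := (moll_contDiff n j).continuous

lemma moll_hasCompactSupport (n j : ℕ) : HasCompactSupport (moll n j) :=
  ContDiffBump.hasCompactSupport_normed _

lemma moll_neg (n j : ℕ) (x : Eu n) : moll n j (-x) = moll n j x := ContDiffBump.normed_neg _ _

lemma moll_sub_comm (n j : ℕ) (x y : Eu n) : moll n j (x - y) = moll n j (y - x) := by
  rw [← moll_neg, neg_sub]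

lemma moll_fderiv_neg (n j : ℕ) (x v : Eu n) :
    fderiv ℝ (moll n j) (-x) v = - fderiv ℝ (moll n j) x v := by
  have h : moll n j = fun x => moll n j (-x) := by
    ext x; rw [moll_neg]
  have h1 : HasFDerivAt (moll n j) (fderiv ℝ (moll n j) (-x)) (-x) :=
    ((moll_contDiff_one n j).differentiable one_ne_zero (-x)).hasFDerivAt
  have h2 : HasFDerivAt (fun x => moll n j (-x))
      ((fderiv ℝ (moll n j) (-x)).comp (-ContinuousLinearMap.id ℝ (Eu n))) x :=
    h1.comp x (hasFDerivAt_id x).neg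
  rw [← h] at h2
  conv_rhs => rw [h2.fderiv]
  simp

lemma moll_integral (n j : ℕ) : ∫ x, moll n j x = 1 := ContDiffBump.integral_normed _

lemma moll_integral_sub (n j : ℕ) (x : Eu n) : ∫ y, moll n j (x - y) = 1 := by
  rw [integral_sub_left_eq_self (moll n j) volume x, moll_integral]

lemma mollRad_pos (j : ℕ) : 0 < mollRad j := by unfold mollRad; positivity

lemma mollRad_tendsto : Tendsto mollRad atTop (𝓝 0) := tendsto_one_div_add_atTop_nhds_zero_nat

lemma moll_support (n j : ℕ) : Function.support (moll n j) = ball 0 (mollRad j) :=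
  ContDiffBump.support_normed_eq _

lemma moll_tsupport (n j : ℕ) : tsupport (moll n j) = closedBall 0 (mollRad j) :=
  ContDiffBump.tsupport_normed_eq _

lemma moll_eq_zero {j : ℕ} {x y : Eu n} (h : y ∉ ball x (mollRad j)) : moll n j (x - y) = 0 := by
  have : x - y ∉ Function.support (moll n j) := by
    rw [moll_support, mem_ball_zero_iff, ← dist_eq_norm, dist_comm]
    exact h
  simpa using this

lemma moll_integrable_sub (n j : ℕ) (x : Eu n) : Integrable (fun y => moll n j (x - y)) := by
  have h1 : Continuous (fun y => moll n j (x - y)) := by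
    have := moll_continuous n j
    fun_prop
  exact h1.integrable_of_hasCompactSupport
    ((moll_hasCompactSupport n j).comp_homeomorph (Homeomorph.subLeft x))

lemma moll_lower {j : ℕ} {x y : Eu n} (h : y ∈ ball x (mollRad j / 2)) :
    (volume.real (closedBall (0 : Eu n) (mollRad j)))⁻¹ ≤ moll n j (x - y) := by
  have h1 : (mollBump n j) (x - y) = 1 := by
    apply (mollBump n j).one_of_mem_closedBall
    rw [mem_closedBall_zero_iff, ← dist_eq_norm, dist_comm]
    have h2 : (mollBump n j).rIn = mollRad j / 2 := by
      simp only [mollBump, mollRad]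
      field_simp
    rw [h2]
    exact (mem_ball.1 h).le
  unfold moll
  rw [ContDiffBump.normed_def, h1, one_div]
  exact inv_anti₀ (ContDiffBump.integral_pos _)
    (ContDiffBump.integral_le_measure_closedBall _ _)

lemma kconv_moll_norm_le_of_ball {f : Eu n → F} (j : ℕ) (x : Eu n) {B : ℝ}
    (h : ∀ y ∈ ball x (mollRad j), ‖f y‖ ≤ B) : ‖kconv (moll n j) f x‖ ≤ B := by
  calc ‖kconv (moll n j) f x‖ ≤ ∫ y, moll n j (x - y) * B := by
        refine norm_integral_le_of_norm_le ((moll_integrable_sub n j x).mul_const B)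
          (ae_of_all _ fun y => ?_)
        rw [norm_smul, Real.norm_of_nonneg (moll_nonneg _ _ _)]
        by_cases hy : y ∈ ball x (mollRad j)
        · exact mul_le_mul_of_nonneg_left (h y hy) (moll_nonneg _ _ _)
        · rw [moll_eq_zero hy]; simp
    _ = B := by rw [integral_mul_const, moll_integral_sub, one_mul]

lemma kconv_moll_norm_le {f : Eu n → F} (j : ℕ) {B : ℝ} (h : ∀ y, ‖f y‖ ≤ B) (x : Eu n) :
    ‖kconv (moll n j) f x‖ ≤ B :=
  kconv_moll_norm_le_of_ball j x fun y _ => h y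

lemma kconv_moll_eq_zero {f : Eu n → F} (j : ℕ) (x : Eu n)
    (h : ∀ y ∈ ball x (mollRad j), f y = 0) : kconv (moll n j) f x = 0 := by
  have := kconv_moll_norm_le_of_ball (B := 0) j x (f := f) (fun y hy => by simp [h y hy])
  simpa using this

lemma kconv_moll_mem_Icc {f : Eu n → ℝ} (hf : LocallyIntegrable f) (j : ℕ) (x : Eu n) {a b : ℝ}
    (h : ∀ y ∈ ball x (mollRad j), f y ∈ Icc a b) : kconv (moll n j) f x ∈ Icc a b := by
  have hi := integrable_kernel_smul (moll_continuous n j) (moll_hasCompactSupport n j) hf x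
  have hm := moll_integrable_sub n j x
  constructor
  · calc a = ∫ y, moll n j (x - y) * a := by rw [integral_mul_const, moll_integral_sub, one_mul]
      _ ≤ _ := by
        refine integral_mono (hm.mul_const a) hi fun y => ?_
        by_cases hy : y ∈ ball x (mollRad j)
        · exact mul_le_mul_of_nonneg_left (h y hy).1 (moll_nonneg _ _ _)
        · simp [moll_eq_zero hy]
  · calc kconv (moll n j) f x
      _ ≤ ∫ y, moll n j (x - y) * b := by
        refine integral_mono hi (hm.mul_const b) fun y => ?_
        by_cases hy : y ∈ ball x (mollRad j)
        · exact mul_le_mul_of_nonneg_left (h y hy).2 (moll_nonneg _ _ _)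
        · simp [moll_eq_zero hy]
      _ = b := by rw [integral_mul_const, moll_integral_sub, one_mul]

lemma kconv_moll_ae_tendsto [CompleteSpace F] {f : Eu n → F} (hf : LocallyIntegrable f) :
    ∀ᵐ x, Tendsto (fun j => kconv (moll n j) f x) atTop (𝓝 (f x)) := by
  have h := ContDiffBump.ae_convolution_tendsto_right_of_locallyIntegrable
    (φ := fun j => mollBump n j) (l := atTop) (K := 2) (μ := (volume : Measure (Eu n)))
    mollRad_tendsto (Eventually.of_forall fun j => by
      simp only [mollBump]
      apply le_of_eq
      field_simp) hf
  filter_upwards [h] with x hx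
  refine hx.congr fun j => ?_
  rw [convolution_eq_swap]
  rfl

lemma uniform_mollify {φ : Eu n → ℝ} (hφ : Continuous φ) (hs : HasCompactSupport φ)
    {ω : ℝ} (hω : 0 < ω) : ∀ᶠ j in atTop, ∀ x y : Eu n, y ∈ ball x (mollRad j) →
      |φ y - φ x| ≤ ω := by
  have hu := hs.uniformContinuous_of_continuous hφ
  obtain ⟨δ, hδ, h⟩ := Metric.uniformContinuous_iff.1 hu ω hω
  filter_upwards [(tendsto_order.1 mollRad_tendsto).2 δ hδ] with j hj x y hy
  exact (h ((mem_ball.1 hy).trans hj)).le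

end Mollification

/-! ### Translations of functions of bounded variation -/

section Translation

variable {n : ℕ}

/-- The average of `ψ` over the segment from `x - y` to `x`. -/
def segAvg (ψ : Eu n → ℝ) (y x : Eu n) : ℝ := ∫ s in (0 : ℝ)..1, ψ (x - s • y)

lemma segAvg_contDiff {ψ : Eu n → ℝ} (hψ : ContDiff ℝ 1 ψ) (hs : HasCompactSupport ψ)
    (y : Eu n) : ContDiff ℝ 1 (segAvg ψ y) := by
  set m : Measure (Eu n) := (volume.restrict (Ioc (0 : ℝ) 1)).map (fun s => s • y) with hm
  have : IsFiniteMeasure m := by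
    rw [hm]
    infer_instance
  have h1 : segAvg ψ y = convolution (fun _ : Eu n => (1 : ℝ)) ψ
      (ContinuousLinearMap.lsmul ℝ ℝ) m := by
    ext x
    rw [convolution_def, hm, integral_map (by fun_prop)]
    · simp only [segAvg, intervalIntegral.integral_of_le zero_le_one,
        ContinuousLinearMap.lsmul_apply, one_smul]
    · have := hψ.continuous
      exact Continuous.aestronglyMeasurable (by fun_prop)
  rw [h1]
  exact hs.contDiff_convolution_right (n := 1) _ (locallyIntegrable_const 1) hψ

lemma segAvg_fderiv {ψ : Eu n → ℝ} (hψ : ContDiff ℝ 1 ψ) (hs : HasCompactSupport ψ)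
    (y x : Eu n) : fderiv ℝ (segAvg ψ y) x y = ψ x - ψ (x - y) := by
  have hc := hψ.continuous
  have h1 : HasDerivAt (fun t : ℝ => segAvg ψ y (x + t • y)) (fderiv ℝ (segAvg ψ y) x y) 0 := by
    have := ((segAvg_contDiff hψ hs y).differentiable one_ne_zero (x + (0 : ℝ) • y)).hasFDerivAt
    have h2 : HasDerivAt (fun t : ℝ => x + t • y) y 0 := by
      simpa using ((hasDerivAt_id (0 : ℝ)).smul_const y).const_add x
    have h3 := this.comp_hasDerivAt (0 : ℝ) h2
    simp only [zero_smul, add_zero] at h3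
    exact h3
  have h2 : ∀ t : ℝ, segAvg ψ y (x + t • y)
      = (∫ s in (0 : ℝ)..(1 - t), ψ (x - s • y)) - ∫ s in (0 : ℝ)..(-t), ψ (x - s • y) := by
    intro t
    have hcont : Continuous (fun s : ℝ => ψ (x - s • y)) := by fun_prop
    rw [intervalIntegral.integral_interval_sub_left
      (hcont.intervalIntegrable _ _) (hcont.intervalIntegrable _ _)]
    have := intervalIntegral.integral_comp_sub_right (a := 0) (b := 1)
      (fun s : ℝ => ψ (x - s • y)) t
    rw [show -t = 0 - t by ring, ← this]
    unfold segAvg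
    congr 1
    ext s
    congr 1
    module
  have h3 : HasDerivAt (fun t : ℝ => segAvg ψ y (x + t • y)) (ψ x - ψ (x - y)) 0 := by
    have hcont : Continuous (fun s : ℝ => ψ (x - s • y)) := by fun_prop
    have g : ∀ b : ℝ, HasDerivAt (fun u : ℝ => ∫ s in (0 : ℝ)..u, ψ (x - s • y))
        (ψ (x - b • y)) b := fun b =>
      intervalIntegral.integral_hasDerivAt_right (hcont.intervalIntegrable _ _)
        hcont.stronglyMeasurable.stronglyMeasurableAtFilter hcont.continuousAt
    have g1 : HasDerivAt (fun t : ℝ => 1 - t) (-1) 0 := by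
      simpa using (hasDerivAt_id (0 : ℝ)).const_sub 1
    have g2 : HasDerivAt (fun t : ℝ => -t) (-1) 0 := hasDerivAt_neg 0
    have k1 := (g (1 - 0)).comp (0 : ℝ) g1
    have k2 := (g (-0)).comp (0 : ℝ) g2
    have k3 := k1.sub k2
    refine (k3.congr_deriv ?_).congr_of_eventuallyEq (Eventually.of_forall fun t => h2 t)
    simp
    ring
  exact h1.unique h3

lemma segAvg_abs_le {ψ : Eu n → ℝ} (h : ∀ x, |ψ x| ≤ 1) (y x : Eu n) : |segAvg ψ y x| ≤ 1 := by
  have := intervalIntegral.norm_integral_le_of_norm_le_const (a := 0) (b := 1) (C := 1)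
    (f := fun s : ℝ => ψ (x - s • y)) (fun s _ => h _)
  simpa [segAvg] using this

lemma segAvg_support (ψ : Eu n → ℝ) (y : Eu n) :
    Function.support (segAvg ψ y) ⊆
      (fun p : Eu n × ℝ => p.1 + p.2 • y) '' (tsupport ψ ×ˢ Icc (0 : ℝ) 1) := by
  intro x hx
  by_contra hcon
  apply hx
  unfold segAvg
  rw [intervalIntegral.integral_of_le zero_le_one]
  refine setIntegral_eq_zero_of_forall_eq_zero fun s hs => ?_
  by_contra h
  apply hcon
  exact ⟨(x - s • y, s), ⟨subset_tsupport _ h, ⟨hs.1.le, hs.2⟩⟩, by simp⟩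

lemma VarLe.translate_smooth {f : Eu n → ℝ} {O : Set (Eu n)} {M : ℝ}
    (h : VarLe f O (fun _ => 1) M) {ψ : Eu n → ℝ} (hψ : ContDiff ℝ 1 ψ)
    (hs : HasCompactSupport ψ) (h1 : ∀ x, |ψ x| ≤ 1) (y : Eu n)
    (hO : ∀ x ∈ tsupport ψ, ∀ s ∈ Icc (0 : ℝ) 1, x + s • y ∈ O) :
    ∫ x, f x * (ψ x - ψ (x - y)) ≤ ‖y‖ * M := by
  have hcomp : IsCompact ((fun p : Eu n × ℝ => p.1 + p.2 • y) '' (tsupport ψ ×ˢ Icc (0 : ℝ) 1)) :=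
    (IsCompact.prod hs isCompact_Icc).image (by fun_prop)
  have hsub : Function.support (fun x => segAvg ψ y x • y) ⊆
      (fun p : Eu n × ℝ => p.1 + p.2 • y) '' (tsupport ψ ×ˢ Icc (0 : ℝ) 1) :=
    (Function.support_smul_subset_left (segAvg ψ y) (fun _ => y)).trans (segAvg_support ψ y)
  have hC := segAvg_contDiff hψ hs y
  have hX : IsTestField O (fun x => segAvg ψ y x • y) := by
    refine ⟨hC.smul contDiff_const,
      HasCompactSupport.of_support_subset_isCompact hcomp hsub, ?_⟩
    refine (closure_minimal hsub hcomp.isClosed).trans ?_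
    rintro _ ⟨p, hp, rfl⟩
    exact hO p.1 hp.1 p.2 hp.2
  have := h.le_mul (norm_nonneg y) hX (fun x => by
    rw [norm_smul, mul_one]
    have := segAvg_abs_le h1 y x
    exact mul_le_of_le_one_left (norm_nonneg y) this)
  simpa only [dv_smul_const (hC.differentiable one_ne_zero), segAvg_fderiv hψ hs] using this

lemma kconv_moll_hasCompactSupport {F : Type*} [NormedAddCommGroup F] [NormedSpace ℝ F]
    {f : Eu n → F} {S : Set (Eu n)} (hS : Bornology.IsBounded S)
    (h : ∀ x ∉ S, f x = 0) (j : ℕ) : HasCompactSupport (kconv (moll n j) f) ∧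
      tsupport (kconv (moll n j) f) ⊆ cthickening (mollRad j) S := by
  have hsub : Function.support (kconv (moll n j) f) ⊆ cthickening (mollRad j) S := by
    intro x hx
    by_contra hcon
    apply hx
    apply kconv_moll_eq_zero
    intro y hy
    apply h
    intro hyS
    apply hcon
    exact thickening_subset_cthickening _ _
      (mem_thickening_iff.2 ⟨y, hyS, by rw [dist_comm]; exact mem_ball.1 hy⟩)
  have hc : IsCompact (cthickening (mollRad j) S) :=
    isCompact_of_isClosed_isBounded isClosed_cthickening hS.cthickening
  exact ⟨HasCompactSupport.of_support_subset_isCompact hc hsub,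
    closure_minimal hsub isClosed_cthickening⟩

lemma VarLe.translate {f : Eu n → ℝ} (hf : Measurable f) {B : ℝ} (hB : ∀ x, |f x| ≤ B)
    {O : Set (Eu n)} {M : ℝ} (h : VarLe f O (fun _ => 1) M) {S : Set (Eu n)}
    (hSm : MeasurableSet S) (hS : Bornology.IsBounded S) {τ : ℝ} (hτ : 0 < τ)
    (hO : ∀ x ∈ S, ball x (2 * τ) ⊆ O) {y : Eu n} (hy : ‖y‖ ≤ τ) :
    ∫ x, f x * (S.indicator 1 x - S.indicator 1 (x - y)) ≤ ‖y‖ * M := by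
  set g : Eu n → ℝ := S.indicator 1 with hg
  have hg1 : ∀ x, ‖g x‖ ≤ 1 := by
    intro x
    rw [hg, Real.norm_eq_abs]
    by_cases hx : x ∈ S <;> simp [hx]
  have hgm : Measurable g := measurable_one.indicator hSm
  have hgl : LocallyIntegrable g := locallyIntegrable_of_bdd hgm.aestronglyMeasurable hg1
  have hg0 : ∀ x ∉ S, g x = 0 := fun x hx => by simp [hg, hx]
  have hle : ∀ᶠ j in atTop, ∫ x, f x * (kconv (moll n j) g x - kconv (moll n j) g (x - y))
      ≤ ‖y‖ * M := by
    filter_upwards [(tendsto_order.1 mollRad_tendsto).2 τ hτ] with j hj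
    obtain ⟨c1, c2⟩ := kconv_moll_hasCompactSupport hS hg0 j
    refine h.translate_smooth (kconv_contDiff (moll_contDiff_one n j)
      (moll_hasCompactSupport n j) hgl) c1 (kconv_moll_norm_le j hg1) y ?_
    intro x hx s hs
    have hx2 := c2 hx
    have hx3 : x ∈ thickening τ S := cthickening_subset_thickening' hτ hj S hx2
    obtain ⟨z, hz, hxz⟩ := mem_thickening_iff.1 hx3
    apply hO z hz
    rw [mem_ball]
    calc dist (x + s • y) z ≤ dist (x + s • y) x + dist x z := dist_triangle _ _ _
      _ = ‖s • y‖ + dist x z := by rw [dist_self_add_left]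
      _ < 2 * τ := by
        rw [norm_smul, Real.norm_of_nonneg hs.1]
        have := mul_le_of_le_one_left (norm_nonneg y) hs.2
        linarith
  have hae := kconv_moll_ae_tendsto (n := n) hgl
  have hae2 : ∀ᵐ x, Tendsto (fun j => kconv (moll n j) g (x - y)) atTop (𝓝 (g (x - y))) :=
    (measurePreserving_sub_right volume y).quasiMeasurePreserving.ae hae
  refine le_of_tendsto ?_ hle
  have hK : IsCompact (cthickening (1 + ‖y‖) S) :=
    isCompact_of_isClosed_isBounded isClosed_cthickening hS.cthickening
  have hB0 : 0 ≤ B := (abs_nonneg _).trans (hB 0)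
  refine tendsto_integral_of_dominated_convergence
    ((cthickening (1 + ‖y‖) S).indicator fun _ => B * 2) ?_ ?_ ?_ ?_
  · intro j
    have hc := (kconv_contDiff (moll_contDiff_one n j)
      (moll_hasCompactSupport n j) hgl).continuous
    exact (hf.mul (by fun_prop : Continuous fun x =>
      kconv (moll n j) g x - kconv (moll n j) g (x - y)).measurable).aestronglyMeasurable
  · rw [integrable_indicator_iff isClosed_cthickening.measurableSet]
    exact integrableOn_const hK.measure_lt_top.ne
  · intro j
    refine ae_of_all _ fun x => ?_
    have hr : mollRad j ≤ 1 := by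
      unfold mollRad
      rw [div_le_one (by positivity)]
      linarith [(Nat.cast_nonneg j : (0 : ℝ) ≤ j)]
    have hsupp := (kconv_moll_hasCompactSupport hS hg0 j).2
    by_cases hx : x ∈ cthickening (1 + ‖y‖) S
    · rw [indicator_of_mem hx, norm_mul]
      refine mul_le_mul (hB x) ?_ (norm_nonneg _) hB0
      refine (norm_sub_le _ _).trans ?_
      linarith [kconv_moll_norm_le j hg1 x, kconv_moll_norm_le j hg1 (x - y)]
    · rw [indicator_of_notMem hx]
      have e1 : kconv (moll n j) g x = 0 := by
        by_contra hcon
        apply hx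
        exact cthickening_mono (by linarith [norm_nonneg y]) S
          (hsupp (subset_tsupport _ hcon))
      have e2 : kconv (moll n j) g (x - y) = 0 := by
        by_contra hcon
        apply hx
        have h1 : x - y ∈ cthickening 1 S := cthickening_mono hr S (hsupp (subset_tsupport _ hcon))
        have h2 : x ∈ cthickening ‖y‖ (cthickening 1 S) :=
          mem_cthickening_of_dist_le x (x - y) _ _ h1 (by simp)
        have h3 := cthickening_cthickening_subset (norm_nonneg y) (zero_le_one (α := ℝ)) S h2
        rwa [add_comm] at h3
      simp [e1, e2]
  · filter_upwards [hae, hae2] with x h1 h2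
    exact (h1.sub h2).const_mul _

/-- A set on which `f = 1` while `f` has small averages at scale `τ` is small. -/
lemma VarLe.volume_le {f : Eu n → ℝ} (hf : Measurable f) (h0 : ∀ x, 0 ≤ f x)
    (h1 : ∀ x, f x ≤ 1) {O : Set (Eu n)} {M : ℝ} (h : VarLe f O (fun _ => 1) M)
    {S : Set (Eu n)} (hSm : MeasurableSet S) (hS : Bornology.IsBounded S) {τ : ℝ} (hτ : 0 < τ)
    (hO : ∀ x ∈ S, ball x (2 * τ) ⊆ O) (hfS : ∀ x ∈ S, f x = 1)
    (hd : ∀ x ∈ S, ∫ z in ball x τ, f z ≤ volume.real (ball (0 : Eu n) τ) / 2) :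
    volume.real S ≤ 2 * τ * M := by
  have hM : 0 ≤ M := h.nonneg fun _ => zero_le_one
  have hfb : ∀ x, |f x| ≤ 1 := fun x => by rw [abs_of_nonneg (h0 x)]; exact h1 x
  have hSf : volume S < ⊤ := hS.measure_lt_top
  set W := volume.real (ball (0 : Eu n) τ) with hW
  have hWpos : 0 < W := by
    rw [hW, measureReal_def]
    exact ENNReal.toReal_pos (measure_ball_pos _ _ hτ).ne' measure_ball_lt_top.ne
  have hifS : ∀ y : Eu n, IntegrableOn (fun x => f (x + y)) S := fun y =>
    Measure.integrableOn_of_bounded (M := 1) hSf.ne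
      (Measurable.aestronglyMeasurable (by fun_prop)) (ae_of_all _ fun x => hfb _)
  have key : ∀ y : Eu n, ‖y‖ ≤ τ → volume.real S - ∫ x in S, f (x + y) ≤ τ * M := by
    intro y hy
    have ht := h.translate hf hfb hSm hS hτ hO hy
    have e1 : ∀ x, f x * (S.indicator 1 x - S.indicator 1 (x - y))
        = S.indicator f x - (S.indicator (fun z => f (z + y))) (x - y) := by
      intro x
      by_cases hx : x ∈ S <;> by_cases hx' : x - y ∈ S <;> simp [hx, hx']
    have i1 : Integrable (S.indicator f) := by
      rw [integrable_indicator_iff hSm]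
      simpa using hifS 0
    have i2 : Integrable (S.indicator (fun z => f (z + y))) := by
      rw [integrable_indicator_iff hSm]
      exact hifS y
    simp only [e1] at ht
    rw [integral_sub i1 (i2.comp_sub_right y),
      integral_sub_right_eq_self (S.indicator fun z => f (z + y)) y, integral_indicator hSm,
      integral_indicator hSm, setIntegral_congr_fun hSm (g := fun _ => (1 : ℝ)) hfS] at ht
    simp only [integral_const, smul_eq_mul, mul_one, measureReal_restrict_apply_univ] at ht
    exact ht.trans (mul_le_mul_of_nonneg_right hy hM)
  have hfin : IsFiniteMeasure (volume.restrict S) := ⟨by simpa using hSf⟩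
  have hfin2 : IsFiniteMeasure (volume.restrict (ball (0 : Eu n) τ)) :=
    ⟨by simpa using measure_ball_lt_top⟩
  have hprod : Integrable (fun p : Eu n × Eu n => f (p.2 + p.1))
      ((volume.restrict (ball (0 : Eu n) τ)).prod (volume.restrict S)) := by
    refine Integrable.of_bound (C := 1) ?_ (ae_of_all _ fun p => hfb _)
    exact Measurable.aestronglyMeasurable (by fun_prop)
  have hI : ∫ y in ball (0 : Eu n) τ, ∫ x in S, f (x + y) ≤ W / 2 * volume.real S := by
    rw [integral_integral_swap hprod]
    calc ∫ x in S, ∫ y in ball (0 : Eu n) τ, f (x + y) ≤ ∫ x in S, W / 2 := by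
          refine setIntegral_mono_on hprod.integral_prod_right (integrable_const _) hSm ?_
          intro x hx
          refine le_trans (le_of_eq ?_) (hd x hx)
          have : ball x τ = (fun y => x + y) '' ball (0 : Eu n) τ := by
            simp [Set.image_add_left, preimage_add_ball]
          rw [this, (measurePreserving_add_left volume x).setIntegral_image_emb
            (measurableEmbedding_addLeft x)]
      _ = W / 2 * volume.real S := by simp [mul_comm]
  have hII : W * volume.real S - ∫ y in ball (0 : Eu n) τ, ∫ x in S, f (x + y)
      ≤ W * (τ * M) := by
    have : ∫ y in ball (0 : Eu n) τ, (volume.real S - ∫ x in S, f (x + y))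
        ≤ ∫ y in ball (0 : Eu n) τ, τ * M := by
      refine setIntegral_mono_on ((integrable_const _).sub hprod.integral_prod_left)
        (integrable_const _) measurableSet_ball ?_
      intro y hy
      exact key y (mem_ball_zero_iff.1 hy).le
    rw [integral_sub (integrable_const _) hprod.integral_prod_left] at this
    simpa using this
  have : W * volume.real S ≤ W * (2 * τ * M) := by linarith
  exact le_of_mul_le_mul_left this hWpos

end Translation

/-! ### A polynomial kernel and the associated cutoff functions -/

section Kernel

variable {n : ℕ}

lemma hasDerivAt_max_zero_pow (k : ℕ) (s : ℝ) :
    HasDerivAt (fun s : ℝ => max 0 s ^ (k + 2)) ((k + 2 : ℝ) * max 0 s ^ (k + 1)) s := by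
  rcases lt_trichotomy s 0 with hs | rfl | hs
  · have h : (fun s : ℝ => max 0 s ^ (k + 2)) =ᶠ[𝓝 s] fun _ => 0 := by
      filter_upwards [Iio_mem_nhds hs] with x hx
      rw [max_eq_left (le_of_lt hx)]; simp
    rw [max_eq_left hs.le]
    simpa using (hasDerivAt_const s (0 : ℝ)).congr_of_eventuallyEq h
  · have h : (fun s : ℝ => max 0 s ^ (k + 2)) =O[𝓝 0] fun s => s ^ 2 := by
      refine Asymptotics.IsBigO.of_bound 1 ?_
      filter_upwards [Iio_mem_nhds (zero_lt_one (α := ℝ))] with x hx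
      rw [norm_pow, one_mul, norm_pow, Real.norm_of_nonneg (le_max_left _ _)]
      calc max 0 x ^ (k + 2) ≤ max 0 x ^ 2 :=
            pow_le_pow_of_le_one (le_max_left _ _) (max_le zero_le_one (le_of_lt hx)) (by omega)
        _ ≤ ‖x‖ ^ 2 := by
            gcongr
            exact max_le (norm_nonneg _) (le_abs_self _)
    have h2 : HasDerivAt (fun s : ℝ => max 0 s ^ (k + 2)) 0 0 := by
      rw [hasDerivAt_iff_isLittleO]
      have := h.trans_isLittleO (Asymptotics.isLittleO_pow_id (one_lt_two))
      simpa using this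
    simpa using h2
  · have h : (fun s : ℝ => max 0 s ^ (k + 2)) =ᶠ[𝓝 s] fun s => s ^ (k + 2) := by
      filter_upwards [Ioi_mem_nhds hs] with x hx
      rw [max_eq_right (le_of_lt hx)]
    rw [max_eq_right hs.le]
    have := (hasDerivAt_pow (k + 2) s).congr_of_eventuallyEq h
    simpa using this

lemma contDiff_max_zero_pow (k : ℕ) : ContDiff ℝ 1 (fun s : ℝ => max 0 s ^ (k + 2)) := by
  rw [contDiff_one_iff_deriv]
  refine ⟨fun s => (hasDerivAt_max_zero_pow k s).differentiableAt, ?_⟩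
  have : deriv (fun s : ℝ => max 0 s ^ (k + 2)) = fun s => (k + 2 : ℝ) * max 0 s ^ (k + 1) :=
    funext fun s => (hasDerivAt_max_zero_pow k s).deriv
  rw [this]
  fun_prop

/-- The kernel `(1 - |z|² / ε²)₊ ^ (2n+2)`. -/
def polyKer (n : ℕ) (ε : ℝ) (z : Eu n) : ℝ := max 0 (1 - ‖ε⁻¹ • z‖ ^ 2) ^ (2 * n + 2)

lemma polyKer_nonneg (ε : ℝ) (z : Eu n) : 0 ≤ polyKer n ε z := by
  unfold polyKer; positivity

lemma polyKer_le_one (ε : ℝ) (z : Eu n) : polyKer n ε z ≤ 1 := by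
  unfold polyKer
  refine pow_le_one₀ (le_max_left _ _) (max_le zero_le_one ?_)
  nlinarith [sq_nonneg ‖ε⁻¹ • z‖]

lemma polyKer_contDiff (ε : ℝ) : ContDiff ℝ 1 (polyKer n ε) := by
  have h : ContDiff ℝ 1 (fun z : Eu n => 1 - ‖ε⁻¹ • z‖ ^ 2) := by
    have : ContDiff ℝ 1 (fun z : Eu n => ε⁻¹ • z) := by fun_prop
    exact contDiff_const.sub (this.norm_sq ℝ)
  exact (contDiff_max_zero_pow (2 * n)).comp h

lemma polyKer_eq_zero {ε : ℝ} (hε : 0 < ε) {z : Eu n} (hz : ε ≤ ‖z‖) : polyKer n ε z = 0 := by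
  unfold polyKer
  have : 1 ≤ ‖ε⁻¹ • z‖ := by
    rw [norm_smul, norm_inv, Real.norm_of_nonneg hε.le, ← div_eq_inv_mul, one_le_div hε]
    exact hz
  rw [max_eq_left (by nlinarith)]
  simp

lemma polyKer_hasCompactSupport {ε : ℝ} (hε : 0 < ε) : HasCompactSupport (polyKer n ε) := by
  refine HasCompactSupport.intro (isCompact_closedBall (0 : Eu n) ε) fun z hz => ?_
  apply polyKer_eq_zero hε
  simp only [mem_closedBall, dist_zero_right, not_le] at hz
  exact hz.le

lemma polyKer_lower {ε : ℝ} (hε : 0 < ε) {z : Eu n} (hz : ‖z‖ ≤ ε / 2) :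
    (3 / 4 : ℝ) ^ (2 * n + 2) ≤ polyKer n ε z := by
  unfold polyKer
  have : ‖ε⁻¹ • z‖ ≤ 1 / 2 := by
    rw [norm_smul, norm_inv, Real.norm_of_nonneg hε.le, ← div_eq_inv_mul, div_le_iff₀ hε]
    linarith
  refine pow_le_pow_left₀ (by norm_num) (le_max_of_le_right ?_) _
  nlinarith [norm_nonneg (ε⁻¹ • z)]

lemma polyKer_fderiv_le {ε : ℝ} (hε : 0 < ε) {t : ℝ} (ht : 0 < t) (z v : Eu n) :
    |fderiv ℝ (polyKer n ε) z v| ≤ (4 * n + 4) * ‖v‖ / ε *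
      (polyKer n ε z / t + (closedBall (0 : Eu n) ε).indicator (fun _ => t ^ (2 * n + 1)) z) := by
  have hin : HasFDerivAt (fun z : Eu n => 1 - ‖ε⁻¹ • z‖ ^ 2)
      (-((2 : ℕ) • ((innerSL ℝ) (ε⁻¹ • z)).comp (ε⁻¹ • ContinuousLinearMap.id ℝ (Eu n)))) z := by
    have h1 : HasFDerivAt (fun z : Eu n => ε⁻¹ • z) (ε⁻¹ • ContinuousLinearMap.id ℝ (Eu n)) z :=
      (ε⁻¹ • ContinuousLinearMap.id ℝ (Eu n)).hasFDerivAt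
    exact (h1.norm_sq).const_sub 1
  have hd := (hasDerivAt_max_zero_pow (2 * n) (1 - ‖ε⁻¹ • z‖ ^ 2)).comp_hasFDerivAt z hin
  have hfd : fderiv ℝ (polyKer n ε) z = _ := hd.fderiv
  rw [hfd]
  set m := max 0 (1 - ‖ε⁻¹ • z‖ ^ 2) with hm
  have hm0 : 0 ≤ m := le_max_left _ _
  have hker : polyKer n ε z = m ^ (2 * n + 2) := rfl
  have hval : |((((2 * n : ℕ) : ℝ) + 2) * m ^ (2 * n + 1)) •
      (-((2 : ℕ) • ((innerSL ℝ) (ε⁻¹ • z)).comp (ε⁻¹ • ContinuousLinearMap.id ℝ (Eu n)))) v|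
      = (4 * n + 4) * m ^ (2 * n + 1) * |⟪ε⁻¹ • z, ε⁻¹ • v⟫| := by
    simp only [neg_apply, smul_apply,
      ContinuousLinearMap.comp_apply, innerSL_apply_apply, ContinuousLinearMap.id_apply,
      smul_eq_mul, nsmul_eq_mul, abs_mul, abs_neg]
    rw [abs_of_nonneg (by positivity : (0 : ℝ) ≤ ((2 * n : ℕ) : ℝ) + 2),
      abs_of_nonneg (by positivity : (0 : ℝ) ≤ m ^ (2 * n + 1))]
    push_cast
    rw [abs_of_nonneg (by positivity : (0 : ℝ) ≤ 2)]
    ring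
  have hgoal : |((((2 * n : ℕ) : ℝ) + 2) * m ^ (2 * n + 1)) •
      (-((2 : ℕ) • ((innerSL ℝ) (ε⁻¹ • z)).comp (ε⁻¹ • ContinuousLinearMap.id ℝ (Eu n)))) v|
      ≤ (4 * n + 4) * ‖v‖ / ε *
      (polyKer n ε z / t +
        (closedBall (0 : Eu n) ε).indicator (fun _ => t ^ (2 * n + 1)) z) := by
    rw [hval, hker]
    by_cases hz : z ∈ closedBall (0 : Eu n) ε
    · rw [indicator_of_mem hz]
      have hzn : ‖ε⁻¹ • z‖ ≤ 1 := by
        rw [norm_smul, norm_inv, Real.norm_of_nonneg hε.le, ← div_eq_inv_mul, div_le_one hε]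
        simpa using hz
      have hin2 : |⟪ε⁻¹ • z, ε⁻¹ • v⟫| ≤ ‖v‖ / ε := by
        refine (abs_real_inner_le_norm _ _).trans ?_
        rw [norm_smul ε⁻¹ v, norm_inv, Real.norm_of_nonneg hε.le, ← div_eq_inv_mul]
        exact mul_le_of_le_one_left (by positivity) hzn
      have hyoung : m ^ (2 * n + 1) ≤ m ^ (2 * n + 2) / t + t ^ (2 * n + 1) := by
        rcases le_total t m with h | h
        · have : m ^ (2 * n + 1) ≤ m ^ (2 * n + 2) / t := by
            rw [le_div_iff₀ ht, pow_succ m (2 * n + 1)]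
            exact mul_le_mul_of_nonneg_left h (by positivity)
          have h2 : 0 < t ^ (2 * n + 1) := by positivity
          linarith
        · have : m ^ (2 * n + 1) ≤ t ^ (2 * n + 1) := pow_le_pow_left₀ hm0 h _
          have h2 : 0 ≤ m ^ (2 * n + 2) / t := by positivity
          linarith
      calc (4 * n + 4) * m ^ (2 * n + 1) * |⟪ε⁻¹ • z, ε⁻¹ • v⟫|
          ≤ (4 * n + 4) * (m ^ (2 * n + 2) / t + t ^ (2 * n + 1)) * (‖v‖ / ε) := by gcongr
        _ = _ := by ring
    · have : m = 0 := by
        have h := polyKer_eq_zero hε (z := z) (by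
          simp only [mem_closedBall, dist_zero_right, not_le] at hz
          exact hz.le)
        rw [hker] at h
        exact pow_eq_zero_iff (by omega) |>.1 h
      rw [indicator_of_notMem hz, this]
      simp
  exact_mod_cast hgoal

/-- Smoothed mass of `E` at scale `ε`. -/
def smoothMass (E : Set (Eu n)) (ε : ℝ) : Eu n → ℝ := kconv (polyKer n ε) (E.indicator fun _ => 1)

lemma indicator_one_norm_le (E : Set (Eu n)) (x : Eu n) :
    ‖E.indicator (fun _ => (1 : ℝ)) x‖ ≤ 1 := by
  by_cases hx : x ∈ E <;> simp [hx]

lemma indicator_one_locallyIntegrable {E : Set (Eu n)} (hE : MeasurableSet E) :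
    LocallyIntegrable (E.indicator fun _ => (1 : ℝ)) :=
  locallyIntegrable_of_bdd (measurable_const.indicator hE).aestronglyMeasurable
    (indicator_one_norm_le E)

lemma smoothMass_contDiff {E : Set (Eu n)} (hE : MeasurableSet E) {ε : ℝ} (hε : 0 < ε) :
    ContDiff ℝ 1 (smoothMass E ε) :=
  kconv_contDiff (polyKer_contDiff ε) (polyKer_hasCompactSupport hε)
    (indicator_one_locallyIntegrable hE)

lemma integrable_smoothMass {E : Set (Eu n)} (hE : MeasurableSet E) {ε : ℝ} (hε : 0 < ε)
    (x : Eu n) :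
    Integrable (fun y => polyKer n ε (x - y) • E.indicator (fun _ => (1 : ℝ)) y) :=
  integrable_kernel_smul (polyKer_contDiff ε).continuous (polyKer_hasCompactSupport hε)
    (indicator_one_locallyIntegrable hE) x

lemma integral_indicator_one_real {S : Set (Eu n)} (hS : MeasurableSet S) :
    ∫ y, S.indicator (fun _ => (1 : ℝ)) y = volume.real S := by
  rw [integral_indicator hS]
  simp

lemma integrable_indicator_ball {S : Set (Eu n)} (hS : MeasurableSet S) {T : Set (Eu n)}
    (hT : volume T < ⊤) (hST : S ⊆ T) (c : ℝ) : Integrable (S.indicator fun _ => c) := by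
  rw [integrable_indicator_iff hS]
  exact integrableOn_const ((measure_mono hST).trans_lt hT).ne

lemma smoothMass_le {E : Set (Eu n)} (hE : MeasurableSet E) {ε : ℝ} (hε : 0 < ε) (x : Eu n) :
    smoothMass E ε x ≤ volume.real (E ∩ ball x ε) := by
  rw [← integral_indicator_one_real (hE.inter measurableSet_ball)]
  refine integral_mono (integrable_smoothMass hE hε x) (integrable_indicator_ball
    (hE.inter measurableSet_ball) measure_ball_lt_top inter_subset_right 1) fun y => ?_
  by_cases hy : y ∈ E
  · by_cases hy2 : y ∈ ball x ε
    · simpa [hy, mem_ball.1 hy2] using polyKer_le_one ε (x - y)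
    · have : polyKer n ε (x - y) = 0 := polyKer_eq_zero hε (by
        rw [← dist_eq_norm, dist_comm]
        simpa using hy2)
      simp [this, hy2]
  · simp [hy]

lemma volume_le_smoothMass {E : Set (Eu n)} (hE : MeasurableSet E) {ε : ℝ} (hε : 0 < ε)
    (x : Eu n) : volume.real (E ∩ ball x (ε / 2)) ≤ (4 / 3 : ℝ) ^ (2 * n + 2) * smoothMass E ε x := by
  rw [← integral_indicator_one_real (hE.inter measurableSet_ball), smoothMass, kconv,
    ← integral_const_mul]
  refine integral_mono (integrable_indicator_ball
    (hE.inter measurableSet_ball) measure_ball_lt_top inter_subset_right 1)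
    ((integrable_smoothMass hE hε x).const_mul _) fun y => ?_
  have h0 := polyKer_nonneg (n := n) ε (x - y)
  by_cases hy : y ∈ E
  · by_cases hy2 : y ∈ ball x (ε / 2)
    · have h1 := polyKer_lower (n := n) hε (z := x - y) (by
        rw [← dist_eq_norm, dist_comm]
        exact (mem_ball.1 hy2).le)
      have h2 : (4 / 3 : ℝ) ^ (2 * n + 2) * (3 / 4 : ℝ) ^ (2 * n + 2) = 1 := by
        rw [← mul_pow]; norm_num
      have h3 : (1 : ℝ) ≤ (4 / 3 : ℝ) ^ (2 * n + 2) * polyKer n ε (x - y) := by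
        rw [← h2]; gcongr
      simpa [hy, mem_ball.1 hy2] using h3
    · have : (0 : ℝ) ≤ (4 / 3 : ℝ) ^ (2 * n + 2) * polyKer n ε (x - y) := by positivity
      rw [indicator_of_notMem (fun h => hy2 h.2)]
      simpa [hy] using this
  · simp [hy]

lemma volume_real_ball (x : Eu n) {r : ℝ} (hr : 0 < r) :
    volume.real (ball x r) = r ^ n * volume.real (ball (0 : Eu n) 1) := by
  rw [measureReal_def, measureReal_def, Measure.addHaar_ball_of_pos volume x hr,
    ENNReal.toReal_mul, ENNReal.toReal_ofReal (by positivity)]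
  simp

lemma volume_real_closedBall (x : Eu n) {r : ℝ} (hr : 0 < r) :
    volume.real (closedBall x r) = r ^ n * volume.real (ball (0 : Eu n) 1) := by
  rw [measureReal_def, measureReal_def, Measure.addHaar_closedBall volume x hr.le,
    ENNReal.toReal_mul, ENNReal.toReal_ofReal (by positivity)]
  simp

lemma smoothMass_fderiv_le {E : Set (Eu n)} (hE : MeasurableSet E) {ε : ℝ} (hε : 0 < ε) {t : ℝ}
    (ht : 0 < t) (x v : Eu n) :
    |fderiv ℝ (smoothMass E ε) x v| ≤ (4 * n + 4) * ‖v‖ / ε *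
      (smoothMass E ε x / t + t ^ (2 * n + 1) * (ε ^ n * volume.real (ball (0 : Eu n) 1))) := by
  have hloc := indicator_one_locallyIntegrable hE
  rw [smoothMass, kconv_fderiv (polyKer_contDiff ε) (polyKer_hasCompactSupport hε) hloc]
  have hb : ∀ y, (closedBall (0 : Eu n) ε).indicator (fun _ => t ^ (2 * n + 1)) (x - y)
      = (closedBall x ε).indicator (fun _ => t ^ (2 * n + 1)) y := by
    intro y
    by_cases hy : y ∈ closedBall x ε
    · rw [indicator_of_mem hy, indicator_of_mem]
      rwa [mem_closedBall_zero_iff, ← dist_eq_norm, dist_comm]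
    · rw [indicator_of_notMem hy, indicator_of_notMem]
      rwa [mem_closedBall_zero_iff, ← dist_eq_norm, dist_comm]
  have hi := integrable_smoothMass hE hε x
  have hi2 : Integrable ((closedBall x ε).indicator fun _ => t ^ (2 * n + 1)) :=
    integrable_indicator_ball measurableSet_closedBall measure_closedBall_lt_top subset_rfl _
  have hval : ∫ y, (4 * n + 4) * ‖v‖ / ε *
      ((polyKer n ε (x - y) • E.indicator (fun _ => (1 : ℝ)) y) / t
        + (closedBall x ε).indicator (fun _ => t ^ (2 * n + 1)) y)
      = (4 * n + 4) * ‖v‖ / ε * (kconv (polyKer n ε) (E.indicator fun _ => 1) x / t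
        + t ^ (2 * n + 1) * (ε ^ n * volume.real (ball (0 : Eu n) 1))) := by
    rw [integral_const_mul, integral_add (hi.div_const t) hi2, integral_div,
      integral_indicator measurableSet_closedBall]
    simp only [integral_const, measureReal_restrict_apply_univ, smul_eq_mul,
      volume_real_closedBall x hε, kconv]
    ring
  rw [← hval, ← Real.norm_eq_abs]
  refine norm_integral_le_of_norm_le (((hi.div_const t).add hi2).const_mul _)
    (ae_of_all _ fun y => ?_)
  have h1 := polyKer_fderiv_le (n := n) hε ht (x - y) v
  rw [hb] at h1
  by_cases hy : y ∈ E
  · simpa [hy] using h1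
  · have : 0 ≤ (closedBall x ε).indicator (fun _ => t ^ (2 * n + 1)) y :=
      indicator_nonneg (fun _ _ => by positivity) y
    simp only [indicator_of_notMem hy, smul_zero, norm_zero, zero_div, zero_add]
    positivity

lemma exists_step : ∃ (β : ℝ → ℝ) (K : ℝ), ContDiff ℝ (⊤ : ℕ∞) β ∧ 0 < K ∧
    (∀ s, β s ∈ Icc (0 : ℝ) 1) ∧ (∀ s, s ≤ 0 → β s = 0) ∧ (∀ s, 1 ≤ s → β s = 1) ∧
    ∀ s, 0 ≤ deriv β s ∧ deriv β s ≤ K := by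
  have hc : ContDiff ℝ (⊤ : ℕ∞) Real.smoothTransition := Real.smoothTransition.contDiff
  have hcd : Continuous (deriv Real.smoothTransition) :=
    hc.continuous_deriv (by exact_mod_cast le_top)
  obtain ⟨K, hK⟩ := (isCompact_Icc (a := (0 : ℝ)) (b := 1)).exists_bound_of_continuousOn
    hcd.continuousOn
  refine ⟨Real.smoothTransition, max K 1, hc, by positivity, fun s =>
    ⟨Real.smoothTransition.nonneg s, Real.smoothTransition.le_one s⟩,
    fun s hs => Real.smoothTransition.zero_of_nonpos hs,
    fun s hs => Real.smoothTransition.one_of_one_le hs, fun s => ⟨?_, ?_⟩⟩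
  · exact (Real.smoothTransition.monotone).deriv_nonneg
  · by_cases hs : s ∈ Icc (0 : ℝ) 1
    · exact ((le_abs_self _).trans (hK s hs)).trans (le_max_left _ _)
    · have hz : deriv Real.smoothTransition s = 0 := by
        rw [mem_Icc, not_and_or, not_le, not_le] at hs
        rcases hs with hs | hs
        · have : Real.smoothTransition =ᶠ[𝓝 s] fun _ => 0 := by
            filter_upwards [Iio_mem_nhds hs] with x hx
            exact Real.smoothTransition.zero_of_nonpos (le_of_lt hx)
          rw [this.deriv_eq]; simp
        · have : Real.smoothTransition =ᶠ[𝓝 s] fun _ => 1 := by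
            filter_upwards [Ioi_mem_nhds hs] with x hx
            exact Real.smoothTransition.one_of_one_le (le_of_lt hx)
          rw [this.deriv_eq]; simp
      rw [hz]; positivity

end Kernel

/-! ### The variation of a set in regions of low density -/

section LowDensity

variable {n : ℕ}

/-- The optimal constant in `VarLe`, together with near optimal fields. -/
lemma VarLe.exists_optimal {f : Eu n → ℝ} {O : Set (Eu n)} {w : Eu n → ℝ} {M : ℝ}
    (h : VarLe f O w M) (hw : ∀ x, 0 ≤ w x) :
    ∃ V ≤ M, VarLe f O w V ∧ ∀ η > 0, ∃ X, IsTestField O X ∧ (∀ x, ‖X x‖ ≤ w x) ∧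
      V - η < ∫ x, f x * dv X x := by
  set s : Set ℝ := {a | ∃ X, IsTestField O X ∧ (∀ x, ‖X x‖ ≤ w x) ∧ a = ∫ x, f x * dv X x} with hs
  have hne : s.Nonempty := ⟨_, _, isTestField_zero O, by simpa using hw, rfl⟩
  have hbd : M ∈ upperBounds s := by
    rintro _ ⟨X, hX, hXw, rfl⟩
    exact h X hX hXw
  refine ⟨sSup s, csSup_le hne hbd, fun X hX hXw => le_csSup ⟨M, hbd⟩ ⟨X, hX, hXw, rfl⟩, ?_⟩
  intro η hη
  obtain ⟨_, ⟨X, hX, hXw, rfl⟩, hlt⟩ := exists_lt_of_lt_csSup hne (sub_lt_self (sSup s) hη)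
  exact ⟨X, hX, hXw, hlt⟩

lemma volume_real_ball_one_pos : 0 < volume.real (ball (0 : Eu n) 1) := by
  rw [measureReal_def]
  exact ENNReal.toReal_pos (measure_ball_pos _ _ one_pos).ne' measure_ball_lt_top.ne

lemma volume_smoothMass_small {E U : Set (Eu n)} (hE : MeasurableSet E) {M : ℝ}
    (hV : VarLe (E.indicator fun _ => 1) U (fun _ => 1) M) {t ε : ℝ} (ht : 0 < t) (hε : 0 < ε)
    (ht1 : t ^ 2 ≤ 1 / 2)
    (ht2 : (4 / 3 : ℝ) ^ (2 * n + 2) * 2 * t ^ 2 ≤ volume.real (ball (0 : Eu n) 1) / 2)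
    {T : Set (Eu n)} (hT : MeasurableSet T) (hTb : Bornology.IsBounded T)
    (hTU : ∀ x ∈ T, ball x (2 * (t ^ 2 * ε)) ⊆ U) :
    volume.real (E ∩ {x | smoothMass E ε x ≤ 2 * (t ^ (2 * n + 2) * ε ^ n)} ∩ T)
      ≤ 2 * (t ^ 2 * ε) * M := by
  have hm : MeasurableSet {x | smoothMass E ε x ≤ 2 * (t ^ (2 * n + 2) * ε ^ n)} :=
    measurableSet_le (smoothMass_contDiff hE hε).continuous.measurable measurable_const
  refine hV.volume_le (measurable_const.indicator hE) (fun x => indicator_nonneg (by simp) x)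
    (fun x => ?_) ((hE.inter hm).inter hT) (hTb.subset inter_subset_right) (by positivity)
    (fun x hx => hTU x hx.2) (fun x hx => indicator_of_mem hx.1.1 _) (fun x hx => ?_)
  · exact (le_abs_self _).trans (indicator_one_norm_le E x)
  · rw [setIntegral_indicator hE]
    simp only [integral_const, measureReal_restrict_apply_univ, smul_eq_mul, mul_one]
    rw [inter_comm]
    calc volume.real (E ∩ ball x (t ^ 2 * ε)) ≤ volume.real (E ∩ ball x (ε / 2)) := by
          refine measureReal_mono ?_ ?_
          · refine inter_subset_inter_right _ (ball_subset_ball ?_)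
            nlinarith
          · exact ((measure_mono inter_subset_right).trans_lt measure_ball_lt_top).ne
      _ ≤ (4 / 3 : ℝ) ^ (2 * n + 2) * smoothMass E ε x := volume_le_smoothMass hE hε x
      _ ≤ (4 / 3 : ℝ) ^ (2 * n + 2) * (2 * (t ^ (2 * n + 2) * ε ^ n)) := by
          gcongr
          exact hx.1.2
      _ = ((4 / 3 : ℝ) ^ (2 * n + 2) * 2 * t ^ 2) * (t ^ 2 * ε) ^ n := by
          rw [mul_pow, ← pow_mul]
          ring
      _ ≤ volume.real (ball (0 : Eu n) 1) / 2 * (t ^ 2 * ε) ^ n := by gcongr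
      _ = volume.real (ball (0 : Eu n) (t ^ 2 * ε)) / 2 := by
          rw [volume_real_ball _ (by positivity : 0 < t ^ 2 * ε)]
          ring

lemma smoothMass_cutoff_fderiv_le {E : Set (Eu n)} (hE : MeasurableSet E) {β : ℝ → ℝ} {K : ℝ}
    (hβ : ContDiff ℝ (⊤ : ℕ∞) β) (hβ1 : ∀ s, 1 ≤ s → β s = 1)
    (hβd : ∀ s, 0 ≤ deriv β s ∧ deriv β s ≤ K) {t ε : ℝ} (ht : 0 < t) (hε : 0 < ε) (x v : Eu n) :
    |fderiv ℝ (fun x => 1 - β (smoothMass E ε x / (t ^ (2 * n + 2) * ε ^ n) - 1)) x v| ≤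
      {x | smoothMass E ε x ≤ 2 * (t ^ (2 * n + 2) * ε ^ n)}.indicator
        (fun _ => K * (4 * n + 4) * (2 + volume.real (ball (0 : Eu n) 1)) / (t * ε) * ‖v‖) x := by
  set d := t ^ (2 * n + 2) * ε ^ n with hd
  have hd0 : 0 < d := by positivity
  set ω := volume.real (ball (0 : Eu n) 1) with hω
  have hω0 : 0 ≤ ω := measureReal_nonneg
  have hK : 0 ≤ K := (hβd 0).1.trans (hβd 0).2
  have hw : HasFDerivAt (smoothMass E ε) (fderiv ℝ (smoothMass E ε) x) x :=
    ((smoothMass_contDiff hE hε).differentiable one_ne_zero x).hasFDerivAt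
  have hβ' : HasDerivAt β (deriv β (smoothMass E ε x / d - 1)) (smoothMass E ε x / d - 1) :=
    (hβ.differentiable (by simp) _).hasDerivAt
  have h1 : HasFDerivAt (fun x => smoothMass E ε x / d - 1)
      (d⁻¹ • fderiv ℝ (smoothMass E ε) x) x := by
    simp only [div_eq_mul_inv]
    exact (hw.mul_const d⁻¹).sub_const 1
  have h2 := (hβ'.comp_hasFDerivAt x h1).const_sub 1
  have h3 : fderiv ℝ (fun x => 1 - β (smoothMass E ε x / d - 1)) x = _ := h2.fderiv
  rw [h3]
  have h4 : (-(deriv β (smoothMass E ε x / d - 1) • d⁻¹ • fderiv ℝ (smoothMass E ε) x)) v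
      = - (deriv β (smoothMass E ε x / d - 1) * (d⁻¹ * fderiv ℝ (smoothMass E ε) x v)) := rfl
  rw [h4, abs_neg, abs_mul, abs_mul, abs_of_nonneg (hβd _).1, abs_of_nonneg (by positivity)]
  by_cases hx : smoothMass E ε x ≤ 2 * d
  · rw [indicator_of_mem (by exact hx)]
    have h5 := smoothMass_fderiv_le hE hε ht x v
    have h6 : smoothMass E ε x / t + t ^ (2 * n + 1) * (ε ^ n * ω) ≤ d / t * (2 + ω) := by
      have : smoothMass E ε x / t ≤ 2 * d / t := by gcongr
      have h7 : t ^ (2 * n + 1) * (ε ^ n * ω) = d / t * ω := by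
        rw [hd, pow_succ t (2 * n + 1)]
        field_simp
      rw [h7]
      calc _ ≤ 2 * d / t + d / t * ω := by gcongr
        _ = _ := by ring
    calc deriv β (smoothMass E ε x / d - 1) * (d⁻¹ * |fderiv ℝ (smoothMass E ε) x v|)
        ≤ K * (d⁻¹ * ((4 * n + 4) * ‖v‖ / ε * (d / t * (2 + ω)))) := by
          gcongr
          · exact (hβd _).2
          · exact h5.trans (by gcongr)
      _ = K * (4 * n + 4) * (2 + ω) / (t * ε) * ‖v‖ := by
          field_simp
  · rw [indicator_of_notMem (by exact hx)]
    have : deriv β (smoothMass E ε x / d - 1) = 0 := by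
      have hlt : 1 < smoothMass E ε x / d - 1 := by
        rw [not_le] at hx
        have := (lt_div_iff₀ hd0).2 hx
        linarith
      have he : β =ᶠ[𝓝 (smoothMass E ε x / d - 1)] fun _ => 1 := by
        filter_upwards [Ioi_mem_nhds hlt] with y hy
        exact hβ1 y (le_of_lt hy)
      rw [he.deriv_eq]; simp
    rw [this]; simp

lemma low_density_variation {E U O : Set (Eu n)} (hE : MeasurableSet E) {M : ℝ}
    (hV : VarLe (E.indicator fun _ => 1) U (fun _ => 1) M) {r : ℝ} (hr : 0 < r)
    (hO : ∀ x ∈ O, ball x r ⊆ U) {κ : ℝ} (hκ : 0 < κ) :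
    ∃ δ > 0, ∀ᶠ ε in 𝓝[>] (0 : ℝ), ∃ b : Eu n → ℝ, Measurable b ∧ (∀ x, b x ∈ Icc (0 : ℝ) 1) ∧
      (∀ x, volume.real (E ∩ ball x ε) ≤ δ * ε ^ n → b x = 1) ∧
      VarLe (fun x => E.indicator (fun _ => 1) x * b x) O (fun _ => 1) κ := by
  obtain ⟨β, K, hβ, hK, hβI, hβ0, hβ1, hβd⟩ := exists_step
  have hM : 0 ≤ M := hV.nonneg fun _ => zero_le_one
  set ω := volume.real (ball (0 : Eu n) 1) with hω
  have hω0 : 0 < ω := volume_real_ball_one_pos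
  set A := K * (4 * n + 4) * (2 + ω) with hA
  have hA0 : 0 < A := by positivity
  have hOU : O ⊆ U := fun x hx => hO x hx (mem_ball_self hr)
  have hf : Measurable (E.indicator fun _ => (1 : ℝ)) := measurable_const.indicator hE
  have hfb := indicator_one_norm_le E
  obtain ⟨t, ht, ht1, ht2, ht3⟩ : ∃ t : ℝ, 0 < t ∧ t ^ 2 ≤ 1 / 2 ∧
      (4 / 3 : ℝ) ^ (2 * n + 2) * 2 * t ^ 2 ≤ ω / 2 ∧ A * 8 * M * t ≤ κ / 4 := by
    have c1 : Tendsto (fun t : ℝ => t ^ 2) (𝓝[>] 0) (𝓝 0) := by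
      have : Tendsto (fun t : ℝ => t ^ 2) (𝓝 0) (𝓝 (0 ^ 2)) := (continuous_pow 2).tendsto 0
      simpa using this.mono_left nhdsWithin_le_nhds
    have c2 : Tendsto (fun t : ℝ => (4 / 3 : ℝ) ^ (2 * n + 2) * 2 * t ^ 2) (𝓝[>] 0) (𝓝 0) := by
      simpa using c1.const_mul ((4 / 3 : ℝ) ^ (2 * n + 2) * 2)
    have c3 : Tendsto (fun t : ℝ => A * 8 * M * t) (𝓝[>] 0) (𝓝 0) := by
      have : Tendsto (fun t : ℝ => t) (𝓝[>] (0 : ℝ)) (𝓝 0) := nhdsWithin_le_nhds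
      simpa using this.const_mul (A * 8 * M)
    obtain ⟨t, h1, h2, h3, h4⟩ := (((tendsto_order.1 c1).2 (1 / 2) (by norm_num)).and
      (((tendsto_order.1 c2).2 (ω / 2) (by positivity)).and
      (((tendsto_order.1 c3).2 (κ / 4) (by positivity)).and self_mem_nhdsWithin))).exists
    exact ⟨t, h4, h1.le, h2.le, h3.le⟩
  obtain ⟨V, -, hVV, hopt⟩ := (hV.mono_set hOU).exists_optimal (fun _ => zero_le_one)
  obtain ⟨X₀, hX₀, hX₀1, hX₀V⟩ := hopt (κ / 4) (by positivity)
  obtain ⟨B, hB0, hB⟩ := hX₀.exists_dv_bound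
  refine ⟨t ^ (2 * n + 2), by positivity, ?_⟩
  have ev1 : ∀ᶠ ε in 𝓝[>] (0 : ℝ), 2 * (t ^ 2 * ε) < r ∧ B * (2 * (t ^ 2 * ε) * M) < κ / 4 := by
    have c0 : Tendsto (fun ε : ℝ => ε) (𝓝[>] (0 : ℝ)) (𝓝 0) := nhdsWithin_le_nhds
    have c1 : Tendsto (fun ε : ℝ => 2 * (t ^ 2 * ε)) (𝓝[>] 0) (𝓝 0) := by
      simpa using (c0.const_mul (t ^ 2)).const_mul 2
    have c2 : Tendsto (fun ε : ℝ => B * (2 * (t ^ 2 * ε) * M)) (𝓝[>] 0) (𝓝 0) := by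
      simpa using (c1.mul_const M).const_mul B
    exact ((tendsto_order.1 c1).2 r hr).and ((tendsto_order.1 c2).2 (κ / 4) (by positivity))
  filter_upwards [ev1, self_mem_nhdsWithin] with ε hε1 hε
  replace hε : 0 < ε := hε
  set d := t ^ (2 * n + 2) * ε ^ n with hd
  have hd0 : 0 < d := by positivity
  set b : Eu n → ℝ := fun x => 1 - β (smoothMass E ε x / d - 1) with hb
  have hbC : ContDiff ℝ 1 b := by
    have h1 : ContDiff ℝ 1 (fun x => smoothMass E ε x / d - 1) :=
      ((smoothMass_contDiff hE hε).div_const d).sub contDiff_const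
    exact contDiff_const.sub ((hβ.of_le (by exact_mod_cast le_top)).comp h1)
  have hbI : ∀ x, b x ∈ Icc (0 : ℝ) 1 := fun x => by
    have := hβI (smoothMass E ε x / d - 1)
    exact ⟨by linarith [this.2], by linarith [this.1]⟩
  set Q : Set (Eu n) := {x | smoothMass E ε x ≤ 2 * d} with hQ
  have hQm : MeasurableSet Q :=
    measurableSet_le (smoothMass_contDiff hE hε).continuous.measurable measurable_const
  have hbd : ∀ x v, |fderiv ℝ b x v| ≤ Q.indicator (fun _ => A / (t * ε) * ‖v‖) x := fun x v =>
    smoothMass_cutoff_fderiv_le hE hβ hβ1 hβd ht hε x v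
  have hb0 : ∀ x ∉ Q, b x = 0 := by
    intro x hx
    have hlt : 1 ≤ smoothMass E ε x / d - 1 := by
      have := (lt_div_iff₀ hd0).2 (not_le.1 hx)
      linarith
    simp [hb, hβ1 _ hlt]
  refine ⟨b, hbC.continuous.measurable, hbI, ?_, ?_⟩
  · intro x hx
    have h1 : smoothMass E ε x ≤ d := (smoothMass_le hE hε x).trans hx
    have h2 : smoothMass E ε x / d - 1 ≤ 0 := by
      have := (div_le_one hd0).2 h1
      linarith
    simp [hb, hβ0 _ h2]
  · intro X hX hX1
    have hvol : ∀ Y : Eu n → Eu n, IsTestField O Y →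
        volume.real (E ∩ Q ∩ tsupport Y) ≤ 2 * (t ^ 2 * ε) * M := by
      intro Y hY
      refine volume_smoothMass_small hE hV ht hε ht1 ht2 hY.2.1.measurableSet
        hY.2.1.isBounded ?_
      intro x hx
      exact (ball_subset_ball hε1.1.le).trans (hO x (hY.2.2 hx))
    have hfinS : ∀ Y : Eu n → Eu n, IsTestField O Y →
        Integrable ((E ∩ Q ∩ tsupport Y).indicator fun _ => (1 : ℝ)) := fun Y hY =>
      integrable_indicator_ball ((hE.inter hQm).inter hY.2.1.measurableSet)
        hY.2.1.measure_lt_top inter_subset_right 1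
    set D : Eu n → Eu n := fun x => X x + (-1 : ℝ) • X₀ x with hDdef
    have hD : IsTestField O D := hX.add (hX₀.const_smul (-1))
    have hDb : ∀ x, ‖D x‖ ≤ 2 := by
      intro x
      refine (norm_add_le _ _).trans ?_
      rw [neg_smul, one_smul, norm_neg]
      linarith [hX1 x, hX₀1 x]
    set Y : Eu n → Eu n := fun x => b x • D x + X₀ x with hYdef
    have hY : IsTestField O Y := (hD.smul hbC).add hX₀
    have hY1 : ∀ x, ‖Y x‖ ≤ 1 := by
      intro x
      have : Y x = b x • X x + (1 - b x) • X₀ x := by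
        simp only [hYdef, hDdef]
        module
      rw [this]
      have h1 := hbI x
      calc ‖b x • X x + (1 - b x) • X₀ x‖ ≤ b x * 1 + (1 - b x) * 1 := by
            refine (norm_add_le _ _).trans ?_
            rw [norm_smul, norm_smul, Real.norm_of_nonneg h1.1,
              Real.norm_of_nonneg (by linarith [h1.2])]
            have := hX1 x
            have := hX₀1 x
            have h3 : 0 ≤ 1 - b x := by linarith [h1.2]
            have h4 := h1.1
            gcongr
        _ = 1 := by ring
    have hbdiff := hbC.differentiable one_ne_zero
    have hdvY : ∀ x, dv Y x = b x * dv X x - b x * dv X₀ x + fderiv ℝ b x (D x) + dv X₀ x := by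
      intro x
      rw [hYdef, dv_add (hD.smul hbC).differentiable hX₀.differentiable,
        dv_smul hbdiff hD.differentiable, hDdef, dv_add hX.differentiable
        (hX₀.const_smul (-1)).differentiable, dv_const_smul]
      ring
    have hbm : Measurable b := hbC.continuous.measurable
    have hbfm : Measurable (fun x => E.indicator (fun _ => (1 : ℝ)) x * b x) := hf.mul hbm
    have hbfb : ∀ x, |E.indicator (fun _ => (1 : ℝ)) x * b x| ≤ 1 := by
      intro x
      rw [abs_mul, abs_of_nonneg (hbI x).1]
      exact mul_le_one₀ (hfb x) (hbI x).1 (hbI x).2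
    have i1 := integrable_mul_dv hbfm hbfb hX
    have i2 := integrable_mul_dv hbfm hbfb hX₀
    have i3 := integrable_mul_dv hf hfb hX₀
    have i4 := integrable_mul_dv hf hfb hY
    have hfderm : Continuous (fun x => fderiv ℝ b x (D x)) :=
      (hbC.continuous_fderiv one_ne_zero).clm_apply hD.1.continuous
    have bound1 : ∀ x, |E.indicator (fun _ => (1 : ℝ)) x * fderiv ℝ b x (D x)| ≤
        (A / (t * ε) * 2) * (E ∩ Q ∩ tsupport D).indicator (fun _ => (1 : ℝ)) x := by
      intro x
      by_cases hx : x ∈ E ∩ Q ∩ tsupport D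
      · rw [indicator_of_mem hx, indicator_of_mem hx.1.1, one_mul, mul_one]
        have h1 := hbd x (D x)
        rw [indicator_of_mem hx.1.2] at h1
        refine h1.trans ?_
        have := hDb x
        gcongr
      · rw [indicator_of_notMem hx, mul_zero]
        apply le_of_eq
        rw [abs_eq_zero]
        by_cases hxE : x ∈ E
        · by_cases hxD : x ∈ tsupport D
          · have hxQ : x ∉ Q := fun h => hx ⟨⟨hxE, h⟩, hxD⟩
            have h1 := hbd x (D x)
            rw [indicator_of_notMem hxQ] at h1
            rw [abs_nonpos_iff.1 h1, mul_zero]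
          · rw [image_eq_zero_of_notMem_tsupport hxD]
            simp
        · simp [hxE]
    have i5 : Integrable (fun x => E.indicator (fun _ => (1 : ℝ)) x * fderiv ℝ b x (D x)) :=
      ((hfinS D hD).const_mul (A / (t * ε) * 2)).mono'
        (hf.mul hfderm.measurable).aestronglyMeasurable (ae_of_all _ bound1)
    have est1 : |∫ x, E.indicator (fun _ => (1 : ℝ)) x * fderiv ℝ b x (D x)| ≤ κ / 4 := by
      rw [← Real.norm_eq_abs]
      refine (norm_integral_le_of_norm_le ((hfinS D hD).const_mul _)
        (ae_of_all _ bound1)).trans ?_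
      rw [integral_const_mul, integral_indicator_one_real
        ((hE.inter hQm).inter hD.2.1.measurableSet)]
      calc A / (t * ε) * 2 * volume.real (E ∩ Q ∩ tsupport D)
          ≤ A / (t * ε) * 2 * (2 * (t ^ 2 * ε) * M) := by
            gcongr
            exact hvol D hD
        _ = A * 4 * M * t := by
            field_simp
            ring
        _ ≤ A * 8 * M * t := by
            have : 0 ≤ A * M * t := by positivity
            nlinarith
        _ ≤ κ / 4 := ht3
    have bound2 : ∀ x, |E.indicator (fun _ => (1 : ℝ)) x * b x * dv X₀ x| ≤
        B * (E ∩ Q ∩ tsupport X₀).indicator (fun _ => (1 : ℝ)) x := by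
      intro x
      by_cases hx : x ∈ E ∩ Q ∩ tsupport X₀
      · rw [indicator_of_mem hx, mul_one, abs_mul]
        exact (mul_le_of_le_one_left (abs_nonneg _) (hbfb x)).trans (hB x)
      · rw [indicator_of_notMem hx, mul_zero]
        apply le_of_eq
        rw [abs_eq_zero]
        by_cases hxE : x ∈ E
        · by_cases hxD : x ∈ tsupport X₀
          · have hxQ : x ∉ Q := fun h => hx ⟨⟨hxE, h⟩, hxD⟩
            rw [hb0 x hxQ]; simp
          · rw [dv_eq_zero_of_notMem hxD]; simp
        · simp [hxE]
    have est2 : ∫ x, E.indicator (fun _ => (1 : ℝ)) x * b x * dv X₀ x ≤ κ / 4 := by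
      refine (le_abs_self _).trans ?_
      rw [← Real.norm_eq_abs]
      refine (norm_integral_le_of_norm_le ((hfinS X₀ hX₀).const_mul _)
        (ae_of_all _ bound2)).trans ?_
      rw [integral_const_mul, integral_indicator_one_real
        ((hE.inter hQm).inter hX₀.2.1.measurableSet)]
      exact (mul_le_mul_of_nonneg_left (hvol X₀ hX₀) hB0.le).trans hε1.2.le
    have hsum : ∫ x, E.indicator (fun _ => (1 : ℝ)) x * dv Y x
        = (∫ x, E.indicator (fun _ => (1 : ℝ)) x * b x * dv X x)
          - (∫ x, E.indicator (fun _ => (1 : ℝ)) x * b x * dv X₀ x)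
          + (∫ x, E.indicator (fun _ => (1 : ℝ)) x * fderiv ℝ b x (D x))
          + ∫ x, E.indicator (fun _ => (1 : ℝ)) x * dv X₀ x := by
      have i12 : Integrable (fun x => E.indicator (fun _ => (1 : ℝ)) x * b x * dv X x
          - E.indicator (fun _ => (1 : ℝ)) x * b x * dv X₀ x) := i1.sub i2
      have i125 : Integrable (fun x => E.indicator (fun _ => (1 : ℝ)) x * b x * dv X x
          - E.indicator (fun _ => (1 : ℝ)) x * b x * dv X₀ x
          + E.indicator (fun _ => (1 : ℝ)) x * fderiv ℝ b x (D x)) := i12.add i5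
      rw [← integral_sub i1 i2, ← integral_add i12 i5, ← integral_add i125 i3]
      congr 1
      ext x
      rw [hdvY]
      ring
    have hle := hVV Y hY hY1
    have h5 := neg_le_of_abs_le est1
    linarith

end LowDensity

/-! ### Points of positive upper density -/

section UpperDensity

variable {n : ℕ}

lemma measure_closedBall_le_of_rep {Ω : Set (Eu n)} {μ : Measure (Eu n)} [IsFiniteMeasure μ]
    {σ : Eu n → Eu n} {C : ℝ} (hC : ∀ x, ‖σ x‖ ≤ C)
    (hrep : ∀ ψ, IsTest Ω ψ → ∫ x, fderiv ℝ ψ x (σ x) = ∫ x, ψ x ∂μ) :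
    ∃ A, 0 ≤ A ∧ ∀ (x : Eu n) (R : ℝ), 0 < R → closedBall x (2 * R) ⊆ Ω →
      μ.real (closedBall x R) ≤ A * (R ^ n / R) := by
  obtain ⟨β, K, hβ, hK, hβI, hβ0, hβ1, hβd⟩ := exists_step
  have hC0 : 0 ≤ C := (norm_nonneg _).trans (hC 0)
  refine ⟨4 * K * C * (2 ^ n * volume.real (ball (0 : Eu n) 1)), by positivity, ?_⟩
  intro x R hR hx
  set q : Eu n → ℝ := fun y => 2 - ‖R⁻¹ • (y - x)‖ ^ 2 with hq
  have hqC : ContDiff ℝ (⊤ : ℕ∞) q := by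
    have : ContDiff ℝ (⊤ : ℕ∞) (fun y : Eu n => R⁻¹ • (y - x)) := by fun_prop
    exact contDiff_const.sub (this.norm_sq ℝ)
  set ψ : Eu n → ℝ := fun y => β (q y) with hψ
  have hψC : ContDiff ℝ (⊤ : ℕ∞) ψ := hβ.comp hqC
  have hψ0 : ∀ y ∉ closedBall x (2 * R), q y ≤ 0 := by
    intro y hy
    rw [mem_closedBall, dist_eq_norm, not_le] at hy
    have h1 : 2 ≤ ‖R⁻¹ • (y - x)‖ := by
      rw [norm_smul, norm_inv, Real.norm_of_nonneg hR.le, inv_mul_eq_div, le_div_iff₀ hR]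
      exact hy.le
    simp only [hq]
    nlinarith
  have hψs : Function.support ψ ⊆ closedBall x (2 * R) := by
    intro y hy
    by_contra h
    exact hy (hβ0 _ (hψ0 y h))
  have hts : tsupport ψ ⊆ closedBall x (2 * R) :=
    closure_minimal hψs isClosed_closedBall
  have hψt : IsTest Ω ψ :=
    ⟨hψC, HasCompactSupport.of_support_subset_isCompact (isCompact_closedBall _ _) hψs,
      hts.trans hx⟩
  have hbound : ∀ y, ‖fderiv ℝ ψ y (σ y)‖ ≤
      (closedBall x (2 * R)).indicator (fun _ => 4 * K * C / R) y := by
    intro y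
    by_cases hy : y ∈ closedBall x (2 * R)
    · rw [indicator_of_mem hy]
      have h1 : HasFDerivAt q (-(2 • (innerSL ℝ (R⁻¹ • (y - x))).comp
          (R⁻¹ • ContinuousLinearMap.id ℝ (Eu n)))) y := by
        have h2 : HasFDerivAt (fun y : Eu n => R⁻¹ • (y - x))
            (R⁻¹ • ContinuousLinearMap.id ℝ (Eu n)) y := by
          have h3 : HasFDerivAt (fun y : Eu n => y - x) (ContinuousLinearMap.id ℝ (Eu n)) y :=
            (hasFDerivAt_id y).sub_const x
          exact h3.const_smul R⁻¹
        exact h2.norm_sq.const_sub 2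
      have h4 : HasFDerivAt ψ _ y :=
        ((hβ.differentiable (by simp)).differentiableAt (x := q y)).hasDerivAt.comp_hasFDerivAt
          y h1
      rw [h4.fderiv]
      have h5 : ‖inner ℝ (R⁻¹ • (y - x)) (R⁻¹ • σ y)‖ ≤ 2 * (C / R) := by
        refine (norm_inner_le_norm _ _).trans ?_
        rw [mem_closedBall, dist_eq_norm] at hy
        have h6 : ‖R⁻¹ • (y - x)‖ ≤ 2 := by
          rw [norm_smul, norm_inv, Real.norm_of_nonneg hR.le, inv_mul_eq_div, div_le_iff₀ hR]
          exact hy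
        have h7 : ‖R⁻¹ • σ y‖ ≤ C / R := by
          rw [norm_smul, norm_inv, Real.norm_of_nonneg hR.le, inv_mul_eq_div]
          gcongr
          exact hC y
        gcongr
      have h8 : ‖deriv β (q y)‖ ≤ K := by
        rw [Real.norm_of_nonneg (hβd _).1]
        exact (hβd _).2
      have h9 : (deriv β (q y) • -(2 • (innerSL ℝ (R⁻¹ • (y - x))).comp
          (R⁻¹ • ContinuousLinearMap.id ℝ (Eu n)))) (σ y)
          = - (deriv β (q y) * (2 * inner ℝ (R⁻¹ • (y - x)) (R⁻¹ • σ y))) := by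
        simp [inner_smul_left, inner_smul_right, inner_sub_left]
      rw [h9, norm_neg, norm_mul, norm_mul, Real.norm_ofNat]
      calc _ ≤ K * (2 * (2 * (C / R))) := by gcongr
        _ = _ := by ring
    · rw [indicator_of_notMem hy]
      rw [fderiv_of_notMem_tsupport ℝ (fun h => hy (hts h))]
      simp
  have hintg : Integrable ((closedBall x (2 * R)).indicator (fun _ => 4 * K * C / R)) :=
    integrable_indicator_ball measurableSet_closedBall
      (measure_closedBall_lt_top (x := x) (r := 2 * R)) subset_rfl _
  have hψint : Integrable ψ μ := hψC.continuous.integrable_of_hasCompactSupport hψt.2.1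
  calc μ.real (closedBall x R) = ∫ y, (closedBall x R).indicator (fun _ => (1 : ℝ)) y ∂μ := by
        rw [integral_indicator_const _ measurableSet_closedBall]; simp
    _ ≤ ∫ y, ψ y ∂μ := by
        refine integral_mono ((integrable_const _).indicator measurableSet_closedBall) hψint ?_
        intro y
        refine indicator_le' (fun y hy => ?_) (fun y _ => (hβI _).1) y
        apply le_of_eq
        symm
        apply hβ1
        rw [mem_closedBall, dist_eq_norm] at hy
        have h1 : ‖R⁻¹ • (y - x)‖ ≤ 1 := by
          rw [norm_smul, norm_inv, Real.norm_of_nonneg hR.le, inv_mul_eq_div, div_le_iff₀ hR]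
          simpa using hy
        simp only [hq]
        have := norm_nonneg (R⁻¹ • (y - x))
        nlinarith
    _ = ∫ y, fderiv ℝ ψ y (σ y) := (hrep ψ hψt).symm
    _ ≤ ‖∫ y, fderiv ℝ ψ y (σ y)‖ := Real.le_norm_self _
    _ ≤ ∫ y, (closedBall x (2 * R)).indicator (fun _ => 4 * K * C / R) y :=
        norm_integral_le_of_norm_le hintg (ae_of_all _ hbound)
    _ = 4 * K * C * (2 ^ n * volume.real (ball (0 : Eu n) 1)) * (R ^ n / R) := by
        rw [integral_indicator_const _ measurableSet_closedBall,
          volume_real_closedBall x (by positivity : 0 < 2 * R), smul_eq_mul, mul_pow]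
        field_simp

/-- Points at which `E` has dyadic upper density larger than `d`. -/
def upperDense (E : Set (Eu n)) (d : ℝ) : Set (Eu n) :=
  {x | ∃ᶠ k : ℕ in atTop, d * ((1 / 2 : ℝ) ^ k) ^ n < volume.real (E ∩ ball x ((1 / 2 : ℝ) ^ k))}

lemma volume_real_inter_ball_mono (E : Set (Eu n)) {x y : Eu n} {r s : ℝ}
    (h : ball x r ⊆ ball y s) : volume.real (E ∩ ball x r) ≤ volume.real (E ∩ ball y s) :=
  measureReal_mono (inter_subset_inter_right _ h)
    (ne_top_of_le_ne_top measure_ball_lt_top.ne (measure_mono inter_subset_right))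

lemma exists_field_of_upperDense {E : Set (Eu n)} (hE : MeasurableSet E) {b : Eu n → ℝ}
    (hbm : Measurable b) (hbI : ∀ x, b x ∈ Icc (0 : ℝ) 1) {d δ ε : ℝ} (hd0 : 0 < d)
    (hd : d * 4 ^ n ≤ volume.real (ball (0 : Eu n) 1) / 2) (hδ0 : 0 ≤ δ) (hδ : δ * 2 ^ n ≤ d)
    (hε : 0 < ε) (hε1 : ε ≤ 1)
    (hb : ∀ x, volume.real (E ∩ ball x ε) ≤ δ * ε ^ n → b x = 1) {x : Eu n}
    (hx : x ∈ upperDense E d) (hxε : volume.real (E ∩ ball x (2 * ε)) ≤ δ * ε ^ n) :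
    ∃ ρ X, 0 < ρ ∧ 2 * ρ ≤ ε ∧ IsTestField (ball x (2 * ρ)) X ∧ (∀ y, ‖X y‖ ≤ 1) ∧
      d * (ρ ^ n / ρ) < ∫ y, E.indicator (fun _ => 1) y * b y * dv X y := by
  classical
  have hex : ∃ k : ℕ, (1 / 2 : ℝ) ^ k ≤ ε ∧
      d * ((1 / 2 : ℝ) ^ k) ^ n < volume.real (E ∩ ball x ((1 / 2 : ℝ) ^ k)) := by
    have h1 : ∀ᶠ k : ℕ in atTop, (1 / 2 : ℝ) ^ k ≤ ε := by
      have := tendsto_pow_atTop_nhds_zero_of_lt_one (r := (1 / 2 : ℝ)) (by norm_num) (by norm_num)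
      exact this.eventually_le_const hε
    obtain ⟨k, hk⟩ := (hx.and_eventually h1).exists
    exact ⟨k, hk.2, hk.1⟩
  obtain ⟨h1, h2⟩ := Nat.find_spec hex
  have hmin := fun m hm => Nat.find_min hex (m := m) hm
  set k := Nat.find hex with hk
  set ρ : ℝ := (1 / 2 : ℝ) ^ k with hρ
  have hρ0 : 0 < ρ := by positivity
  have h2ρ : 2 * ρ ≤ ε := by
    by_contra! h
    have h3 : volume.real (E ∩ ball x ρ) ≤ δ * ε ^ n :=
      (volume_real_inter_ball_mono E (ball_subset_ball (by linarith))).trans hxε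
    have h4 : δ * ε ^ n ≤ δ * (2 * ρ) ^ n := by gcongr
    have h5 : δ * (2 * ρ) ^ n ≤ d * ρ ^ n := by
      rw [mul_pow, ← mul_assoc]
      gcongr
    linarith
  have hk0 : k ≠ 0 := by
    rintro h
    rw [hρ, h, pow_zero] at h2ρ
    linarith
  have h2ρk : (1 / 2 : ℝ) ^ (k - 1) = 2 * ρ := by
    obtain ⟨m, hm⟩ := Nat.exists_eq_succ_of_ne_zero hk0
    rw [hρ, hm, Nat.succ_eq_add_one, Nat.add_sub_cancel, pow_succ]
    ring
  have h6 : volume.real (E ∩ ball x (2 * ρ)) ≤ d * (2 * ρ) ^ n := by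
    have := hmin (k - 1) (by omega)
    rw [h2ρk] at this
    by_contra! h
    exact this ⟨h2ρ, h⟩
  have hb1 : ∀ y ∈ ball x (2 * ρ), b y = 1 := by
    intro y hy
    apply hb
    refine (volume_real_inter_ball_mono E ?_).trans hxε
    refine ball_subset_ball' ?_
    rw [mem_ball] at hy
    linarith
  have hfm : Measurable (E.indicator (fun _ => (1 : ℝ))) := measurable_const.indicator hE
  have hf01 : ∀ y, E.indicator (fun _ => (1 : ℝ)) y ∈ Icc (0 : ℝ) 1 := by
    intro y
    by_cases hy : y ∈ E <;> simp [hy]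
  have hnot : ¬ VarLe (fun y => E.indicator (fun _ => 1) y * b y) (ball x (2 * ρ))
      (fun _ => 1) (d * (ρ ^ n / ρ)) := by
    intro hV
    have hfbm : Measurable (fun y => E.indicator (fun _ => (1 : ℝ)) y * b y) := hfm.mul hbm
    have := hV.volume_le hfbm (fun y => mul_nonneg (hf01 y).1 (hbI y).1)
      (fun y => mul_le_one₀ (hf01 y).2 (hbI y).1 (hbI y).2) (S := E ∩ ball x ρ)
      (hE.inter measurableSet_ball) (isBounded_ball.subset inter_subset_right)
      (τ := ρ / 2) (by positivity) ?_ ?_ ?_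
    · have h7 : 2 * (ρ / 2) * (d * (ρ ^ n / ρ)) = d * ρ ^ n := by field_simp
      linarith
    · intro y hy
      refine ball_subset_ball' ?_
      have := mem_ball.1 hy.2
      linarith
    · intro y hy
      rw [indicator_of_mem hy.1, hb1 y (ball_subset_ball (by linarith) hy.2), one_mul]
    · intro y hy
      have hsub : ball y (ρ / 2) ⊆ ball x (2 * ρ) := by
        refine ball_subset_ball' ?_
        have := mem_ball.1 hy.2
        linarith
      have hintg : IntegrableOn (E.indicator (fun _ => (1 : ℝ))) (ball y (ρ / 2)) :=
        (integrableOn_const (measure_ball_lt_top.ne)).indicator hE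
      calc ∫ z in ball y (ρ / 2), E.indicator (fun _ => (1 : ℝ)) z * b z
          ≤ ∫ z in ball y (ρ / 2), E.indicator (fun _ => (1 : ℝ)) z := by
            refine integral_mono_of_nonneg
              (ae_of_all _ fun z => mul_nonneg (hf01 z).1 (hbI z).1) hintg
              (ae_of_all _ fun z => mul_le_of_le_one_right (hf01 z).1 (hbI z).2)
        _ = volume.real (E ∩ ball y (ρ / 2)) := by
            rw [integral_indicator_const _ hE]
            simp [measureReal_restrict_apply hE]
        _ ≤ d * (2 * ρ) ^ n := (volume_real_inter_ball_mono E hsub).trans h6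
        _ = d * 4 ^ n * (ρ / 2) ^ n := by
            rw [mul_assoc, ← mul_pow]
            ring_nf
        _ ≤ volume.real (ball (0 : Eu n) 1) / 2 * (ρ / 2) ^ n := by gcongr
        _ = volume.real (ball (0 : Eu n) (ρ / 2)) / 2 := by
            rw [volume_real_ball 0 (by positivity : 0 < ρ / 2)]
            ring
  unfold VarLe at hnot
  push Not at hnot
  obtain ⟨X, hX, hX1, hX2⟩ := hnot
  exact ⟨ρ, X, hρ0, h2ρ, hX, hX1, hX2⟩

lemma measure_upperDense_le {E U O K Ω : Set (Eu n)} (hE : MeasurableSet E) {M : ℝ}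
    (hV : VarLe (E.indicator fun _ => 1) U (fun _ => 1) M) {r : ℝ} (hr : 0 < r)
    (hO : ∀ x ∈ O, ball x r ⊆ U) (hK : ∀ x ∈ K, ball x r ⊆ O ∩ Ω)
    {μ : Measure (Eu n)} [IsFiniteMeasure μ] {σ : Eu n → Eu n} {C : ℝ} (hC : ∀ x, ‖σ x‖ ≤ C)
    (hrep : ∀ ψ, IsTest Ω ψ → ∫ x, fderiv ℝ ψ x (σ x) = ∫ x, ψ x ∂μ)
    {d : ℝ} (hd0 : 0 < d) (hd : d * 4 ^ n ≤ volume.real (ball (0 : Eu n) 1) / 2)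
    {η : ℝ} (hη : 0 < η) :
    ∃ δ > 0, ∀ᶠ ε in 𝓝[>] (0 : ℝ), μ.real {x | x ∈ K ∧ x ∈ upperDense E d ∧
      volume.real (E ∩ ball x (2 * ε)) ≤ δ * ε ^ n} ≤ η := by
  obtain ⟨A, hA0, hA⟩ := measure_closedBall_le_of_rep hC hrep
  set A' : ℝ := A * (10 ^ n / 10) + 1 with hA'
  have hA'0 : 0 < A' := by positivity
  obtain ⟨δ₀, hδ₀, hev⟩ := low_density_variation hE hV hr hO
    (κ := d * η / A') (by positivity)
  refine ⟨min δ₀ (d / 2 ^ n), by positivity, ?_⟩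
  set δ := min δ₀ (d / 2 ^ n) with hδdef
  have hδ0 : 0 < δ := by positivity
  have hδ2 : δ * 2 ^ n ≤ d := by
    have : δ ≤ d / 2 ^ n := min_le_right _ _
    rwa [le_div_iff₀ (by positivity)] at this
  have hsmall : ∀ᶠ ε in 𝓝[>] (0 : ℝ), ε < min 1 (r / 20) :=
    nhdsWithin_le_nhds (eventually_lt_nhds (by positivity))
  filter_upwards [hev, hsmall, self_mem_nhdsWithin] with ε hb hεs hε
  rw [mem_Ioi] at hε
  obtain ⟨b, hbm, hbI, hb1, hbV⟩ := hb
  have hε1 : ε < 1 := hεs.trans_le (min_le_left _ _)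
  have hεr : ε < r / 20 := hεs.trans_le (min_le_right _ _)
  set S := {x | x ∈ K ∧ x ∈ upperDense E d ∧ volume.real (E ∩ ball x (2 * ε)) ≤ δ * ε ^ n}
    with hS
  have hb1' : ∀ x, volume.real (E ∩ ball x ε) ≤ δ * ε ^ n → b x = 1 := fun x hx =>
    hb1 x (hx.trans (by gcongr; exact min_le_left _ _))
  have hch : ∀ x : S, ∃ (ρ : ℝ) (X : Eu n → Eu n), 0 < ρ ∧ 2 * ρ ≤ ε ∧
      IsTestField (ball (x : Eu n) (2 * ρ)) X ∧ (∀ y, ‖X y‖ ≤ 1) ∧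
      d * (ρ ^ n / ρ) < ∫ y, E.indicator (fun _ => 1) y * b y * dv X y := fun x =>
    exists_field_of_upperDense hE hbm hbI hd0 hd hδ0.le hδ2 hε hε1.le hb1' x.2.2.1 x.2.2.2
  choose ρ X hρ0 hρε hX hX1 hX2 using hch
  obtain ⟨u, -, hdisj, hcov⟩ := Vitali.exists_disjoint_subfamily_covering_enlargement_closedBall
    (univ : Set S) (fun x => (x : Eu n)) (fun x => 2 * ρ x) ε (fun x _ => hρε x) 5 (by norm_num)
  have hcount : u.Countable := by
    refine hdisj.countable_of_nonempty_interior fun x _ => ?_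
    exact ⟨x, interior_mono ball_subset_closedBall
      (by rw [isOpen_ball.interior_eq]; exact mem_ball_self (by linarith [hρ0 x]))⟩
  have hfm : Measurable (fun y => E.indicator (fun _ => (1 : ℝ)) y * b y) :=
    (measurable_const.indicator hE).mul hbm
  have hfb : ∀ y, |E.indicator (fun _ => (1 : ℝ)) y * b y| ≤ 1 := by
    intro y
    rw [abs_mul, abs_of_nonneg (hbI y).1]
    refine mul_le_one₀ ?_ (hbI y).1 (hbI y).2
    by_cases hy : y ∈ E <;> simp [hy]
  have hsub : ∀ x : S, ball (x : Eu n) (2 * ρ x) ⊆ O := fun x =>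
    (ball_subset_ball (by linarith [hρε x])).trans ((hK x x.2.1).trans inter_subset_left)
  have hfin : ∀ s : Finset u, ∑ x ∈ s, d * (ρ x ^ n / ρ x) ≤ d * η / A' := by
    intro s
    have htf : ∀ x ∈ s, IsTestField O (X (x : S)) := fun x _ => (hX x).mono (hsub x)
    have h1 := hbV (fun y => ∑ x ∈ s, X (x : S) y) (IsTestField.sum s htf) ?_
    · refine le_trans ?_ h1
      have h2 : ∀ y, E.indicator (fun _ => (1 : ℝ)) y * b y * dv (fun y => ∑ x ∈ s, X (x : S) y) y
          = ∑ x ∈ s, E.indicator (fun _ => (1 : ℝ)) y * b y * dv (X (x : S)) y := by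
        intro y
        rw [dv_sum s htf, Finset.mul_sum]
      simp_rw [h2]
      rw [integral_finsetSum _ fun x hx => integrable_mul_dv hfm hfb (htf x hx)]
      exact Finset.sum_le_sum fun x _ => (hX2 x).le
    · intro y
      by_cases hy : ∃ x ∈ s, X (x : S) y ≠ 0
      · obtain ⟨x, hx, hxy⟩ := hy
        have hmem : ∀ z : u, X (z : S) y ≠ 0 → y ∈ closedBall ((z : S) : Eu n) (2 * ρ z) :=
          fun z hz => ball_subset_closedBall ((hX z).2.2 (subset_tsupport _ hz))
        rw [Finset.sum_eq_single_of_mem x hx]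
        · exact hX1 _ y
        · intro z _ hzx
          by_contra hne
          have hne' : (z : S) ≠ (x : S) := fun h => hzx (Subtype.ext h)
          exact Set.disjoint_left.1 (hdisj z.2 x.2 hne') (hmem z hne) (hmem x hxy)
      · push Not at hy
        rw [Finset.sum_eq_zero hy]
        simp
  have hball : ∀ x : S, μ (closedBall (x : Eu n) (5 * (2 * ρ x)))
      ≤ ENNReal.ofReal (A' / d * (d * (ρ x ^ n / ρ x))) := by
    intro x
    have hpos := hρ0 x
    have h1 := hA x (5 * (2 * ρ x)) (by linarith) ?_
    · rw [← ofReal_measureReal]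
      apply ENNReal.ofReal_le_ofReal
      refine h1.trans ?_
      have h2 : A * ((5 * (2 * ρ x)) ^ n / (5 * (2 * ρ x)))
          = A * (10 ^ n / 10) * (ρ x ^ n / ρ x) := by
        rw [← mul_assoc, mul_pow, show (5 : ℝ) * 2 = 10 by norm_num]
        field_simp
      rw [h2, ← mul_assoc, div_mul_cancel₀ _ hd0.ne']
      gcongr
      linarith
    · refine (closedBall_subset_ball ?_).trans ((hK x x.2.1).trans inter_subset_right)
      linarith [hρε x]
  have hμS : μ S ≤ ENNReal.ofReal η := by
    calc μ S ≤ μ (⋃ x ∈ u, closedBall ((x : S) : Eu n) (5 * (2 * ρ x))) := by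
          refine measure_mono fun x hx => ?_
          obtain ⟨z, hz, hsubz⟩ := hcov ⟨x, hx⟩ (mem_univ _)
          exact mem_biUnion hz (hsubz (mem_closedBall_self (by linarith [hρ0 ⟨x, hx⟩])))
      _ ≤ ∑' x : u, μ (closedBall ((x : S) : Eu n) (5 * (2 * ρ x))) :=
          measure_biUnion_le μ hcount _
      _ ≤ ∑' x : u, ENNReal.ofReal (A' / d * (d * (ρ x ^ n / ρ x))) :=
          ENNReal.tsum_le_tsum fun x => hball x
      _ ≤ ENNReal.ofReal η := by
          rw [ENNReal.tsum_eq_iSup_sum]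
          refine iSup_le fun s => ?_
          rw [← ENNReal.ofReal_sum_of_nonneg]
          · apply ENNReal.ofReal_le_ofReal
            rw [← Finset.mul_sum]
            calc A' / d * _ ≤ A' / d * (d * η / A') := by
                  gcongr
                  exact hfin s
              _ = η := by field_simp
          · intro x _
            have := hρ0 x
            positivity
  exact ENNReal.toReal_le_of_le_ofReal hη.le hμS

end UpperDensity

/-! ### Smoothed indicator functions as test functions -/

section SmoothedIndicator

variable {n : ℕ}

lemma kconv_moll_contDiff {f : Eu n → ℝ} (hf : LocallyIntegrable f) (j : ℕ) :
    ContDiff ℝ (⊤ : ℕ∞) (kconv (moll n j) f) := by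
  rw [kconv_eq_convolution]
  exact (moll_hasCompactSupport n j).contDiff_convolution_right _ hf (moll_contDiff n j)

lemma exists_fderiv_bound {k : Eu n → ℝ} (hk : ContDiff ℝ 1 k) (hks : HasCompactSupport k) :
    ∃ B, 0 ≤ B ∧ ∀ x, ‖fderiv ℝ k x‖ ≤ B := by
  obtain ⟨B, hB⟩ := (hks.fderiv ℝ).exists_bound_of_continuous (hk.continuous_fderiv one_ne_zero)
  exact ⟨B, (norm_nonneg _).trans (hB 0), hB⟩

lemma dv_kconv {k : Eu n → ℝ} (hk : ContDiff ℝ 1 k) (hks : HasCompactSupport k)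
    {Z : Eu n → Eu n} (hZ : LocallyIntegrable Z) (y : Eu n) :
    dv (kconv k Z) y = ∫ x, fderiv ℝ k (y - x) (Z x) := by
  unfold dv
  have hintg : ∀ i : Fin n, Integrable (fun x =>
      fderiv ℝ k (y - x) (EuclideanSpace.single i 1) • Z x) := fun i =>
    integrable_kernel_smul ((hk.continuous_fderiv one_ne_zero).clm_apply continuous_const)
      (hks.fderiv_apply ℝ _) hZ y
  have h1 : ∀ i : Fin n, (fderiv ℝ (kconv k Z) y (EuclideanSpace.single i 1)) i
      = ∫ x, fderiv ℝ k (y - x) (EuclideanSpace.single i 1) * Z x i := by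
    intro i
    rw [kconv_fderiv hk hks hZ]
    have := (EuclideanSpace.proj (𝕜 := ℝ) i).integral_comp_comm (hintg i)
    simpa using this.symm
  simp_rw [h1]
  rw [← integral_finsetSum]
  · simp_rw [← map_eq_sum_single]
  · intro i _
    have := (EuclideanSpace.proj (𝕜 := ℝ) i).integrable_comp (hintg i)
    simpa using this

lemma integral_fderiv_kconv_moll {f : Eu n → ℝ} (hf : Measurable f) {B : ℝ}
    (hB : ∀ x, |f x| ≤ B) {Z : Eu n → Eu n} (hZ : Measurable Z) {B' : ℝ} (hB' : ∀ x, ‖Z x‖ ≤ B')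
    {S : Set (Eu n)} (hS : IsCompact S) (hZS : ∀ x ∉ S, Z x = 0) (j : ℕ) :
    ∫ x, fderiv ℝ (kconv (moll n j) f) x (Z x) = - ∫ y, f y * dv (kconv (moll n j) Z) y := by
  have hfl : LocallyIntegrable f := locallyIntegrable_of_bdd hf.aestronglyMeasurable hB
  have hZl : LocallyIntegrable Z := locallyIntegrable_of_bdd hZ.aestronglyMeasurable hB'
  set k := moll n j with hk
  have hkC : ContDiff ℝ 1 k := moll_contDiff_one n j
  have hks : HasCompactSupport k := moll_hasCompactSupport n j
  obtain ⟨L, hL0, hL⟩ := exists_fderiv_bound hkC hks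
  have hB0 : 0 ≤ B := (abs_nonneg _).trans (hB 0)
  have hB'0 : 0 ≤ B' := (norm_nonneg _).trans (hB' 0)
  have hcont := hkC.continuous_fderiv one_ne_zero
  have hmeas : Measurable (fun p : Eu n × Eu n => fderiv ℝ k (p.1 - p.2) (Z p.1) * f p.2) := by
    have h1 : Measurable (fun p : Eu n × Eu n => fderiv ℝ k (p.1 - p.2) (Z p.1)) := by
      have h2 : Continuous (fun q : (Eu n →L[ℝ] ℝ) × Eu n => q.1 q.2) :=
        continuous_fst.clm_apply continuous_snd
      have h3 : Measurable (fun p : Eu n × Eu n => fderiv ℝ k (p.1 - p.2)) :=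
        (hcont.comp (continuous_fst.sub continuous_snd)).measurable
      exact h2.measurable.comp (h3.prodMk (hZ.comp measurable_fst))
    exact h1.mul (hf.comp measurable_snd)
  have hST : IsCompact (cthickening (mollRad j) S) := hS.cthickening
  have hintg : Integrable (fun p : Eu n × Eu n => fderiv ℝ k (p.1 - p.2) (Z p.1) * f p.2)
      (volume.prod volume) := by
    have hcpt : IsCompact (S ×ˢ cthickening (mollRad j) S) := hS.prod hST
    have hbd : Integrable ((S ×ˢ cthickening (mollRad j) S).indicator
        fun _ : Eu n × Eu n => L * B' * B) (volume.prod volume) := by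
      rw [integrable_indicator_iff hcpt.measurableSet]
      exact integrableOn_const hcpt.measure_lt_top.ne
    refine hbd.mono' hmeas.aestronglyMeasurable (ae_of_all _ fun p => ?_)
    by_cases hp : p ∈ S ×ˢ cthickening (mollRad j) S
    · rw [indicator_of_mem hp, norm_mul]
      have h1 : ‖fderiv ℝ k (p.1 - p.2) (Z p.1)‖ ≤ L * B' :=
        ((fderiv ℝ k (p.1 - p.2)).le_opNorm _).trans (by gcongr; exacts [hL _, hB' _])
      exact mul_le_mul h1 (hB _) (norm_nonneg _) (by positivity)
    · rw [indicator_of_notMem hp]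
      apply le_of_eq
      rw [norm_eq_zero]
      by_cases hp1 : p.1 ∈ S
      · have hp2 : p.1 - p.2 ∉ tsupport k := by
          rw [hk, moll_tsupport, mem_closedBall, dist_zero_right, not_le]
          by_contra! h
          exact hp ⟨hp1, mem_cthickening_of_dist_le p.2 p.1 _ _ hp1
            (by rw [dist_comm, dist_eq_norm]; exact h)⟩
        rw [fderiv_of_notMem_tsupport ℝ hp2]
        simp
      · rw [hZS _ hp1]
        simp
  have h1 : ∀ x, fderiv ℝ (kconv k f) x (Z x) = ∫ y, fderiv ℝ k (x - y) (Z x) * f y := fun x => by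
    rw [kconv_fderiv hkC hks hfl]
    rfl
  have h2 : ∀ y, f y * dv (kconv k Z) y = - ∫ x, fderiv ℝ k (x - y) (Z x) * f y := by
    intro y
    rw [dv_kconv hkC hks hZl, ← integral_const_mul, ← integral_neg]
    congr 1
    ext x
    rw [← neg_sub x y, hk, moll_fderiv_neg]
    ring
  simp_rw [h1, h2]
  rw [integral_neg, neg_neg, integral_integral_swap hintg]

/-- The variation bound for fields which are nearly dominated by the weight. -/
lemma VarLe.le_of_add {f : Eu n → ℝ} (hf : Measurable f) {B : ℝ} (hB : ∀ x, |f x| ≤ B)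
    {Ω U : Set (Eu n)} {φ : Eu n → ℝ} (hφ : ContDiff ℝ 1 φ) (hφ0 : ∀ x, 0 ≤ φ x) {V M : ℝ}
    (hV : VarLe f Ω φ V) (hM : VarLe f U (fun _ => 1) M) {C ω : ℝ} (hC : 0 ≤ C) (hω : 0 < ω)
    {Y : Eu n → Eu n} (hY : IsTestField Ω Y) (hYU : IsTestField U Y)
    (hYb : ∀ x, ‖Y x‖ ≤ C * (φ x + ω)) : ∫ x, f x * dv Y x ≤ C * (V + ω * M) := by
  have hpos : ∀ x, 0 < φ x + ω := fun x => add_pos_of_nonneg_of_pos (hφ0 x) hω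
  have hne : ∀ x, φ x + ω ≠ 0 := fun x => (hpos x).ne'
  have hq1 : ContDiff ℝ 1 (fun x => φ x / (φ x + ω)) := hφ.div (hφ.add contDiff_const) hne
  have hq2 : ContDiff ℝ 1 (fun x => ω / (φ x + ω)) :=
    contDiff_const.div (hφ.add contDiff_const) hne
  have h1 := hV.le_mul hC (hY.smul hq1) (fun x => by
    rw [norm_smul, Real.norm_of_nonneg (div_nonneg (hφ0 x) (hpos x).le)]
    calc φ x / (φ x + ω) * ‖Y x‖ ≤ φ x / (φ x + ω) * (C * (φ x + ω)) := by
          have := div_nonneg (hφ0 x) (hpos x).le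
          gcongr
          exact hYb x
      _ = C * φ x := by
          have := hne x
          field_simp)
  have h2 := hM.le_mul (c := C * ω) (by positivity) (hYU.smul hq2) (fun x => by
    rw [norm_smul, Real.norm_of_nonneg (div_nonneg hω.le (hpos x).le)]
    calc ω / (φ x + ω) * ‖Y x‖ ≤ ω / (φ x + ω) * (C * (φ x + ω)) := by
          have := div_nonneg hω.le (hpos x).le
          gcongr
          exact hYb x
      _ = C * ω * 1 := by
          have := hne x
          field_simp)
  have h3 : ∀ x, dv Y x = dv (fun x => (φ x / (φ x + ω)) • Y x) x
      + dv (fun x => (ω / (φ x + ω)) • Y x) x := by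
    intro x
    rw [← dv_add (hY.smul hq1).differentiable (hYU.smul hq2).differentiable]
    congr 1
    ext1 x
    rw [← add_smul, ← add_div, div_self (hne x), one_smul]
  simp_rw [h3, mul_add]
  rw [integral_add (integrable_mul_dv hf hB (hY.smul hq1))
    (integrable_mul_dv hf hB (hYU.smul hq2))]
  linarith

end SmoothedIndicator

section Pairing

variable {n : ℕ}

lemma indicator_one_mem_Icc (E : Set (Eu n)) (x : Eu n) :
    E.indicator (fun _ => (1 : ℝ)) x ∈ Icc (0 : ℝ) 1 := by
  by_cases hx : x ∈ E <;> simp [hx]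

lemma indicator_one_abs_le (E : Set (Eu n)) (x : Eu n) :
    |E.indicator (fun _ => (1 : ℝ)) x| ≤ 1 := by
  rw [abs_of_nonneg (indicator_one_mem_Icc E x).1]
  exact (indicator_one_mem_Icc E x).2

lemma exists_cthickening_mollRad_subset {S U : Set (Eu n)} (hS : IsCompact S) (hU : IsOpen U)
    (hSU : S ⊆ U) : ∀ᶠ j in atTop, cthickening (mollRad j) S ⊆ U := by
  obtain ⟨r, hr, hrU⟩ := hS.exists_cthickening_subset_open hU hSU
  filter_upwards [mollRad_tendsto.eventually_le_const hr] with j hj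
  exact (cthickening_mono hj S).trans hrU

lemma tendsto_integral_comp_moll {E : Set (Eu n)} (hE : MeasurableSet E) {G : ℝ → ℝ}
    (hG : Continuous G) {w : Eu n → ℝ} (hw : Integrable w) :
    Tendsto (fun j => ∫ x, G (kconv (moll n j) (E.indicator fun _ => (1 : ℝ)) x) * w x) atTop
      (𝓝 (∫ x, G (E.indicator (fun _ => 1) x) * w x)) := by
  have hl := indicator_one_locallyIntegrable hE
  obtain ⟨B, hB⟩ := isCompact_Icc.exists_bound_of_continuousOn
    (hG.continuousOn (s := Icc (0 : ℝ) 1))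
  refine tendsto_integral_of_dominated_convergence (fun x => B * ‖w x‖) ?_ (hw.norm.const_mul B)
    ?_ ?_
  · intro j
    exact (hG.comp (kconv_moll_contDiff hl j).continuous).aestronglyMeasurable.mul
      hw.aestronglyMeasurable
  · intro j
    refine ae_of_all _ fun x => ?_
    rw [norm_mul]
    gcongr
    exact hB _ (kconv_moll_mem_Icc hl j x fun y _ => indicator_one_mem_Icc E y)
  · filter_upwards [kconv_moll_ae_tendsto hl] with x hx
    exact ((hG.tendsto _).comp hx).mul_const _

lemma eventually_pairing_le {Ω U E : Set (Eu n)} (hΩ : IsOpen Ω) (hU : IsOpen U)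
    (hE : MeasurableSet E)
    {φ : Eu n → ℝ} (hφ : IsTest Ω φ) (hφ0 : ∀ x, 0 ≤ φ x) (hφU : tsupport φ ⊆ U) {V M : ℝ}
    (hV : VarLe (E.indicator fun _ => 1) Ω φ V)
    (hM : VarLe (E.indicator fun _ => 1) U (fun _ => 1) M)
    {σ : Eu n → Eu n} (hσ : Measurable σ) {C : ℝ} (hC : ∀ x, ‖σ x‖ ≤ C)
    {β : ℝ → ℝ} {K : ℝ} (hβ : ContDiff ℝ (⊤ : ℕ∞) β) (hK : 0 < K)
    (hβ0 : β 0 = 0) (hβ1 : ∀ s, 1 ≤ s → β s = 1)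
    (hβd : ∀ s, 0 ≤ deriv β s ∧ deriv β s ≤ K) {δ : ℝ} (hδ : 0 < δ) (hδ1 : δ ≤ 1) (hδK : δ ≤ K)
    {η : ℝ} (hη : 0 < η) :
    ∀ᶠ j in atTop, ∫ x, φ x * fderiv ℝ
      (fun x => β (kconv (moll n j) (E.indicator fun _ => (1 : ℝ)) x / δ)) x (σ x) ≤ C * V + η := by
  have hC0 : 0 ≤ C := (norm_nonneg _).trans (hC 0)
  have hM0 : 0 ≤ M := hM.nonneg fun _ => zero_le_one
  obtain ⟨V', hV'V, hV', hopt⟩ := hV.exists_optimal hφ0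
  set κ := δ / K with hκdef
  have hκ : 0 < κ := by positivity
  have hκ1 : κ ≤ 1 := (div_le_one hK).2 hδK
  set ω := κ * η / (4 * (C * M + 1)) with hω
  have hω0 : 0 < ω := by positivity
  have hωC : C * (ω * M) ≤ κ * η / 4 := by
    have : C * (ω * M) = κ * η / 4 * (C * M / (C * M + 1)) := by
      rw [hω]; field_simp
    rw [this]
    refine mul_le_of_le_one_right (by positivity) ?_
    rw [div_le_one (by positivity)]
    linarith
  set η' := κ * η / (4 * (C + 1)) with hη'
  have hη'0 : 0 < η' := by positivity
  have hηC : C * η' ≤ κ * η / 4 := by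
    have : C * η' = κ * η / 4 * (C / (C + 1)) := by
      rw [hη']; field_simp
    rw [this]
    refine mul_le_of_le_one_right (by positivity) ?_
    rw [div_le_one (by positivity)]
    linarith
  obtain ⟨X, hX, hXφ, hXV⟩ := hopt η' hη'0
  set f : Eu n → ℝ := E.indicator fun _ => (1 : ℝ) with hf
  have hfm : Measurable f := measurable_const.indicator hE
  have hfb : ∀ x, |f x| ≤ 1 := indicator_one_abs_le E
  have hl : LocallyIntegrable f := indicator_one_locallyIntegrable hE
  have hφ1 : ContDiff ℝ 1 φ := hφ.1.of_le (by exact_mod_cast le_top)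
  set S := tsupport φ with hS
  have hScpt : IsCompact S := hφ.2.1
  have hφS : ∀ x ∉ S, φ x = 0 := fun x hx => image_eq_zero_of_notMem_tsupport hx
  have hXS : ∀ x ∉ S, X x = 0 := fun x hx => by
    have := hXφ x
    rw [hφS x hx] at this
    exact norm_le_zero_iff.1 this
  set G : ℝ → ℝ := fun s => s - κ * β (s / δ) with hG
  have hGC : ContDiff ℝ (⊤ : ℕ∞) G := by
    have : ContDiff ℝ (⊤ : ℕ∞) (fun s : ℝ => β (s / δ)) := hβ.comp (contDiff_id.div_const δ)
    exact contDiff_id.sub (contDiff_const.mul this)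
  have hGf : ∀ x, G (f x) = (1 - κ) * f x := by
    intro x
    by_cases hx : x ∈ E
    · have : β (1 / δ) = 1 := hβ1 _ ((one_le_div hδ).2 hδ1)
      simp only [hf, hG, indicator_of_mem hx, this]
      ring
    · simp [hf, hG, indicator_of_notMem hx, hβ0]
  have hlim := tendsto_integral_comp_moll hE hGC.continuous hX.integrable_dv
  have hlim2 : ∫ x, G (f x) * dv X x = (1 - κ) * ∫ x, f x * dv X x := by
    simp_rw [hGf, mul_assoc]
    rw [integral_const_mul]
  rw [hlim2] at hlim
  filter_upwards [hlim.eventually_const_lt (sub_lt_self _ hη'0),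
    exists_cthickening_mollRad_subset hScpt hΩ hφ.2.2,
    exists_cthickening_mollRad_subset hScpt hU hφU,
    uniform_mollify hφ.1.continuous hφ.2.1 hω0] with j hj1 hjΩ hjU hjω
  set p := kconv (moll n j) f with hp
  have hpC : ContDiff ℝ (⊤ : ℕ∞) p := kconv_moll_contDiff hl j
  have hpC1 : ContDiff ℝ 1 p := hpC.of_le (by exact_mod_cast le_top)
  have hpd : ∀ x, HasFDerivAt p (fderiv ℝ p x) x := fun x =>
    (hpC1.differentiable one_ne_zero x).hasFDerivAt
  have hgd : ∀ x, fderiv ℝ (fun x => β (p x / δ)) x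
      = (deriv β (p x / δ) / δ) • fderiv ℝ p x := by
    intro x
    have h1 : HasDerivAt (fun s : ℝ => β (s / δ)) (deriv β (p x / δ) * (1 / δ)) (p x) :=
      ((hβ.differentiable (by simp)).differentiableAt (x := p x / δ)).hasDerivAt.comp (p x)
        ((hasDerivAt_id (p x)).div_const δ)
    have h2 := h1.comp_hasFDerivAt x (hpd x)
    rw [mul_one_div] at h2
    exact h2.fderiv
  set c : Eu n → ℝ := fun x => κ * (deriv β (p x / δ) / δ) with hc
  have hβ'c : Continuous (deriv β) := hβ.continuous_deriv (by simp)
  have hcc : Continuous c := by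
    have := hpC.continuous
    fun_prop
  have hcI : ∀ x, c x ∈ Icc (0 : ℝ) 1 := by
    intro x
    have h1 := hβd (p x / δ)
    refine ⟨by have := h1.1; positivity, ?_⟩
    have : c x = deriv β (p x / δ) / K := by
      simp only [hc, hκdef]
      field_simp
    rw [this]
    exact (div_le_one hK).2 h1.2
  set Z : Eu n → Eu n := fun x => (c x * φ x) • σ x - ((1 - c x) * C) • X x with hZ
  have hZm : Measurable Z := by
    have h1 := hcc.measurable
    have h2 := hφ.1.continuous.measurable
    have h3 := hX.1.continuous.measurable
    fun_prop
  have hZb : ∀ x, ‖Z x‖ ≤ C * φ x := by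
    intro x
    have h1 := hcI x
    have h2 := hφ0 x
    have h3 : 0 ≤ 1 - c x := by linarith [h1.2]
    have h4 := h1.1
    refine (norm_sub_le _ _).trans ?_
    rw [norm_smul, norm_smul, Real.norm_of_nonneg (by positivity),
      Real.norm_of_nonneg (by positivity)]
    calc c x * φ x * ‖σ x‖ + (1 - c x) * C * ‖X x‖
        ≤ c x * φ x * C + (1 - c x) * C * φ x := by
          gcongr
          exacts [hC x, hXφ x]
      _ = C * φ x := by ring
  have hZS : ∀ x ∉ S, Z x = 0 := by
    intro x hx
    simp [hZ, hφS x hx, hXS x hx]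
  obtain ⟨Bφ, hBφ⟩ := hφ.2.1.exists_bound_of_continuous hφ.1.continuous
  have hZB : ∀ x, ‖Z x‖ ≤ C * Bφ := fun x =>
    (hZb x).trans (by gcongr; exact (Real.le_norm_self _).trans (hBφ x))
  have hZl : LocallyIntegrable Z := locallyIntegrable_of_bdd hZm.aestronglyMeasurable hZB
  have hY0 := kconv_moll_hasCompactSupport hScpt.isBounded hZS j
  have hYC : ContDiff ℝ 1 (kconv (moll n j) Z) :=
    kconv_contDiff (moll_contDiff_one n j) (moll_hasCompactSupport n j) hZl
  have hYb : ∀ x, ‖(-1 : ℝ) • kconv (moll n j) Z x‖ ≤ C * (φ x + ω) := by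
    intro x
    rw [norm_smul, norm_neg, norm_one, one_mul]
    refine kconv_moll_norm_le_of_ball j x fun y hy => (hZb y).trans ?_
    gcongr
    linarith [le_of_abs_le (hjω x y hy)]
  have hYΩ : IsTestField Ω (fun x => (-1 : ℝ) • kconv (moll n j) Z x) :=
    IsTestField.const_smul ⟨hYC, hY0.1, hY0.2.trans hjΩ⟩ (-1)
  have hYU : IsTestField U (fun x => (-1 : ℝ) • kconv (moll n j) Z x) :=
    IsTestField.const_smul ⟨hYC, hY0.1, hY0.2.trans hjU⟩ (-1)
  have hmain := hV'.le_of_add hfm hfb hφ1 hφ0 hM hC0 hω0 hYΩ hYU hYb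
  have hdual := integral_fderiv_kconv_moll hfm hfb hZm hZB hScpt hZS j
  have h1 : ∫ x, f x * dv (fun x => (-1 : ℝ) • kconv (moll n j) Z x) x
      = ∫ x, fderiv ℝ p x (Z x) := by
    rw [hdual, ← integral_neg]
    congr 1
    ext x
    rw [dv_const_smul]
    ring
  rw [h1] at hmain
  have hGp : ContDiff ℝ 1 (fun x => G (p x)) :=
    (hGC.comp hpC).of_le (by exact_mod_cast le_top)
  have hGd : ∀ x, fderiv ℝ (fun x => G (p x)) x (X x) = (1 - c x) * fderiv ℝ p x (X x) := by
    intro x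
    have h2 : fderiv ℝ (fun x => G (p x)) x
        = fderiv ℝ p x - κ • fderiv ℝ (fun x => β (p x / δ)) x := by
      have h3 : Differentiable ℝ (fun x => β (p x / δ)) :=
        (hβ.comp (hpC.div_const δ)).differentiable (by simp)
      have h4 := (hpd x).sub ((h3 x).hasFDerivAt.const_mul κ)
      exact h4.fderiv
    rw [h2, hgd]
    simp only [sub_apply, smul_apply, smul_eq_mul, hc]
    ring
  have hIBP := integral_mul_dv hGp hX
  simp_rw [hGd] at hIBP
  have hsplit : ∀ x, fderiv ℝ p x (Z x)
      = κ * (φ x * fderiv ℝ (fun x => β (p x / δ)) x (σ x))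
        - C * ((1 - c x) * fderiv ℝ p x (X x)) := by
    intro x
    rw [hgd]
    simp only [hZ, hc, map_sub, map_smul, smul_eq_mul, smul_apply]
    ring
  have hfpc : Continuous (fderiv ℝ p) := hpC1.continuous_fderiv one_ne_zero
  have i2 : Integrable (fun x => (1 - c x) * fderiv ℝ p x (X x)) := by
    refine Continuous.integrable_of_hasCompactSupport ?_ ?_
    · have := hX.1.continuous
      fun_prop
    · refine HasCompactSupport.of_support_subset_isCompact hScpt fun x hx => ?_
      by_contra h
      exact hx (by simp [hXS x h])
  have i1 : Integrable (fun x => φ x * fderiv ℝ (fun x => β (p x / δ)) x (σ x)) := by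
    have hgc : Continuous (fderiv ℝ (fun x => β (p x / δ))) :=
      (hβ.comp (hpC.div_const δ)).continuous_fderiv (by simp)
    have hcs : Continuous (fun x => φ x * ‖fderiv ℝ (fun x => β (p x / δ)) x‖ * C) := by
      have := hφ.1.continuous
      fun_prop
    have hi : Integrable (fun x => φ x * ‖fderiv ℝ (fun x => β (p x / δ)) x‖ * C) := by
      refine hcs.integrable_of_hasCompactSupport
        (HasCompactSupport.of_support_subset_isCompact hScpt fun x hx => ?_)
      by_contra h
      exact hx (by simp [hφS x h])
    refine hi.mono' ?_ (ae_of_all _ fun x => ?_)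
    · have h2 : Continuous (fun q : (Eu n →L[ℝ] ℝ) × Eu n => q.1 q.2) :=
        continuous_fst.clm_apply continuous_snd
      exact (hφ.1.continuous.measurable.mul
        (h2.measurable.comp (hgc.measurable.prodMk hσ))).aestronglyMeasurable
    · rw [norm_mul, Real.norm_of_nonneg (hφ0 x), mul_assoc]
      have := hφ0 x
      gcongr
      exact ((fderiv ℝ (fun x => β (p x / δ)) x).le_opNorm _).trans (by gcongr; exact hC x)
  simp_rw [hsplit] at hmain
  rw [integral_sub (i1.const_mul κ) (i2.const_mul C), integral_const_mul,
    integral_const_mul] at hmain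
  set I := ∫ x, φ x * fderiv ℝ (fun x => β (p x / δ)) x (σ x) with hI
  set J := ∫ x, (1 - c x) * fderiv ℝ p x (X x) with hJ
  have h5 : (1 - κ) * (V' - η') - η' ≤ -J := by
    rw [← hIBP]
    have : (1 - κ) * (V' - η') ≤ (1 - κ) * ∫ x, f x * dv X x :=
      mul_le_mul_of_nonneg_left hXV.le (by linarith)
    linarith
  have h6 : C * ((1 - κ) * (V' - η') - η') ≤ C * -J := mul_le_mul_of_nonneg_left h5 hC0
  have h7 : κ * I ≤ κ * (C * V' + η) := by
    have : 0 ≤ C * (κ * η') := by positivity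
    nlinarith
  have h8 := le_of_mul_le_mul_left h7 hκ
  have h9 : C * V' ≤ C * V := by gcongr
  linarith

end Pairing

section SetInequality

variable {n : ℕ}

lemma measurable_volume_real_inter_ball {E : Set (Eu n)} (hE : MeasurableSet E) (r : ℝ) :
    Measurable (fun x => volume.real (E ∩ ball x r)) := by
  have hm : MeasurableSet {p : Eu n × Eu n | p.2 ∈ E ∧ dist p.2 p.1 < r} :=
    (measurable_snd hE).inter
      (isOpen_lt (continuous_snd.dist continuous_fst) continuous_const).measurableSet
  exact (measurable_measure_prodMk_left (ν := volume) hm).ennreal_toReal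

lemma measurableSet_upperDense {E : Set (Eu n)} (hE : MeasurableSet E) (d : ℝ) :
    MeasurableSet (upperDense E d) := by
  unfold upperDense
  have : {x | ∃ᶠ k : ℕ in atTop, d * ((1 / 2 : ℝ) ^ k) ^ n
      < volume.real (E ∩ ball x ((1 / 2 : ℝ) ^ k))}
      = limsup (fun k : ℕ => {x | d * ((1 / 2 : ℝ) ^ k) ^ n
        < volume.real (E ∩ ball x ((1 / 2 : ℝ) ^ k))}) atTop := by
    ext x
    rw [mem_limsup_iff_frequently_mem]
    rfl
  rw [this]
  exact MeasurableSet.measurableSet_limsup fun k =>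
    measurableSet_lt measurable_const (measurable_volume_real_inter_ball hE _)

lemma upperDense_anti (E : Set (Eu n)) {d d' : ℝ} (h : d ≤ d') :
    upperDense E d' ⊆ upperDense E d := by
  intro x hx
  refine Frequently.mono hx fun k hk => lt_of_le_of_lt ?_ hk
  gcongr

lemma le_kconv_moll_indicator {E : Set (Eu n)} (hE : MeasurableSet E) {δ : ℝ} {j : ℕ} {x : Eu n}
    (h : δ * (mollRad j / 4) ^ n ≤ volume.real (E ∩ ball x (2 * (mollRad j / 4)))) :
    δ / (4 ^ n * volume.real (ball (0 : Eu n) 1))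
      ≤ kconv (moll n j) (E.indicator fun _ => (1 : ℝ)) x := by
  have hr := mollRad_pos j
  have hω := volume_real_ball_one_pos (n := n)
  rw [show 2 * (mollRad j / 4) = mollRad j / 2 by ring] at h
  set v := (volume.real (closedBall (0 : Eu n) (mollRad j)))⁻¹ with hv
  have hv0 : 0 ≤ v := by positivity
  have hintg : Integrable ((E ∩ ball x (mollRad j / 2)).indicator fun _ => v) :=
    integrable_indicator_ball (hE.inter measurableSet_ball)
      (measure_ball_lt_top (x := x) (r := mollRad j / 2)) inter_subset_right v
  calc δ / (4 ^ n * volume.real (ball (0 : Eu n) 1)) = δ * (mollRad j / 4) ^ n * v := by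
        rw [hv, volume_real_closedBall 0 hr, div_pow]
        field_simp
    _ ≤ volume.real (E ∩ ball x (mollRad j / 2)) * v := by gcongr
    _ = ∫ y, (E ∩ ball x (mollRad j / 2)).indicator (fun _ => v) y := by
        rw [integral_indicator_const _ (hE.inter measurableSet_ball), smul_eq_mul]
    _ ≤ ∫ y, moll n j (x - y) • E.indicator (fun _ => (1 : ℝ)) y := by
        refine integral_mono hintg (integrable_kernel_smul (moll_continuous n j)
          (moll_hasCompactSupport n j) (indicator_one_locallyIntegrable hE) x) fun y => ?_
        by_cases hy : y ∈ E ∩ ball x (mollRad j / 2)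
        · rw [indicator_of_mem hy]
          dsimp only
          rw [indicator_of_mem hy.1, smul_eq_mul, mul_one]
          exact moll_lower hy.2
        · rw [indicator_of_notMem hy]
          exact mul_nonneg (moll_nonneg n j _) (indicator_one_mem_Icc E y).1
    _ = _ := rfl

lemma integrable_fderiv_apply {Ω : Set (Eu n)} {φ : Eu n → ℝ} (hφ : IsTest Ω φ)
    {σ : Eu n → Eu n} (hσ : Measurable σ) {C : ℝ} (hC : ∀ x, ‖σ x‖ ≤ C) :
    Integrable (fun x => fderiv ℝ φ x (σ x)) := by
  have hc : Continuous (fderiv ℝ φ) := hφ.1.continuous_fderiv (by simp)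
  have hi : Integrable (fun x => ‖fderiv ℝ φ x‖ * C) :=
    (hc.norm.integrable_of_hasCompactSupport (hφ.2.1.fderiv ℝ).norm).mul_const C
  refine hi.mono' ?_ (ae_of_all _ fun x => ?_)
  · have h2 : Continuous (fun q : (Eu n →L[ℝ] ℝ) × Eu n => q.1 q.2) :=
      continuous_fst.clm_apply continuous_snd
    exact (h2.measurable.comp (hc.measurable.prodMk hσ)).aestronglyMeasurable
  · exact ((fderiv ℝ φ x).le_opNorm _).trans (by gcongr; exact hC x)

lemma IsTest.mul_contDiff {Ω : Set (Eu n)} {φ g : Eu n → ℝ} (hφ : IsTest Ω φ)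
    (hg : ContDiff ℝ (⊤ : ℕ∞) g) : IsTest Ω (fun x => φ x * g x) := by
  refine ⟨hφ.1.mul hg, HasCompactSupport.mul_right (f := φ) hφ.2.1, ?_⟩
  exact (tsupport_mul_subset_left (f := φ) (g := g)).trans hφ.2.2

lemma setIntegral_upperDense_le {Ω U E : Set (Eu n)} (hΩ : IsOpen Ω) (hU : IsOpen U)
    (hE : MeasurableSet E)
    {φ : Eu n → ℝ} (hφ : IsTest Ω φ) (hφ0 : ∀ x, 0 ≤ φ x) (hφU : tsupport φ ⊆ U) {V M : ℝ}
    (hV : VarLe (E.indicator fun _ => 1) Ω φ V)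
    (hM : VarLe (E.indicator fun _ => 1) U (fun _ => 1) M)
    {σ : Eu n → Eu n} (hσ : Measurable σ) {C : ℝ} (hC : ∀ x, ‖σ x‖ ≤ C)
    {μ : Measure (Eu n)} [IsFiniteMeasure μ]
    (hrep : ∀ ψ, IsTest Ω ψ → ∫ x, fderiv ℝ ψ x (σ x) = ∫ x, ψ x ∂μ)
    {d : ℝ} (hd0 : 0 < d) (hd : d * 4 ^ n ≤ volume.real (ball (0 : Eu n) 1) / 2) {A : Set (Eu n)}
    (hA : MeasurableSet A) (hAd : A ⊆ upperDense E d) :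
    ∫ x in A, φ x ∂μ ≤ C * V + ∫ x, E.indicator (fun _ => 1) x * fderiv ℝ φ x (σ x) := by
  refine le_of_forall_pos_le_add fun η hη => ?_
  obtain ⟨r, hr, hrU⟩ := hφ.2.1.isCompact.exists_thickening_subset_open (hU.inter hΩ)
    (subset_inter hφU hφ.2.2)
  obtain ⟨Bφ, hBφ⟩ := hφ.2.1.exists_bound_of_continuous hφ.1.continuous
  have hB0 : 0 ≤ Bφ := (norm_nonneg _).trans (hBφ 0)
  have hsubr : ∀ x ∈ tsupport φ, ball x r ⊆ U ∩ Ω := fun x hx =>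
    (ball_subset_thickening hx r).trans hrU
  have hK : ∀ x ∈ tsupport φ, ball x (r / 2) ⊆ {x | ball x (r / 2) ⊆ U} ∩ Ω := by
    intro x hx y hy
    rw [mem_ball] at hy
    refine ⟨fun z hz => (hsubr x hx ?_).1, (hsubr x hx (mem_ball.2 (by linarith))).2⟩
    rw [mem_ball] at hz ⊢
    linarith [dist_triangle z y x]
  obtain ⟨δ, hδ, hbad⟩ := measure_upperDense_le (O := {x | ball x (r / 2) ⊆ U})
    (K := tsupport φ) (r := r / 2) hE hM (by positivity) (fun x hx => hx)
    hK hC hrep hd0 hd (η := η / (3 * (Bφ + 1))) (by positivity)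
  obtain ⟨β, K, hβ, hK, hβI, hβ0, hβ1, hβd⟩ := exists_step
  have hω := volume_real_ball_one_pos (n := n)
  set δ' := min (δ / (4 ^ n * volume.real (ball (0 : Eu n) 1))) (min 1 K) with hδ'
  have hδ'0 : 0 < δ' := by positivity
  have hpair := eventually_pairing_le hΩ hU hE hφ hφ0 hφU hV hM hσ hC hβ hK (hβ0 0 le_rfl) hβ1 hβd
    hδ'0 ((min_le_right _ _).trans (min_le_left _ _))
    ((min_le_right _ _).trans (min_le_right _ _)) (η := η / 3) (by positivity)
  have hrad : Tendsto (fun j => mollRad j / 4) atTop (𝓝[>] 0) := by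
    rw [tendsto_nhdsWithin_iff]
    refine ⟨by simpa using mollRad_tendsto.div_const 4, Eventually.of_forall fun j => ?_⟩
    have := mollRad_pos j
    exact div_pos this (by norm_num)
  have hφσ := integrable_fderiv_apply hφ hσ hC
  have hlim := tendsto_integral_comp_moll hE (G := fun s => β (s / δ'))
    (hβ.continuous.comp (continuous_id.div_const δ')) hφσ
  have hGf : ∀ x, β (E.indicator (fun _ => (1 : ℝ)) x / δ') = E.indicator (fun _ => (1 : ℝ)) x := by
    intro x
    by_cases hx : x ∈ E
    · have : 1 ≤ 1 / δ' :=
        (one_le_div hδ'0).2 ((min_le_right _ _).trans (min_le_left _ _))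
      simp only [indicator_of_mem hx, hβ1 _ this]
    · simp [indicator_of_notMem hx, hβ0 0 le_rfl]
  simp_rw [hGf] at hlim
  obtain ⟨j, hj1, hj2, hj3⟩ := (hpair.and ((hrad.eventually hbad).and
    (hlim.eventually_lt_const (lt_add_of_pos_right _ (by positivity : 0 < η / 3))))).exists
  set p := kconv (moll n j) (E.indicator fun _ => (1 : ℝ)) with hp
  have hpC : ContDiff ℝ (⊤ : ℕ∞) p :=
    kconv_moll_contDiff (indicator_one_locallyIntegrable hE) j
  have hgC : ContDiff ℝ (⊤ : ℕ∞) (fun x => β (p x / δ')) := hβ.comp (hpC.div_const δ')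
  have htest := hφ.mul_contDiff hgC
  have hid := hrep _ htest
  have hder : ∀ x, fderiv ℝ (fun x => φ x * β (p x / δ')) x (σ x)
      = φ x * fderiv ℝ (fun x => β (p x / δ')) x (σ x) + β (p x / δ') * fderiv ℝ φ x (σ x) := by
    intro x
    rw [fderiv_fun_mul (hφ.1.differentiable (by simp) x) (hgC.differentiable (by simp) x)]
    simp
  have i2 : Integrable (fun x => β (p x / δ') * fderiv ℝ φ x (σ x)) :=
    hφσ.bdd_mul (c := 1) hgC.continuous.aestronglyMeasurable
      (ae_of_all _ fun x => by
        rw [Real.norm_of_nonneg (hβI _).1]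
        exact (hβI _).2)
  have i1 : Integrable (fun x => φ x * fderiv ℝ (fun x => β (p x / δ')) x (σ x)) := by
    have := (integrable_fderiv_apply htest hσ hC).sub i2
    refine this.congr (ae_of_all _ fun x => ?_)
    simp only [Pi.sub_apply, hder]
    ring
  simp_rw [hder] at hid
  rw [integral_add i1 i2] at hid
  set T := {x | x ∈ tsupport φ ∧ x ∈ upperDense E d ∧
    volume.real (E ∩ ball x (2 * (mollRad j / 4))) ≤ δ * (mollRad j / 4) ^ n} with hT
  have iψ : Integrable (fun x => φ x * β (p x / δ')) μ :=
    htest.1.continuous.integrable_of_hasCompactSupport htest.2.1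
  have iφ : Integrable φ μ := hφ.1.continuous.integrable_of_hasCompactSupport hφ.2.1
  have hTm := measurableSet_toMeasurable μ T
  have iT : Integrable ((toMeasurable μ T).indicator fun _ => Bφ) μ :=
    (integrable_const _).indicator hTm
  have hbound : ∫ x in A, φ x ∂μ ≤ (∫ x, φ x * β (p x / δ') ∂μ) + Bφ * μ.real T := by
    have h1 : ∫ x, (toMeasurable μ T).indicator (fun _ => Bφ) x ∂μ = Bφ * μ.real T := by
      rw [integral_indicator_const _ hTm, smul_eq_mul, mul_comm, measureReal_def,
        measure_toMeasurable, measureReal_def]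
    rw [← h1, ← integral_add iψ iT, ← integral_indicator hA]
    refine integral_mono (iφ.indicator hA) (iψ.add iT) fun x => ?_
    have hnn : 0 ≤ φ x * β (p x / δ') := mul_nonneg (hφ0 x) (hβI _).1
    have hind : ∀ x, 0 ≤ (toMeasurable μ T).indicator (fun _ => Bφ) x := fun x =>
      indicator_nonneg (fun _ _ => hB0) x
    by_cases hx : x ∈ A
    · rw [indicator_of_mem hx]
      by_cases hxT : x ∈ T
      · simp only [indicator_of_mem (subset_toMeasurable μ T hxT)]
        have := (Real.le_norm_self _).trans (hBφ x)
        linarith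
      · by_cases hxs : x ∈ tsupport φ
        · have h2 : δ * (mollRad j / 4) ^ n ≤ volume.real (E ∩ ball x (2 * (mollRad j / 4))) := by
            by_contra! h
            exact hxT ⟨hxs, hAd hx, h.le⟩
          have h3 : 1 ≤ p x / δ' := by
            rw [one_le_div hδ'0]
            exact (min_le_left _ _).trans (le_kconv_moll_indicator hE h2)
          rw [hβ1 _ h3, mul_one]
          linarith [hind x]
        · rw [image_eq_zero_of_notMem_tsupport hxs, zero_mul, zero_add]
          exact hind x
    · rw [indicator_of_notMem hx]
      exact add_nonneg hnn (hind x)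
  have hlast : Bφ * μ.real T ≤ η / 3 := by
    calc Bφ * μ.real T ≤ Bφ * (η / (3 * (Bφ + 1))) := by gcongr
      _ = η / 3 * (Bφ / (Bφ + 1)) := by field_simp
      _ ≤ η / 3 := by
          refine mul_le_of_le_one_right (by positivity) ?_
          rw [div_le_one (by positivity)]
          linarith
  linarith

/-- The pairing inequality for a set of locally finite perimeter. -/
lemma setIntegral_le_of_varLe {Ω U E : Set (Eu n)} (hΩ : IsOpen Ω) (hU : IsOpen U)
    (hE : MeasurableSet E)
    {φ : Eu n → ℝ} (hφ : IsTest Ω φ) (hφ0 : ∀ x, 0 ≤ φ x) (hφU : tsupport φ ⊆ U) {V M : ℝ}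
    (hV : VarLe (E.indicator fun _ => 1) Ω φ V)
    (hM : VarLe (E.indicator fun _ => 1) U (fun _ => 1) M)
    {σ : Eu n → Eu n} (hσ : Measurable σ) {C : ℝ} (hC : ∀ x, ‖σ x‖ ≤ C)
    {μ : Measure (Eu n)} [IsFiniteMeasure μ]
    (hrep : ∀ ψ, IsTest Ω ψ → ∫ x, fderiv ℝ ψ x (σ x) = ∫ x, ψ x ∂μ)
    {A : Set (Eu n)} (hA : MeasurableSet A) (hAd : ∀ x ∈ A, ∃ d > 0, x ∈ upperDense E d) :
    ∫ x in A, φ x ∂μ ≤ C * V + ∫ x, E.indicator (fun _ => 1) x * fderiv ℝ φ x (σ x) := by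
  set s : ℕ → Set (Eu n) := fun m => A ∩ upperDense E (1 / ((m : ℝ) + 1)) with hs
  have hsm : ∀ m, MeasurableSet (s m) := fun m => hA.inter (measurableSet_upperDense hE _)
  have hmono : Monotone s := fun a b hab => by
    refine inter_subset_inter_right _ (upperDense_anti E ?_)
    gcongr
  have hUn : ⋃ m, s m = A := by
    refine subset_antisymm (iUnion_subset fun m => inter_subset_left) fun x hx => ?_
    obtain ⟨d, hd, hxd⟩ := hAd x hx
    obtain ⟨m, hm⟩ := exists_nat_one_div_lt hd
    exact mem_iUnion.2 ⟨m, hx, upperDense_anti E hm.le hxd⟩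
  have iφ : Integrable φ μ := hφ.1.continuous.integrable_of_hasCompactSupport hφ.2.1
  have hlim := tendsto_setIntegral_of_monotone hsm hmono iφ.integrableOn
  rw [hUn] at hlim
  refine le_of_tendsto hlim ?_
  have hω := volume_real_ball_one_pos (n := n)
  have hsmall : ∀ᶠ m : ℕ in atTop,
      1 / ((m : ℝ) + 1) ≤ volume.real (ball (0 : Eu n) 1) / 2 / 4 ^ n :=
    tendsto_one_div_add_atTop_nhds_zero_nat.eventually_le_const (by positivity)
  filter_upwards [hsmall] with m hm
  refine setIntegral_upperDense_le hΩ hU hE hφ hφ0 hφU hV hM hσ hC hrep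
    (d := 1 / ((m : ℝ) + 1)) (by positivity) ?_ (hsm m) inter_subset_right
  rwa [le_div_iff₀ (by positivity)] at hm

end SetInequality

/-! ### A coarea inequality -/

section Coarea

variable {n : ℕ}

lemma norm_fderiv_kconv_moll_le {Ω : Set (Eu n)} {u : Eu n → ℝ} (hu : LocallyIntegrable u)
    {ν : Measure (Eu n)}
    (hG : ∀ ψ, IsTest Ω ψ → (∀ x, 0 ≤ ψ x) → ∀ v,
      ∫ x, u x * fderiv ℝ ψ x v ≤ ‖v‖ * ∫ x, ψ x ∂ν) {j : ℕ} {x : Eu n}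
    (hx : closedBall x (mollRad j) ⊆ Ω) :
    ‖fderiv ℝ (kconv (moll n j) u) x‖ ≤ ∫ y, moll n j (x - y) ∂ν := by
  have hψC : ContDiff ℝ (⊤ : ℕ∞) (fun y => moll n j (x - y)) :=
    (moll_contDiff n j).comp (contDiff_const.sub contDiff_id)
  have hsupp : Function.support (fun y => moll n j (x - y)) ⊆ closedBall x (mollRad j) := by
    intro y hy
    by_contra h
    exact hy (moll_eq_zero fun h' => h (ball_subset_closedBall h'))
  have hψ : IsTest Ω (fun y => moll n j (x - y)) :=
    ⟨hψC, HasCompactSupport.of_support_subset_isCompact (isCompact_closedBall _ _) hsupp,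
      (closure_minimal hsupp isClosed_closedBall).trans hx⟩
  have h0 : 0 ≤ ∫ y, moll n j (x - y) ∂ν := integral_nonneg fun y => moll_nonneg n j _
  have hd : ∀ y v, fderiv ℝ (fun y => moll n j (x - y)) y v = - fderiv ℝ (moll n j) (x - y) v := by
    intro y v
    have h1 : HasFDerivAt (fun y : Eu n => x - y) (-ContinuousLinearMap.id ℝ (Eu n)) y :=
      (hasFDerivAt_id y).const_sub x
    have h2 := (((moll_contDiff n j).differentiable (by simp)) (x - y)).hasFDerivAt.comp y h1
    have h3 : fderiv ℝ (fun y => moll n j (x - y)) y = _ := h2.fderiv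
    rw [h3]
    simp
  have hle : ∀ v, fderiv ℝ (kconv (moll n j) u) x v ≤ (∫ y, moll n j (x - y) ∂ν) * ‖v‖ := by
    intro v
    have h1 := hG _ hψ (fun y => moll_nonneg n j _) (-v)
    rw [norm_neg, mul_comm] at h1
    refine le_trans (le_of_eq ?_) h1
    rw [kconv_fderiv (moll_contDiff_one n j) (moll_hasCompactSupport n j) hu]
    congr 1
    ext y
    rw [hd, map_neg, neg_neg, smul_eq_mul, mul_comm]
  refine ContinuousLinearMap.opNorm_le_bound _ h0 fun v => ?_
  rw [Real.norm_eq_abs, abs_le]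
  refine ⟨?_, hle v⟩
  have := hle (-v)
  rw [map_neg, norm_neg] at this
  linarith

lemma eventually_integral_norm_fderiv_le {Ω : Set (Eu n)} (hΩ : IsOpen Ω) {u : Eu n → ℝ}
    (hu : LocallyIntegrable u) {ν : Measure (Eu n)} [IsFiniteMeasure ν]
    (hG : ∀ ψ, IsTest Ω ψ → (∀ x, 0 ≤ ψ x) → ∀ v,
      ∫ x, u x * fderiv ℝ ψ x v ≤ ‖v‖ * ∫ x, ψ x ∂ν)
    {φ : Eu n → ℝ} (hφ : IsTest Ω φ) (hφ0 : ∀ x, 0 ≤ φ x) {ω : ℝ} (hω : 0 < ω) :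
    ∀ᶠ j in atTop, ∫ x, φ x * ‖fderiv ℝ (kconv (moll n j) u) x‖ ≤ (∫ x, φ x ∂ν) + ω := by
  have hω' : 0 < ω / (ν.real univ + 1) := by positivity
  filter_upwards [exists_cthickening_mollRad_subset hφ.2.1 hΩ hφ.2.2,
    uniform_mollify hφ.1.continuous hφ.2.1 hω'] with j hj1 hj2
  have hφs : ∀ x ∉ tsupport φ, φ x = 0 := fun x hx => image_eq_zero_of_notMem_tsupport hx
  obtain ⟨Bφ, hBφ⟩ := hφ.2.1.exists_bound_of_continuous hφ.1.continuous
  obtain ⟨Bk, hBk⟩ := (moll_hasCompactSupport n j).exists_bound_of_continuous (moll_continuous n j)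
  have hB0 : 0 ≤ Bφ := (norm_nonneg _).trans (hBφ 0)
  have hcont : Continuous (fun p : Eu n × Eu n => φ p.1 * moll n j (p.1 - p.2)) := by
    have := hφ.1.continuous
    have := moll_continuous n j
    fun_prop
  have hintg : Integrable (fun p : Eu n × Eu n => φ p.1 * moll n j (p.1 - p.2))
      ((volume : Measure (Eu n)).prod ν) := by
    have hm : MeasurableSet (tsupport φ ×ˢ (univ : Set (Eu n))) :=
      hφ.2.1.measurableSet.prod MeasurableSet.univ
    have hbd : Integrable ((tsupport φ ×ˢ (univ : Set (Eu n))).indicator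
        fun _ : Eu n × Eu n => Bφ * Bk) ((volume : Measure (Eu n)).prod ν) := by
      rw [integrable_indicator_iff hm]
      refine integrableOn_const ?_
      rw [Measure.prod_prod]
      exact ENNReal.mul_ne_top hφ.2.1.measure_lt_top.ne (measure_ne_top _ _)
    refine hbd.mono' hcont.aestronglyMeasurable (ae_of_all _ fun p => ?_)
    by_cases hp : p.1 ∈ tsupport φ
    · have hp' : p ∈ tsupport φ ×ˢ (univ : Set (Eu n)) := ⟨hp, mem_univ _⟩
      rw [indicator_of_mem hp', norm_mul]
      exact mul_le_mul (hBφ _) (hBk _) (norm_nonneg _) hB0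
    · rw [indicator_of_notMem (fun h => hp h.1), hφs _ hp]
      simp
  have hswap := integral_integral_swap (f := fun x y => φ x * moll n j (x - y)) hintg
  have hC1 : ContDiff ℝ 1 (kconv (moll n j) u) :=
    kconv_contDiff (moll_contDiff_one n j) (moll_hasCompactSupport n j) hu
  calc ∫ x, φ x * ‖fderiv ℝ (kconv (moll n j) u) x‖
      ≤ ∫ x, ∫ y, φ x * moll n j (x - y) ∂ν := by
        refine integral_mono ?_ hintg.integral_prod_left fun x => ?_
        · refine Continuous.integrable_of_hasCompactSupport
            (hφ.1.continuous.mul (hC1.continuous_fderiv one_ne_zero).norm)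
            (HasCompactSupport.mul_right (f := φ) hφ.2.1)
        · dsimp only
          rw [integral_const_mul]
          by_cases hx : x ∈ tsupport φ
          · refine mul_le_mul_of_nonneg_left (norm_fderiv_kconv_moll_le hu hG ?_) (hφ0 x)
            refine (closedBall_subset_cthickening hx _).trans hj1
          · rw [hφs x hx]
            simp
    _ = ∫ y, (∫ x, φ x * moll n j (x - y)) ∂ν := hswap
    _ ≤ ∫ y, (φ y + ω / (ν.real univ + 1)) ∂ν := by
        refine integral_mono hintg.integral_prod_right ?_ fun y => ?_
        · exact (hφ.1.continuous.integrable_of_hasCompactSupport hφ.2.1).add (integrable_const _)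
        · have hk : kconv (moll n j) φ y = ∫ x, φ x * moll n j (x - y) := by
            unfold kconv
            congr 1
            ext x
            rw [moll_sub_comm, smul_eq_mul, mul_comm]
          dsimp only
          rw [← hk]
          refine (kconv_moll_mem_Icc (a := 0) (b := φ y + ω / (ν.real univ + 1))
            hφ.1.continuous.locallyIntegrable j y fun z hz => ⟨hφ0 z, ?_⟩).2
          linarith [le_of_abs_le (hj2 y z hz)]
    _ = (∫ x, φ x ∂ν) + ν.real univ * (ω / (ν.real univ + 1)) := by
        rw [integral_add (hφ.1.continuous.integrable_of_hasCompactSupport hφ.2.1)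
          (integrable_const _), integral_const, smul_eq_mul]
    _ ≤ (∫ x, φ x ∂ν) + ω := by
        gcongr
        have : ν.real univ * (ω / (ν.real univ + 1)) = ω * (ν.real univ / (ν.real univ + 1)) := by
          field_simp
        rw [this]
        refine mul_le_of_le_one_right hω.le ?_
        rw [div_le_one (by positivity)]
        linarith

lemma exists_steep_step {θ : ℝ} (hθ : 0 < θ) : ∃ β : ℝ → ℝ, ContDiff ℝ 1 β ∧
    (∀ s, s ≤ 0 → β s = 0) ∧ (∀ s, 1 ≤ s → β s = 1) ∧ (∀ s, β s ∈ Icc (0 : ℝ) 1) ∧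
    (∀ s, 0 ≤ deriv β s ∧ deriv β s ≤ 1 + θ) ∧ ∀ s ∉ Ico (0 : ℝ) 1, deriv β s = 0 := by
  obtain ⟨η, hη, hη4, hη1⟩ : ∃ η : ℝ, 0 < η ∧ η ≤ 1 / 4 ∧ 1 ≤ (1 + θ) * (1 - 2 * η) := by
    refine ⟨min (1 / 4) (θ / (2 * (1 + θ))), by positivity, min_le_left _ _, ?_⟩
    have h1 : min (1 / 4) (θ / (2 * (1 + θ))) ≤ θ / (2 * (1 + θ)) := min_le_right _ _
    rw [le_div_iff₀ (by positivity)] at h1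
    nlinarith
  set τ : ℝ → ℝ := fun s => max 0 (min 1 (min (s / η) ((1 - s) / η))) with hτ
  have hτc : Continuous τ := by fun_prop
  have hτI : ∀ s, τ s ∈ Icc (0 : ℝ) 1 := fun s =>
    ⟨le_max_left _ _, max_le zero_le_one (min_le_left _ _)⟩
  have hτ0 : ∀ s, s ≤ 0 → τ s = 0 := fun s hs =>
    max_eq_left ((min_le_right _ _).trans ((min_le_left _ _).trans
      (div_nonpos_of_nonpos_of_nonneg hs hη.le)))
  have hτ1 : ∀ s, 1 ≤ s → τ s = 0 := fun s hs =>
    max_eq_left ((min_le_right _ _).trans ((min_le_right _ _).trans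
      (div_nonpos_of_nonpos_of_nonneg (by linarith) hη.le)))
  have hτm : ∀ s ∈ Icc η (1 - η), τ s = 1 := by
    intro s hs
    have h1 : 1 ≤ s / η := (one_le_div hη).2 hs.1
    have h2 : 1 ≤ (1 - s) / η := (one_le_div hη).2 (by linarith [hs.2])
    simp only [hτ]
    rw [min_eq_left (le_min h1 h2), max_eq_right zero_le_one]
  have hii : ∀ a b, IntervalIntegrable τ volume a b := fun a b => hτc.intervalIntegrable a b
  have hnn : ∀ a b, a ≤ b → 0 ≤ ∫ s in a..b, τ s := fun a b hab =>
    intervalIntegral.integral_nonneg hab fun s _ => (hτI s).1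
  set m := ∫ s in (0 : ℝ)..1, τ s with hm
  have hm1 : 1 - 2 * η ≤ m := by
    have h1 : ∫ s in η..(1 - η), τ s = 1 - 2 * η := by
      rw [intervalIntegral.integral_congr (g := fun _ => (1 : ℝ))]
      · simp
        ring
      · intro s hs
        rw [uIcc_of_le (by linarith)] at hs
        exact hτm s hs
    have h2 : m = (∫ s in (0 : ℝ)..η, τ s) + (∫ s in η..(1 - η), τ s)
        + ∫ s in (1 - η)..1, τ s := by
      rw [intervalIntegral.integral_add_adjacent_intervals (hii _ _) (hii _ _),
        intervalIntegral.integral_add_adjacent_intervals (hii _ _) (hii _ _)]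
    have h3 := hnn 0 η hη.le
    have h4 := hnn (1 - η) 1 (by linarith)
    linarith
  have hm0 : 0 < m := by linarith
  set β : ℝ → ℝ := fun s => (∫ r in (0 : ℝ)..s, τ r) / m with hβ
  have hder : ∀ s, HasDerivAt β (τ s / m) s := fun s =>
    (intervalIntegral.integral_hasDerivAt_right (hii 0 s)
      (hτc.stronglyMeasurableAtFilter _ _) hτc.continuousAt).div_const m
  have hderiv : deriv β = fun s => τ s / m := funext fun s => (hder s).deriv
  have hβ0 : ∀ s, s ≤ 0 → β s = 0 := by
    intro s hs
    simp only [hβ]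
    rw [intervalIntegral.integral_congr (g := fun _ => (0 : ℝ))]
    · simp
    · intro r hr
      rw [uIcc_of_ge hs] at hr
      exact hτ0 r hr.2
  have hβ1 : ∀ s, 1 ≤ s → β s = 1 := by
    intro s hs
    simp only [hβ]
    rw [← intervalIntegral.integral_add_adjacent_intervals (hii 0 1) (hii 1 s),
      intervalIntegral.integral_congr (a := 1) (g := fun _ => (0 : ℝ))]
    · simp only [intervalIntegral.integral_zero, add_zero]
      exact div_self hm0.ne'
    · intro r hr
      rw [uIcc_of_le hs] at hr
      exact hτ1 r hr.1
  have hmono : Monotone β := monotone_of_deriv_nonneg (fun s => (hder s).differentiableAt)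
    fun s => by
      rw [hderiv]
      exact div_nonneg (hτI s).1 hm0.le
  refine ⟨β, ?_, hβ0, hβ1, ?_, ?_, ?_⟩
  · rw [contDiff_one_iff_deriv]
    refine ⟨fun s => (hder s).differentiableAt, ?_⟩
    rw [hderiv]
    exact hτc.div_const m
  · intro s
    constructor
    · rw [← hβ0 (min s 0) (min_le_right _ _)]
      exact hmono (min_le_left _ _)
    · rw [← hβ1 (max s 1) (le_max_right _ _)]
      exact hmono (le_max_left _ _)
  · intro s
    rw [hderiv]
    refine ⟨div_nonneg (hτI s).1 hm0.le, ?_⟩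
    rw [div_le_iff₀ hm0]
    have := (hτI s).2
    nlinarith
  · intro s hs
    rw [hderiv]
    dsimp only
    rw [mem_Ico, not_and_or, not_le, not_lt] at hs
    rcases hs with hs | hs
    · rw [hτ0 s hs.le, zero_div]
    · rw [hτ1 s hs, zero_div]

end Coarea

section Coarea

variable {n : ℕ}

lemma integral_step_dv_le {v : Eu n → ℝ} (hv : ContDiff ℝ 1 v) {Ω : Set (Eu n)} {φ : Eu n → ℝ}
    (hφ : Continuous φ) (hφc : HasCompactSupport φ) {β : ℝ → ℝ} (hβ : ContDiff ℝ 1 β) {L : ℝ}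
    (hβd : ∀ s, 0 ≤ deriv β s ∧ deriv β s ≤ L) (hβs : ∀ s ∉ Ico (0 : ℝ) 1, deriv β s = 0)
    (t : ℝ) {h : ℝ} (hh : 0 < h) {X : Eu n → Eu n} (hX : IsTestField Ω X)
    (hXφ : ∀ x, ‖X x‖ ≤ φ x) :
    ∫ x, β ((v x - t) / h) * dv X x ≤ L / h * ((∫ x in {x | v x < t + h}, φ x * ‖fderiv ℝ v x‖)
      - ∫ x in {x | v x < t}, φ x * ‖fderiv ℝ v x‖) := by
  have hL : 0 ≤ L := (hβd 0).1.trans (hβd 0).2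
  have hvd := hv.differentiable one_ne_zero
  have hintg : Integrable (fun x => φ x * ‖fderiv ℝ v x‖) :=
    Continuous.integrable_of_hasCompactSupport
      (hφ.mul (hv.continuous_fderiv one_ne_zero).norm) (HasCompactSupport.mul_right (f := φ) hφc)
  have hm : ∀ s, MeasurableSet {x | v x < s} := fun s =>
    (isOpen_lt hv.continuous continuous_const).measurableSet
  have hg : ContDiff ℝ 1 (fun x => β ((v x - t) / h)) :=
    hβ.comp ((hv.sub contDiff_const).div_const h)
  have hsub : {x | v x < t} ⊆ {x | v x < t + h} := fun x hx => by
    simp only [mem_ofPred_eq] at hx ⊢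
    linarith
  rw [integral_mul_dv hg hX, ← integral_neg, ← setIntegral_sdiff (hm t) hintg.integrableOn hsub,
    ← integral_const_mul,
    ← integral_indicator ((hm _).diff (hm _))]
  have hder : ∀ x w, fderiv ℝ (fun x => β ((v x - t) / h)) x w
      = deriv β ((v x - t) / h) * (fderiv ℝ v x w / h) := by
    intro x w
    have h1 : HasFDerivAt (fun x => (v x - t) / h) ((1 / h) • fderiv ℝ v x) x := by
      have := ((hvd x).hasFDerivAt.sub_const t).const_mul (1 / h)
      refine this.congr_of_eventuallyEq (Eventually.of_forall fun y => ?_)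
      simp only
      ring
    have h2 : HasDerivAt β (deriv β ((v x - t) / h)) ((v x - t) / h) :=
      (hβ.differentiable one_ne_zero _).hasDerivAt
    have h3 := (h2.comp_hasFDerivAt x h1).fderiv
    have h4 : (β ∘ fun x => (v x - t) / h) = fun x => β ((v x - t) / h) := rfl
    rw [h4] at h3
    rw [h3, smul_apply, smul_apply, smul_eq_mul, smul_eq_mul]
    ring
  refine integral_mono ?_ ((hintg.const_mul (L / h)).indicator ((hm _).diff (hm _))) fun x => ?_
  · refine Integrable.neg (Continuous.integrable_of_hasCompactSupport
      ((hg.continuous_fderiv one_ne_zero).clm_apply hX.1.continuous) ?_)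
    refine hX.2.1.mono fun x hx => ?_
    intro h0
    exact hx (by simp [h0])
  · dsimp only
    rw [hder]
    by_cases hx : v x < t + h ∧ ¬ v x < t
    · have hx' : x ∈ {x | v x < t + h} \ {x | v x < t} := hx
      rw [indicator_of_mem hx']
      have h1 : -(fderiv ℝ v x (X x)) ≤ φ x * ‖fderiv ℝ v x‖ := by
        have h2 := (fderiv ℝ v x).le_opNorm (X x)
        have h3 := mul_le_mul_of_nonneg_left (hXφ x) (norm_nonneg (fderiv ℝ v x))
        have h4 := neg_le_abs (fderiv ℝ v x (X x))
        rw [← Real.norm_eq_abs] at h4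
        linarith [mul_comm (φ x) ‖fderiv ℝ v x‖]
      have h0 : 0 ≤ φ x * ‖fderiv ℝ v x‖ :=
        mul_nonneg ((norm_nonneg _).trans (hXφ x)) (norm_nonneg _)
      calc -(deriv β ((v x - t) / h) * (fderiv ℝ v x (X x) / h))
          = deriv β ((v x - t) / h) / h * -(fderiv ℝ v x (X x)) := by ring
        _ ≤ deriv β ((v x - t) / h) / h * (φ x * ‖fderiv ℝ v x‖) :=
            mul_le_mul_of_nonneg_left h1 (div_nonneg (hβd _).1 hh.le)
        _ ≤ L / h * (φ x * ‖fderiv ℝ v x‖) := by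
            refine mul_le_mul_of_nonneg_right ?_ h0
            have := (hβd ((v x - t) / h)).2
            gcongr
    · have hx' : x ∉ {x | v x < t + h} \ {x | v x < t} := hx
      rw [indicator_of_notMem hx', hβs]
      · simp
      · rintro ⟨h1, h2⟩
        refine hx ⟨?_, ?_⟩
        · rw [div_lt_one hh] at h2
          linarith
        · intro h3
          have := div_neg_of_neg_of_pos (sub_neg.2 h3) hh
          linarith

/-- A coarea profile: a monotone function whose increments control the weighted variation of
smooth truncations of `u`. -/
lemma exists_monotone_profile {Ω : Set (Eu n)} (hΩ : IsOpen Ω) {u : Eu n → ℝ}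
    (hu : LocallyIntegrable u) {ν : Measure (Eu n)} [IsFiniteMeasure ν]
    (hG : ∀ ψ, IsTest Ω ψ → (∀ x, 0 ≤ ψ x) → ∀ v,
      ∫ x, u x * fderiv ℝ ψ x v ≤ ‖v‖ * ∫ x, ψ x ∂ν)
    {φ : Eu n → ℝ} (hφ : IsTest Ω φ) (hφ0 : ∀ x, 0 ≤ φ x) :
    ∃ m : ℝ → ℝ, Monotone m ∧ (∀ t, m t ∈ Icc 0 (∫ x, φ x ∂ν)) ∧
      ∀ (β : ℝ → ℝ) (L : ℝ), ContDiff ℝ 1 β → (∀ s, β s ∈ Icc (0 : ℝ) 1) →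
        (∀ s, 0 ≤ deriv β s ∧ deriv β s ≤ L) → (∀ s ∉ Ico (0 : ℝ) 1, deriv β s = 0) →
        ∀ t h, 0 < h → ∀ X, IsTestField Ω X → (∀ x, ‖X x‖ ≤ φ x) →
          ∫ x, β ((u x - t) / h) * dv X x ≤ L / h * (m (t + h) - m t) := by
  set U : ℕ → Eu n → ℝ := fun j => kconv (moll n j) u with hU
  have hUc : ∀ j, ContDiff ℝ 1 (U j) := fun j =>
    kconv_contDiff (moll_contDiff_one n j) (moll_hasCompactSupport n j) hu
  set a : ℕ → ℝ → ℝ := fun j t => ∫ x in {x | U j x < t}, φ x * ‖fderiv ℝ (U j) x‖ with ha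
  have hnn : ∀ j x, 0 ≤ φ x * ‖fderiv ℝ (U j) x‖ := fun j x =>
    mul_nonneg (hφ0 x) (norm_nonneg _)
  have hintg : ∀ j, Integrable (fun x => φ x * ‖fderiv ℝ (U j) x‖) := fun j =>
    Continuous.integrable_of_hasCompactSupport
      (hφ.1.continuous.mul ((hUc j).continuous_fderiv one_ne_zero).norm)
      (HasCompactSupport.mul_right (f := φ) hφ.2.1)
  have ha0 : ∀ j t, 0 ≤ a j t := fun j t => integral_nonneg fun x => hnn j x
  have haM : ∀ j t, a j t ≤ ∫ x, φ x * ‖fderiv ℝ (U j) x‖ := fun j t =>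
    setIntegral_le_integral (hintg j) (ae_of_all _ (hnn j))
  have hmono : ∀ j, Monotone (a j) := fun j s t hst =>
    setIntegral_mono_set (hintg j).integrableOn (ae_of_all _ (hnn j))
      (Eventually.of_forall fun x (hx : U j x < s) => (hx.trans_le hst : U j x < t))
  have hev : ∀ ω > 0, ∀ᶠ j in atTop, ∀ t, a j t ≤ (∫ x, φ x ∂ν) + ω := fun ω hω => by
    filter_upwards [eventually_integral_norm_fderiv_le hΩ hu hG hφ hφ0 hω] with j hj t
    exact (haM j t).trans hj
  have hF : (hyperfilter ℕ : Filter ℕ) ≤ atTop := Nat.hyperfilter_le_atTop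
  have hlim : ∀ t, ∃ l, Tendsto (fun j => a j t) (hyperfilter ℕ : Filter ℕ) (𝓝 l) := by
    intro t
    have hK : IsCompact (Icc (0 : ℝ) ((∫ x, φ x ∂ν) + 1)) := isCompact_Icc
    obtain ⟨l, -, hl⟩ := hK.ultrafilter_le_nhds ((hyperfilter ℕ).map fun j => a j t) (by
      rw [le_principal_iff]
      refine hF ?_
      filter_upwards [hev 1 one_pos] with j hj
      exact ⟨ha0 j t, hj t⟩)
    exact ⟨l, hl⟩
  choose m hm using hlim
  refine ⟨m, fun s t hst => le_of_tendsto_of_tendsto' (hm s) (hm t) fun j => hmono j hst,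
    fun t => ⟨ge_of_tendsto' (hm t) fun j => ha0 j t, ?_⟩, ?_⟩
  · refine le_of_forall_pos_le_add fun ω hω => ?_
    exact le_of_tendsto (hm t) (((hev ω hω).filter_mono hF).mono fun j hj => hj t)
  · intro β L hβ hβI hβd hβs t h hh X hX hXφ
    have hconv : Tendsto (fun j => ∫ x, β ((U j x - t) / h) * dv X x) atTop
        (𝓝 (∫ x, β ((u x - t) / h) * dv X x)) := by
      refine tendsto_integral_of_dominated_convergence (fun x => |dv X x|) (fun j => ?_)
        hX.integrable_dv.abs (fun j => ae_of_all _ fun x => ?_) ?_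
      · have h1 := (hUc j).continuous
        have h2 := hβ.continuous
        have h3 := dv_continuous hX.1
        exact Continuous.aestronglyMeasurable (by fun_prop)
      · rw [Real.norm_eq_abs, abs_mul]
        refine mul_le_of_le_one_left (abs_nonneg _) ?_
        rw [abs_of_nonneg (hβI _).1]
        exact (hβI _).2
      · filter_upwards [kconv_moll_ae_tendsto hu] with x hx
        exact ((hβ.continuous.tendsto _).comp ((hx.sub_const t).div_const h)).mul_const _
    exact le_of_tendsto_of_tendsto' (hconv.mono_left hF)
      (((hm (t + h)).sub (hm t)).const_mul (L / h)) fun j =>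
        integral_step_dv_le (hUc j) hφ.1.continuous hφ.2.1 hβ hβd hβs t hh hX hXφ

/-- Almost every superlevel set of a function of bounded variation has finite weighted variation,
with density given by the derivative of a coarea profile. -/
lemma exists_profile_varLe {Ω : Set (Eu n)} (hΩ : IsOpen Ω) {u : Eu n → ℝ} (hum : Measurable u)
    (hu : LocallyIntegrable u) {ν : Measure (Eu n)} [IsFiniteMeasure ν]
    (hG : ∀ ψ, IsTest Ω ψ → (∀ x, 0 ≤ ψ x) → ∀ v,
      ∫ x, u x * fderiv ℝ ψ x v ≤ ‖v‖ * ∫ x, ψ x ∂ν)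
    {φ : Eu n → ℝ} (hφ : IsTest Ω φ) (hφ0 : ∀ x, 0 ≤ φ x) :
    ∃ m : ℝ → ℝ, Monotone m ∧ (∀ t, m t ∈ Icc 0 (∫ x, φ x ∂ν)) ∧
      ∀ᵐ t, VarLe ({x | t < u x}.indicator fun _ => 1) Ω φ (deriv m t) := by
  obtain ⟨m, hm, hmI, hmβ⟩ := exists_monotone_profile hΩ hu hG hφ hφ0
  refine ⟨m, hm, hmI, ?_⟩
  filter_upwards [hm.ae_differentiableAt] with t ht X hX hXφ
  have hd0 : 0 ≤ deriv m t := hm.deriv_nonneg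
  have key : ∀ θ > 0, ∫ x, {x | t < u x}.indicator (fun _ => (1 : ℝ)) x * dv X x
      ≤ (1 + θ) * deriv m t := by
    intro θ hθ
    obtain ⟨β, hβ, hβ0, hβ1, hβI, hβd, hβs⟩ := exists_steep_step hθ
    have hr : Tendsto mollRad atTop (𝓝[>] 0) :=
      tendsto_nhdsWithin_iff.2 ⟨mollRad_tendsto, Eventually.of_forall fun j => mollRad_pos j⟩
    have hR : Tendsto (fun j => (1 + θ) / mollRad j * (m (t + mollRad j) - m t)) atTop
        (𝓝 ((1 + θ) * deriv m t)) := by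
      have h1 := (ht.hasDerivAt.tendsto_slope_zero_right.comp hr).const_mul (1 + θ)
      refine h1.congr fun j => ?_
      simp only [Function.comp, smul_eq_mul]
      ring
    have hL : Tendsto (fun j => ∫ x, β ((u x - t) / mollRad j) * dv X x) atTop
        (𝓝 (∫ x, {x | t < u x}.indicator (fun _ => (1 : ℝ)) x * dv X x)) := by
      refine tendsto_integral_of_dominated_convergence (fun x => |dv X x|) (fun j => ?_)
        hX.integrable_dv.abs (fun j => ae_of_all _ fun x => ?_) (ae_of_all _ fun x => ?_)
      · have h2 := hβ.continuous.measurable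
        have h3 := (dv_continuous hX.1).measurable
        exact Measurable.aestronglyMeasurable (by fun_prop)
      · rw [Real.norm_eq_abs, abs_mul]
        refine mul_le_of_le_one_left (abs_nonneg _) ?_
        rw [abs_of_nonneg (hβI _).1]
        exact (hβI _).2
      · refine Tendsto.mul_const _ ?_
        by_cases hx : t < u x
        · have hx' : x ∈ {x | t < u x} := hx
          rw [indicator_of_mem hx']
          refine tendsto_const_nhds.congr' ?_
          filter_upwards [mollRad_tendsto.eventually (gt_mem_nhds (sub_pos.2 hx))] with j hj
          exact (hβ1 _ ((one_le_div (mollRad_pos j)).2 hj.le)).symm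
        · have hx' : x ∉ {x | t < u x} := hx
          rw [indicator_of_notMem hx']
          refine tendsto_const_nhds.congr fun j => ?_
          exact (hβ0 _ (div_nonpos_of_nonpos_of_nonneg (by linarith) (mollRad_pos j).le)).symm
    exact le_of_tendsto_of_tendsto' hL hR fun j =>
      hmβ β (1 + θ) hβ hβI hβd hβs t _ (mollRad_pos j) X hX hXφ
  refine le_of_forall_pos_le_add fun ε hε => ?_
  have h1 := key (ε / (deriv m t + 1)) (by positivity)
  have h2 : ε / (deriv m t + 1) * deriv m t ≤ ε := by
    rw [div_mul_eq_mul_div, div_le_iff₀ (by positivity)]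
    nlinarith
  linarith

end Coarea

section UpperRepresentative

variable {n : ℕ}

lemma not_densityZeroAt_univ (x : Eu n) : ¬ DensityZeroAt univ x := by
  intro h
  have h1 : Tendsto (fun _ : ℝ => (1 : ℝ≥0∞)) (𝓝[>] 0) (𝓝 0) := by
    refine Tendsto.congr' ?_ h
    filter_upwards [self_mem_nhdsWithin] with r (hr : 0 < r)
    rw [univ_inter]
    exact ENNReal.div_self (measure_ball_pos _ _ hr).ne' measure_ball_lt_top.ne
  exact one_ne_zero (tendsto_nhds_unique tendsto_const_nhds h1)

lemma DensityZeroAt.mono {A B : Set (Eu n)} {x : Eu n} (h : DensityZeroAt B x) (hAB : A ⊆ B) :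
    DensityZeroAt A x :=
  tendsto_of_tendsto_of_tendsto_of_le_of_le tendsto_const_nhds h (fun _ => zero_le)
    fun _ => ENNReal.div_le_div_right (measure_mono (inter_subset_inter_left _ hAB)) _

lemma DensityZeroAt.union {A B : Set (Eu n)} {x : Eu n} (hA : DensityZeroAt A x)
    (hB : DensityZeroAt B x) : DensityZeroAt (A ∪ B) x := by
  have h := hA.add hB
  rw [add_zero] at h
  refine tendsto_of_tendsto_of_tendsto_of_le_of_le tendsto_const_nhds h (fun _ => zero_le)
    fun r => ?_
  dsimp only
  rw [← ENNReal.add_div, union_inter_distrib_right]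
  exact ENNReal.div_le_div_right (measure_union_le _ _) _

lemma volume_inter_ball_div (A : Set (Eu n)) (x : Eu n) {r : ℝ} (hr : 0 < r) :
    volume (A ∩ ball x r) / volume (ball x r) = ENNReal.ofReal
      (volume.real (A ∩ ball x r) / (r ^ n * volume.real (ball (0 : Eu n) 1))) := by
  have h := volume_real_ball_one_pos (n := n)
  rw [ENNReal.ofReal_div_of_pos (by positivity), ← volume_real_ball x hr,
    ofReal_measureReal measure_ball_lt_top.ne, ofReal_measureReal
    (ne_top_of_le_ne_top measure_ball_lt_top.ne (measure_mono inter_subset_right))]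

lemma densityZeroAt_iff_real {A : Set (Eu n)} {x : Eu n} :
    DensityZeroAt A x ↔
      ∀ e > 0, ∀ᶠ r in 𝓝[>] (0 : ℝ), volume.real (A ∩ ball x r) ≤ e * r ^ n := by
  have hw := volume_real_ball_one_pos (n := n)
  set w := volume.real (ball (0 : Eu n) 1)
  unfold DensityZeroAt
  rw [ENNReal.tendsto_nhds_zero]
  constructor
  · intro h e he
    filter_upwards [h (ENNReal.ofReal (e / w)) (by simpa using by positivity),
      self_mem_nhdsWithin] with r hr (hr0 : 0 < r)
    rw [volume_inter_ball_div A x hr0, ENNReal.ofReal_le_ofReal_iff (by positivity),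
      div_le_div_iff₀ (by positivity) hw] at hr
    refine le_of_mul_le_mul_right ?_ hw
    linarith
  · intro h ε hε
    by_cases hε' : ε = ⊤
    · simp [hε']
    have he : 0 < ε.toReal := ENNReal.toReal_pos hε.ne' hε'
    filter_upwards [h (ε.toReal * w) (by positivity), self_mem_nhdsWithin] with r hr (hr0 : 0 < r)
    rw [volume_inter_ball_div A x hr0]
    refine ENNReal.ofReal_le_of_le_toReal ?_
    rw [div_le_iff₀ (by positivity)]
    linarith

lemma densityZeroAt_iff {A : Set (Eu n)} {x : Eu n} :
    DensityZeroAt A x ↔ ∀ m : ℕ, x ∉ upperDense A (1 / ((m : ℝ) + 1)) := by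
  rw [densityZeroAt_iff_real]
  have hhalf : Tendsto (fun k : ℕ => (1 / 2 : ℝ) ^ k) atTop (𝓝[>] 0) :=
    tendsto_nhdsWithin_iff.2 ⟨tendsto_pow_atTop_nhds_zero_of_lt_one (by norm_num) (by norm_num),
      Eventually.of_forall fun k => by simp⟩
  constructor
  · intro h m hm
    have h1 := hhalf.eventually (h (1 / ((m : ℝ) + 1)) (by positivity))
    have hm' : ∃ᶠ k : ℕ in atTop, 1 / ((m : ℝ) + 1) * ((1 / 2 : ℝ) ^ k) ^ n
        < volume.real (A ∩ ball x ((1 / 2) ^ k)) := hm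
    exact hm' (h1.mono fun k hk => hk.not_gt)
  · intro h e he
    obtain ⟨m, hm⟩ := exists_nat_one_div_lt (show 0 < e / 2 ^ n by positivity)
    have h1 : ¬ ∃ᶠ k : ℕ in atTop, 1 / ((m : ℝ) + 1) * ((1 / 2 : ℝ) ^ k) ^ n
        < volume.real (A ∩ ball x ((1 / 2) ^ k)) := h m
    rw [not_frequently] at h1
    obtain ⟨N, hN⟩ := eventually_atTop.1 h1
    filter_upwards [Ioo_mem_nhdsGT (show (0 : ℝ) < (1 / 2) ^ N by positivity)] with r hr
    have hr1 : r ≤ 1 := hr.2.le.trans (pow_le_one₀ (by norm_num) (by norm_num))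
    obtain ⟨k, hk1, hk2⟩ := exists_nat_pow_near_of_lt_one hr.1 hr1
      (show (0 : ℝ) < 1 / 2 by norm_num) (by norm_num)
    have hNk : N ≤ k := by
      have h2 : (1 / 2 : ℝ) ^ (k + 1) < (1 / 2) ^ N := hk1.trans hr.2
      have := (pow_lt_pow_iff_right_of_lt_one₀ (by norm_num) (by norm_num)).1 h2
      omega
    have h3 := hN k hNk
    push Not at h3
    calc volume.real (A ∩ ball x r) ≤ volume.real (A ∩ ball x ((1 / 2) ^ k)) :=
          volume_real_inter_ball_mono A (ball_subset_ball hk2)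
      _ ≤ 1 / ((m : ℝ) + 1) * ((1 / 2 : ℝ) ^ k) ^ n := h3
      _ ≤ e / 2 ^ n * ((1 / 2 : ℝ) ^ k) ^ n := by gcongr
      _ = e * ((1 / 2 : ℝ) ^ (k + 1)) ^ n := by
          rw [pow_succ, mul_pow, ← mul_assoc]
          rw [div_pow 1 2 n, one_pow]
          ring
      _ ≤ e * r ^ n := by gcongr

lemma measurableSet_densityZeroAt {A : Set (Eu n)} (hA : MeasurableSet A) :
    MeasurableSet {x | DensityZeroAt A x} := by
  have : {x | DensityZeroAt A x} = ⋂ m : ℕ, (upperDense A (1 / ((m : ℝ) + 1)))ᶜ := by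
    ext x
    simp only [mem_ofPred_eq, mem_iInter, mem_compl_iff]
    exact densityZeroAt_iff
  rw [this]
  exact MeasurableSet.iInter fun m => (measurableSet_upperDense hA _).compl

lemma densityZeroAt_congr {A B U : Set (Eu n)} (hU : IsOpen U)
    (h : ∀ᵐ y ∂(volume.restrict U), y ∈ A ↔ y ∈ B) {x : Eu n} (hx : x ∈ U) :
    DensityZeroAt A x ↔ DensityZeroAt B x := by
  obtain ⟨ε, hε, hεU⟩ := Metric.isOpen_iff.1 hU x hx
  refine tendsto_congr' ?_
  filter_upwards [Ioo_mem_nhdsGT hε] with r hr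
  congr 1
  rw [ae_restrict_iff' hU.measurableSet] at h
  refine measure_congr ?_
  filter_upwards [h] with y hy
  refine propext ⟨fun hz => ⟨(hy ?_).1 hz.1, hz.2⟩, fun hz => ⟨(hy ?_).2 hz.1, hz.2⟩⟩
  · exact hεU (ball_subset_ball hr.2.le hz.2)
  · exact hεU (ball_subset_ball hr.2.le hz.2)

lemma upperRep_congr {u v : Eu n → ℝ} {U : Set (Eu n)} (hU : IsOpen U)
    (h : ∀ᵐ y ∂(volume.restrict U), u y = v y) {x : Eu n} (hx : x ∈ U) :
    upperRep u x = upperRep v x := by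
  unfold upperRep
  congr 1
  ext t
  refine densityZeroAt_congr hU ?_ hx
  filter_upwards [h] with y hy
  simp only [hy]

variable {u : Eu n → ℝ} {M : ℝ}

lemma densityZeroAt_of_le (hM : ∀ x, |u x| ≤ M) {t : ℝ} (ht : M ≤ t) (x : Eu n) :
    DensityZeroAt {y | t < u y} x := by
  have h0 : {y | t < u y} = ∅ := by
    ext y
    simp only [mem_ofPred_eq, mem_empty_iff_false, iff_false, not_lt]
    exact (le_abs_self _).trans ((hM y).trans ht)
  unfold DensityZeroAt
  simp only [h0, empty_inter, measure_empty, ENNReal.zero_div]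
  exact tendsto_const_nhds

lemma neg_le_of_densityZeroAt (hM : ∀ x, |u x| ≤ M) {t : ℝ} {x : Eu n}
    (h : DensityZeroAt {y | t < u y} x) : -M ≤ t := by
  by_contra! ht
  refine not_densityZeroAt_univ x (h.mono fun y _ => ?_)
  exact ht.trans_le (neg_le_of_abs_le (hM y))

lemma bddBelow_densityZeroAt (hM : ∀ x, |u x| ≤ M) (x : Eu n) :
    BddBelow {t : ℝ | DensityZeroAt {y | t < u y} x} :=
  ⟨-M, fun _ ht => neg_le_of_densityZeroAt hM ht⟩

lemma upperRep_mem_Icc (hM : ∀ x, |u x| ≤ M) (x : Eu n) : upperRep u x ∈ Icc (-M) M :=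
  ⟨le_csInf ⟨M, densityZeroAt_of_le hM le_rfl x⟩ fun _ ht => neg_le_of_densityZeroAt hM ht,
    csInf_le (bddBelow_densityZeroAt hM x) (densityZeroAt_of_le hM le_rfl x)⟩

lemma upperRep_lt_iff (hM : ∀ x, |u x| ≤ M) {x : Eu n} {t : ℝ} :
    upperRep u x < t ↔ ∃ q : ℚ, (q : ℝ) < t ∧ DensityZeroAt {y | (q : ℝ) < u y} x := by
  constructor
  · intro h
    obtain ⟨s, hs, hst⟩ := (csInf_lt_iff (bddBelow_densityZeroAt hM x)
      ⟨M, densityZeroAt_of_le hM le_rfl x⟩).1 h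
    obtain ⟨q, hq1, hq2⟩ := exists_rat_btwn hst
    have hs' : DensityZeroAt {y | s < u y} x := hs
    exact ⟨q, hq2, hs'.mono fun y (hy : (q : ℝ) < u y) => hq1.trans hy⟩
  · rintro ⟨q, hq, hq'⟩
    exact (csInf_le (bddBelow_densityZeroAt hM x) hq').trans_lt hq

lemma measurable_upperRep (hu : Measurable u) (hM : ∀ x, |u x| ≤ M) :
    Measurable (upperRep u) := by
  refine measurable_of_Iio fun t => ?_
  have : upperRep u ⁻¹' Iio t
      = ⋃ q : ℚ, ⋃ (_ : (q : ℝ) < t), {x | DensityZeroAt {y | (q : ℝ) < u y} x} := by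
    ext x
    simp only [mem_preimage, mem_Iio, mem_iUnion, mem_ofPred_eq, exists_prop]
    exact upperRep_lt_iff hM
  rw [this]
  exact MeasurableSet.iUnion fun q => MeasurableSet.iUnion fun _ =>
    measurableSet_densityZeroAt (measurableSet_lt measurable_const hu)

lemma exists_upperDense_of_lt_upperRep (hM : ∀ x, |u x| ≤ M) {x : Eu n} {t : ℝ}
    (h : t < upperRep u x) : ∃ d > 0, x ∈ upperDense {y | t < u y} d := by
  have h1 : ¬ DensityZeroAt {y | t < u y} x := fun h' =>
    (csInf_le (bddBelow_densityZeroAt hM x) h').not_gt h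
  rw [densityZeroAt_iff] at h1
  push Not at h1
  obtain ⟨m, hm⟩ := h1
  exact ⟨_, by positivity, hm⟩

lemma neg_upperRep_le (hM : ∀ x, |u x| ≤ M) (x : Eu n) :
    -upperRep u x ≤ upperRep (fun y => -u y) x := by
  have hM' : ∀ x, |-u x| ≤ M := fun x => by rw [abs_neg]; exact hM x
  refine le_csInf ⟨M, densityZeroAt_of_le hM' le_rfl x⟩ fun s hs => ?_
  rw [neg_le]
  refine le_csInf ⟨M, densityZeroAt_of_le hM le_rfl x⟩ fun t ht => ?_
  by_contra! hts
  refine not_densityZeroAt_univ x ((DensityZeroAt.union hs ht).mono fun y _ => ?_)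
  simp only [mem_union, mem_ofPred_eq]
  by_contra! hy
  linarith [hy.1, hy.2]

end UpperRepresentative

section PairingBound

variable {n : ℕ}

lemma exists_cutoff {K Ω : Set (Eu n)} (hK : IsCompact K) (hΩ : IsOpen Ω) (hKΩ : K ⊆ Ω) :
    ∃ (χ : Eu n → ℝ) (U : Set (Eu n)), IsTest Ω χ ∧ (∀ x, χ x ∈ Icc (0 : ℝ) 1) ∧ IsOpen U ∧
      K ⊆ U ∧ U ⊆ Ω ∧ ∀ x ∈ U, χ x = 1 := by
  obtain ⟨δ, hδ, hδΩ⟩ := hK.exists_cthickening_subset_open hΩ hKΩ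
  set S := cthickening (δ / 2) K with hS
  have hSc : IsCompact S := hK.cthickening
  have hSm : MeasurableSet S := isClosed_cthickening.measurableSet
  obtain ⟨j, hj⟩ := (mollRad_tendsto.eventually (gt_mem_nhds (show 0 < δ / 4 by positivity))).exists
  have hli := indicator_one_locallyIntegrable hSm
  have hcs := kconv_moll_hasCompactSupport (f := S.indicator fun _ => (1 : ℝ)) hSc.isBounded
    (fun x hx => indicator_of_notMem hx _) j
  refine ⟨kconv (moll n j) (S.indicator fun _ => 1), thickening (δ / 4) K,
    ⟨kconv_moll_contDiff hli j, hcs.1, hcs.2.trans ?_⟩, fun x =>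
    kconv_moll_mem_Icc hli j x fun y _ => indicator_one_mem_Icc S y, isOpen_thickening,
    self_subset_thickening (by positivity) K, ?_, fun x hx => ?_⟩
  · refine ((cthickening_cthickening_subset (mollRad_pos j).le (by positivity) K).trans ?_).trans hδΩ
    exact cthickening_mono (by linarith) K
  · refine ((thickening_subset_cthickening _ _).trans ?_).trans hδΩ
    exact cthickening_mono (by linarith) K
  · have h1 : kconv (moll n j) (S.indicator fun _ => 1) x ∈ Icc (1 : ℝ) 1 := by
      refine kconv_moll_mem_Icc hli j x fun y hy => ?_
      have hyS : y ∈ S := by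
        rw [mem_thickening_iff] at hx
        obtain ⟨z, hz, hxz⟩ := hx
        refine mem_cthickening_of_dist_le y z _ _ hz ?_
        rw [mem_ball] at hy
        linarith [dist_triangle y x z]
      rw [indicator_of_mem hyS]
      exact ⟨le_rfl, le_rfl⟩
    exact le_antisymm h1.2 h1.1

lemma VarLe.of_cutoff {f : Eu n → ℝ} {Ω U : Set (Eu n)} {χ : Eu n → ℝ} {M : ℝ}
    (h : VarLe f Ω χ M) (hχ : ∀ x, 0 ≤ χ x) (hUΩ : U ⊆ Ω) (hU : ∀ x ∈ U, χ x = 1) :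
    VarLe f U (fun _ => 1) M := by
  refine fun X hX hX1 => h X (hX.mono hUΩ) fun x => ?_
  by_cases hx : x ∈ tsupport X
  · rw [hU x (hX.2.2 hx)]
    exact hX1 x
  · rw [image_eq_zero_of_notMem_tsupport hx, norm_zero]
    exact hχ x

lemma integrable_layer {ρ : Measure (Eu n)} [SFinite ρ] {v g : Eu n → ℝ} (hv : Measurable v)
    (hg : Integrable g ρ) (M : ℝ) :
    Integrable (fun p : ℝ × Eu n => {x | p.1 < v x}.indicator (fun _ => (1 : ℝ)) p.2 * g p.2)
      ((volume.restrict (Ioc (-M) M)).prod ρ) := by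
  have h1 : Integrable (fun p : ℝ × Eu n => g p.2) ((volume.restrict (Ioc (-M) M)).prod ρ) :=
    hg.comp_snd _
  have h2 : MeasurableSet {p : ℝ × Eu n | p.1 < v p.2} :=
    measurableSet_lt measurable_fst (hv.comp measurable_snd)
  refine (h1.indicator h2).congr (ae_of_all _ fun p => ?_)
  beta_reduce
  by_cases hp : p.1 < v p.2
  · have hp1 : p ∈ {p : ℝ × Eu n | p.1 < v p.2} := hp
    have hp2 : p.2 ∈ {x | p.1 < v x} := hp
    rw [indicator_of_mem hp1, indicator_of_mem hp2, one_mul]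
  · have hp1 : p ∉ {p : ℝ × Eu n | p.1 < v p.2} := hp
    have hp2 : p.2 ∉ {x | p.1 < v x} := hp
    rw [indicator_of_notMem hp1, indicator_of_notMem hp2, zero_mul]

lemma integral_layer {ρ : Measure (Eu n)} [SFinite ρ] {v g : Eu n → ℝ} (hv : Measurable v)
    (hg : Integrable g ρ) {M : ℝ} (hM : ∀ x, v x ∈ Icc (-M) M) :
    ∫ t in Ioc (-M) M, ∫ x, {x | t < v x}.indicator (fun _ => (1 : ℝ)) x * g x ∂ρ
      = ∫ x, (v x + M) * g x ∂ρ := by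
  rw [integral_integral_swap (f := fun t x => {x | t < v x}.indicator (fun _ => (1 : ℝ)) x * g x)
    (integrable_layer hv hg M)]
  congr 1
  ext x
  rw [integral_mul_const]
  congr 1
  have h1 : (fun t => {x | t < v x}.indicator (fun _ => (1 : ℝ)) x)
      = (Iio (v x)).indicator fun _ => (1 : ℝ) := by
    ext t
    by_cases ht : t < v x
    · have ht1 : x ∈ {x | t < v x} := ht
      have ht2 : t ∈ Iio (v x) := ht
      rw [indicator_of_mem ht1, indicator_of_mem ht2]
    · have ht1 : x ∉ {x | t < v x} := ht
      have ht2 : t ∉ Iio (v x) := ht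
      rw [indicator_of_notMem ht1, indicator_of_notMem ht2]
  rw [h1, setIntegral_indicator measurableSet_Iio]
  have h2 : (Ioc (-M) M ∩ Iio (v x) : Set ℝ) = Ioo (-M) (v x) := by
    ext t
    simp only [mem_inter_iff, mem_Ioc, mem_Iio, mem_Ioo]
    constructor
    · rintro ⟨⟨h3, _⟩, h4⟩
      exact ⟨h3, h4⟩
    · rintro ⟨h3, h4⟩
      exact ⟨⟨h3, h4.le.trans (hM x).2⟩, h4⟩
  rw [h2, setIntegral_const, smul_eq_mul, mul_one, Real.volume_real_Ioo_of_le (hM x).1]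
  ring

variable {Ω : Set (Eu n)} {u : Eu n → ℝ} {M : ℝ} {σ : Eu n → Eu n} {C : ℝ}
  {μ ν : Measure (Eu n)} {φ : Eu n → ℝ}

lemma pairing_le (hΩ : IsOpen Ω) (hum : Measurable u) (huM : ∀ x, |u x| ≤ M)
    (hσ : Measurable σ) (hC : ∀ x, ‖σ x‖ ≤ C) [IsFiniteMeasure μ] [IsFiniteMeasure ν]
    (hrep : ∀ ψ, IsTest Ω ψ → ∫ x, fderiv ℝ ψ x (σ x) = ∫ x, ψ x ∂μ)
    (hG : ∀ ψ, IsTest Ω ψ → (∀ x, 0 ≤ ψ x) → ∀ v,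
      ∫ x, u x * fderiv ℝ ψ x v ≤ ‖v‖ * ∫ x, ψ x ∂ν)
    (hφ : IsTest Ω φ) (hφ0 : ∀ x, 0 ≤ φ x) :
    (- ∫ x, u x * fderiv ℝ φ x (σ x)) + ∫ x, φ x * upperRep u x ∂μ ≤ C * ∫ x, φ x ∂ν := by
  have hC0 : 0 ≤ C := (norm_nonneg _).trans (hC 0)
  have hM0 : 0 ≤ M := (abs_nonneg _).trans (huM 0)
  have hu : LocallyIntegrable u := locallyIntegrable_of_bdd hum.aestronglyMeasurable huM
  obtain ⟨χ, U, hχ, hχI, hU, hφU, hUΩ, hχ1⟩ := exists_cutoff hφ.2.1 hΩ hφ.2.2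
  obtain ⟨m, hm, hmI, hmV⟩ := exists_profile_varLe hΩ hum hu hG hφ hφ0
  obtain ⟨m', -, -, hmV'⟩ := exists_profile_varLe hΩ hum hu hG hχ fun x => (hχI x).1
  have hRm := measurable_upperRep hum huM
  have hRI := upperRep_mem_Icc huM
  have huI : ∀ x, u x ∈ Icc (-M) M := fun x => abs_le.1 (huM x)
  have hφi : Integrable φ μ := hφ.1.continuous.integrable_of_hasCompactSupport hφ.2.1
  have hgi : Integrable (fun x => fderiv ℝ φ x (σ x)) := integrable_fderiv_apply hφ hσ hC
  have hae : ∀ᵐ t, ∫ x, {x | t < upperRep u x}.indicator (fun _ => (1 : ℝ)) x * φ x ∂μ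
      ≤ C * deriv m t + ∫ x, {x | t < u x}.indicator (fun _ => (1 : ℝ)) x
        * fderiv ℝ φ x (σ x) := by
    filter_upwards [hmV, hmV'] with t ht ht'
    have hA : MeasurableSet {x | t < upperRep u x} := measurableSet_lt measurable_const hRm
    have h1 := setIntegral_le_of_varLe hΩ hU (measurableSet_lt measurable_const hum) hφ hφ0 hφU ht
      (ht'.of_cutoff (fun x => (hχI x).1) hUΩ hχ1) hσ hC hrep hA
      fun x hx => exists_upperDense_of_lt_upperRep huM hx
    refine le_trans (le_of_eq ?_) h1
    rw [← integral_indicator hA]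
    congr 1
    ext x
    by_cases hx : x ∈ {x | t < upperRep u x}
    · rw [indicator_of_mem hx, indicator_of_mem hx, one_mul]
    · rw [indicator_of_notMem hx, indicator_of_notMem hx, zero_mul]
  have hMM : -M ≤ M := by linarith
  have hdi : Integrable (deriv m) (volume.restrict (Ioc (-M) M)) :=
    (intervalIntegrable_iff_integrableOn_Ioc_of_le hMM).1
      (hm.monotoneOn _).intervalIntegrable_deriv
  have hdI : ∫ t in Ioc (-M) M, deriv m t ≤ ∫ x, φ x ∂ν := by
    rw [← intervalIntegral.integral_of_le hMM]
    have h1 := (hm.monotoneOn (uIcc (-M) M)).intervalIntegral_deriv_mem_uIcc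
    rw [uIcc_of_le (sub_nonneg.2 (hm hMM))] at h1
    linarith [h1.2, (hmI M).2, (hmI (-M)).1]
  have hli := (integrable_layer (ρ := volume) hum hgi M).integral_prod_left
  have h1 := integral_mono_ae (μ := volume.restrict (Ioc (-M) M))
    (integrable_layer (ρ := μ) hRm hφi M).integral_prod_left
    ((hdi.const_mul C).add hli) (ae_restrict_of_ae hae)
  have h2 : ∫ t in Ioc (-M) M, (C * deriv m t + ∫ x, {x | t < u x}.indicator (fun _ => (1 : ℝ)) x
      * fderiv ℝ φ x (σ x)) = C * (∫ t in Ioc (-M) M, deriv m t)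
        + ∫ x, (u x + M) * fderiv ℝ φ x (σ x) := by
    rw [integral_add (hdi.const_mul C) hli, integral_const_mul, integral_layer hum hgi huI]
  have h3 := h1.trans_eq h2
  dsimp only at h3
  rw [integral_layer hRm hφi hRI] at h3
  have h4 : ∫ x, (upperRep u x + M) * φ x ∂μ
      = (∫ x, φ x * upperRep u x ∂μ) + M * ∫ x, φ x ∂μ := by
    rw [← integral_const_mul, ← integral_add _ (hφi.const_mul M)]
    · congr 1
      ext x
      ring
    · refine hφi.mul_bdd (c := M) hRm.aestronglyMeasurable (ae_of_all _ fun x => ?_)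
      exact abs_le.2 (hRI x)
  have h5 : ∫ x, (u x + M) * fderiv ℝ φ x (σ x)
      = (∫ x, u x * fderiv ℝ φ x (σ x)) + M * ∫ x, φ x ∂μ := by
    rw [← hrep φ hφ, ← integral_const_mul, ← integral_add _ (hgi.const_mul M)]
    · congr 1
      ext x
      ring
    · exact hgi.bdd_mul (c := M) hum.aestronglyMeasurable (ae_of_all _ fun x => huM x)
  rw [h4, h5] at h3
  have h6 := mul_le_mul_of_nonneg_left hdI hC0
  linarith

lemma abs_pairing_le (hΩ : IsOpen Ω) (hum : Measurable u) (huM : ∀ x, |u x| ≤ M)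
    (hσ : Measurable σ) (hC : ∀ x, ‖σ x‖ ≤ C) [IsFiniteMeasure μ] [IsFiniteMeasure ν]
    (hrep : ∀ ψ, IsTest Ω ψ → ∫ x, fderiv ℝ ψ x (σ x) = ∫ x, ψ x ∂μ)
    (hG : ∀ ψ, IsTest Ω ψ → (∀ x, 0 ≤ ψ x) → ∀ v,
      ∫ x, u x * fderiv ℝ ψ x v ≤ ‖v‖ * ∫ x, ψ x ∂ν)
    (hφ : IsTest Ω φ) (hφ0 : ∀ x, 0 ≤ φ x) :
    |(- ∫ x, u x * fderiv ℝ φ x (σ x)) + ∫ x, φ x * upperRep u x ∂μ| ≤ C * ∫ x, φ x ∂ν := by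
  have huM' : ∀ x, |-u x| ≤ M := fun x => by rw [abs_neg]; exact huM x
  have hG' : ∀ ψ, IsTest Ω ψ → (∀ x, 0 ≤ ψ x) → ∀ v,
      ∫ x, -u x * fderiv ℝ ψ x v ≤ ‖v‖ * ∫ x, ψ x ∂ν := by
    intro ψ hψ hψ0 v
    have := hG ψ hψ hψ0 (-v)
    rw [norm_neg] at this
    refine le_trans (le_of_eq ?_) this
    congr 1
    ext x
    rw [map_neg]
    ring
  have h1 := pairing_le hΩ hum huM hσ hC hrep hG hφ hφ0
  have h2 := pairing_le hΩ hum.neg huM' hσ hC hrep hG' hφ hφ0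
  have hφi : Integrable φ μ := hφ.1.continuous.integrable_of_hasCompactSupport hφ.2.1
  have hbi : ∀ v : Eu n → ℝ, Measurable v → (∀ x, |v x| ≤ M) →
      Integrable (fun x => φ x * upperRep v x) μ := fun v hv hvM =>
    hφi.mul_bdd (c := M) (measurable_upperRep hv hvM).aestronglyMeasurable
      (ae_of_all _ fun x => abs_le.2 (upperRep_mem_Icc hvM x))
  have h3 : -∫ x, φ x * upperRep u x ∂μ ≤ ∫ x, φ x * upperRep (fun y => -u y) x ∂μ := by
    rw [← integral_neg]
    refine integral_mono (hbi u hum huM).neg (hbi _ hum.neg huM') fun x => ?_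
    have := mul_le_mul_of_nonneg_left (neg_upperRep_le huM x) (hφ0 x)
    dsimp only
    linarith
  have h4 : ∫ x, -u x * fderiv ℝ φ x (σ x) = -∫ x, u x * fderiv ℝ φ x (σ x) := by
    rw [← integral_neg]
    congr 1
    ext x
    ring
  rw [abs_le]
  constructor
  · have h6 : (- ∫ x, -u x * fderiv ℝ φ x (σ x)) + ∫ x, φ x * upperRep (fun y => -u y) x ∂μ
      ≤ C * ∫ x, φ x ∂ν := h2
    linarith
  · exact h1

end PairingBound

section Duality

/-- A linear functional dominated by a multiple of the `L¹` seminorm is given by a bounded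
density. -/
lemma exists_bounded_density {α T : Type*} [MeasurableSpace α] [AddCommGroup T] [Module ℝ T]
    {ρ : Measure α} [IsFiniteMeasure ρ] (J : T →ₗ[ℝ] Lp ℝ 2 ρ) (F : T →ₗ[ℝ] ℝ) {C : ℝ}
    (hC : 0 ≤ C) (hF : ∀ t, F t ≤ C * ∫ x, |J t x| ∂ρ) :
    ∃ g : α → ℝ, AEStronglyMeasurable g ρ ∧ (∀ᵐ x ∂ρ, |g x| ≤ C) ∧
      ∀ t, F t = ∫ x, J t x * g x ∂ρ := by
  have hi : ∀ f : Lp ℝ 2 ρ, Integrable f ρ := fun f =>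
    (Lp.memLp f).integrable (by norm_num)
  set N : Lp ℝ 2 ρ → ℝ := fun f => C * ∫ x, |f x| ∂ρ with hN
  have hNs : ∀ (c : ℝ) (f : Lp ℝ 2 ρ), N (c • f) = |c| * N f := by
    intro c f
    have h1 : ∫ x, |(c • f : Lp ℝ 2 ρ) x| ∂ρ = ∫ x, |c| * |f x| ∂ρ := by
      refine integral_congr_ae ?_
      filter_upwards [Lp.coeFn_smul c f] with x hx
      rw [hx, Pi.smul_apply, smul_eq_mul, abs_mul]
    simp only [hN]
    rw [h1, integral_const_mul]
    ring
  have hNa : ∀ f g : Lp ℝ 2 ρ, N (f + g) ≤ N f + N g := by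
    intro f g
    have h1 : ∫ x, |(f + g : Lp ℝ 2 ρ) x| ∂ρ ≤ ∫ x, (|f x| + |g x|) ∂ρ := by
      refine integral_mono_ae (hi _).abs ((hi f).abs.add (hi g).abs) ?_
      filter_upwards [Lp.coeFn_add f g] with x hx
      rw [hx]
      exact abs_add_le _ _
    rw [integral_add (hi f).abs (hi g).abs] at h1
    simp only [hN]
    rw [← mul_add]
    exact mul_le_mul_of_nonneg_left h1 hC
  have hker : ∀ t, J t = 0 → F t = 0 := by
    have h1 : ∀ t, J t = 0 → F t ≤ 0 := fun t ht => by
      have h2 := hF t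
      have h3 : N (J t) = 0 := by
        have := hNs 0 (J t)
        rw [zero_smul, abs_zero, zero_mul] at this
        rw [ht]
        exact this
      exact h2.trans_eq h3
    intro t ht
    have h2 := h1 (-t) (by rw [map_neg, ht, neg_zero])
    rw [map_neg] at h2
    linarith [h1 t ht]
  obtain ⟨s, hs⟩ := J.rangeRestrict.exists_rightInverse_of_surjective J.range_rangeRestrict
  have hs' : ∀ y : J.range, J (s y) = y := fun y =>
    congrArg Subtype.val (LinearMap.congr_fun hs y)
  have hFs : ∀ t, F (s (J.rangeRestrict t)) = F t := by
    intro t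
    rw [← sub_eq_zero, ← map_sub]
    refine hker _ ?_
    rw [map_sub, hs']
    exact sub_self _
  obtain ⟨G, hG, hGN⟩ := exists_extension_of_le_sublinear
    (⟨J.range, F ∘ₗ s⟩ : Lp ℝ 2 ρ →ₗ.[ℝ] ℝ) N
    (fun c hc f => by rw [hNs, abs_of_pos hc]) hNa (fun y => by
      have h1 := hF (s y)
      rw [hs'] at h1
      exact h1)
  have hGJ : ∀ t, G (J t) = F t := fun t => (hG (J.rangeRestrict t)).trans (hFs t)
  set K : ℝ := (ρ univ ^ (1 / (1 : ℝ≥0∞).toReal - 1 / (2 : ℝ≥0∞).toReal)).toReal with hK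
  have hNK : ∀ f, N f ≤ C * K * ‖f‖ := by
    intro f
    have h1 : ∫ x, |f x| ∂ρ = (eLpNorm f 1 ρ).toReal := by
      rw [eLpNorm_one_eq_lintegral_enorm]
      exact integral_norm_eq_lintegral_enorm (Lp.aestronglyMeasurable f)
    have h2 := eLpNorm_le_eLpNorm_mul_rpow_measure_univ (p := 1) (q := 2) (by norm_num)
      (Lp.aestronglyMeasurable f)
    have h3 : (eLpNorm f 1 ρ).toReal ≤ ‖f‖ * K := by
      rw [Lp.norm_def, hK, ← ENNReal.toReal_mul]
      refine ENNReal.toReal_mono (ENNReal.mul_ne_top (Lp.eLpNorm_ne_top f) ?_) h2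
      exact ENNReal.rpow_ne_top_of_nonneg (by norm_num) (measure_ne_top _ _)
    simp only [hN]
    rw [h1]
    calc C * (eLpNorm f 1 ρ).toReal ≤ C * (‖f‖ * K) := mul_le_mul_of_nonneg_left h3 hC
      _ = C * K * ‖f‖ := by ring
  have hGabs : ∀ f, ‖G f‖ ≤ C * K * ‖f‖ := by
    intro f
    rw [Real.norm_eq_abs, abs_le]
    refine ⟨?_, (hGN f).trans (hNK f)⟩
    have h1 := (hGN (-f)).trans (hNK (-f))
    rw [map_neg, norm_neg] at h1
    linarith
  set k : Lp ℝ 2 ρ := (InnerProductSpace.toDual ℝ (Lp ℝ 2 ρ)).symm (G.mkContinuous _ hGabs) with hk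
  have hGk : ∀ f, G f = inner ℝ k f := fun f => by
    rw [hk, InnerProductSpace.toDual_symm_apply]
    rfl
  refine ⟨k, Lp.aestronglyMeasurable k, ?_, fun t => ?_⟩
  · have hset : ∀ s, MeasurableSet s → ∀ c : ℝ, |c| = 1 → c * ∫ x in s, k x ∂ρ ≤ C * ρ.real s := by
      intro s hs c hc
      set f : Lp ℝ 2 ρ := indicatorConstLp 2 hs (measure_ne_top ρ s) 1 with hf
      have h1 : G f = ∫ x in s, k x ∂ρ := by
        rw [hGk, real_inner_comm, hf, L2.inner_indicatorConstLp_one]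
      have h2 : N f = C * ρ.real s := by
        simp only [hN]
        congr 1
        have h3 : ∫ x, |f x| ∂ρ = ∫ x, s.indicator (fun _ => (1 : ℝ)) x ∂ρ := by
          refine integral_congr_ae ?_
          filter_upwards [indicatorConstLp_coeFn (p := 2) (hs := hs) (hμs := measure_ne_top ρ s)
            (c := (1 : ℝ))] with x hx
          rw [hf, hx, abs_of_nonneg (indicator_nonneg (fun _ _ => zero_le_one) _)]
        rw [h3, integral_indicator hs, setIntegral_const, smul_eq_mul, mul_one]
      have h4 := hGN (c • f)
      rwa [hNs, hc, one_mul, map_smul, h1, h2, smul_eq_mul] at h4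
    have hle : ∀ c : ℝ, |c| = 1 → (fun x => c * k x) ≤ᵐ[ρ] fun _ => C := by
      intro c hc
      refine ae_le_of_forall_setIntegral_le ((hi k).const_mul c) (integrable_const C)
        fun s hs _ => ?_
      rw [integral_const_mul, setIntegral_const, smul_eq_mul, mul_comm (ρ.real s)]
      exact hset s hs c hc
    filter_upwards [hle 1 (by simp), hle (-1) (by simp)] with x h1 h2
    rw [abs_le]
    constructor <;> linarith
  · rw [← hGJ, hGk, L2.inner_def]
    rfl

variable {n : ℕ}

lemma exists_weight {Ω : Set (Eu n)} (hΩ : IsOpen Ω) {ν : Measure (Eu n)} (hν : LocFinOn Ω ν) :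
    ∃ w : Eu n → ℝ≥0∞, Measurable w ∧ (∀ x, w x ≠ 0) ∧ (∀ x, w x ≠ ⊤) ∧ ∫⁻ x, w x ∂ν ≠ ⊤ ∧
      ∀ K ⊆ Ω, IsCompact K → ∃ c : ℝ, 0 < c ∧ ∀ x ∈ K, c ≤ (w x).toReal := by
  have : LocallyCompactSpace Ω := hΩ.locallyCompactSpace
  let E : CompactExhaustion Ω := default
  set V : ℕ → Set (Eu n) := fun k => Subtype.val '' interior (E k) with hV
  have hVo : ∀ k, IsOpen (V k) := fun k => hΩ.isOpenMap_subtype_val _ isOpen_interior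
  have hVfin : ∀ k, ν (V k) < ⊤ := fun k =>
    (measure_mono (image_mono interior_subset)).trans_lt
      (hν.1 (Subtype.val '' E k) (by rintro _ ⟨x, -, rfl⟩; exact x.2)
        ((E.isCompact k).image continuous_subtype_val))
  have hVmono : Monotone V := fun i j hij => image_mono (interior_mono (E.subset hij))
  have hVU : Ω ⊆ ⋃ k, V k := by
    intro x hx
    have h1 : (⟨x, hx⟩ : Ω) ∈ ⋃ k, E k := by rw [E.iUnion_eq]; trivial
    obtain ⟨k, hk⟩ := mem_iUnion.1 h1
    exact mem_iUnion.2 ⟨k + 1, ⟨x, hx⟩, E.subset_interior_succ k hk, rfl⟩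
  obtain ⟨δ, hδ, hδs⟩ := ENNReal.exists_pos_tsum_mul_lt_of_countable (ε := 1) one_ne_zero
    (fun k => 1 + ν (V k)) fun k => ENNReal.add_ne_top.2 ⟨ENNReal.one_ne_top, (hVfin k).ne⟩
  have hle : ∀ k x, (V k).indicator (fun _ => (δ k : ℝ≥0∞)) x
      ≤ Ωᶜ.indicator (fun _ => 1) x + ∑' k, (V k).indicator (fun _ => (δ k : ℝ≥0∞)) x :=
    fun k x => (ENNReal.le_tsum k).trans le_add_self
  have hfin : ∀ x, Ωᶜ.indicator (fun _ => 1) x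
      + ∑' k, (V k).indicator (fun _ => (δ k : ℝ≥0∞)) x ≠ ⊤ := by
    intro x
    refine ENNReal.add_ne_top.2 ⟨?_, ?_⟩
    · refine ne_top_of_le_ne_top ENNReal.one_ne_top (indicator_le_self' ?_ x)
      exact fun _ _ => zero_le
    · refine ne_top_of_le_ne_top ENNReal.one_ne_top (le_trans (ENNReal.tsum_le_tsum fun k => ?_)
        hδs.le)
      refine (indicator_le_self' (fun _ _ => zero_le) x).trans ?_
      rw [add_mul, one_mul]
      exact le_self_add
  refine ⟨fun x => Ωᶜ.indicator (fun _ => 1) x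
    + ∑' k, (V k).indicator (fun _ => (δ k : ℝ≥0∞)) x, ?_, fun x => ?_, hfin, ?_, ?_⟩
  · exact (measurable_const.indicator hΩ.measurableSet.compl).add
      (Measurable.tsum fun k => measurable_const.indicator (hVo k).measurableSet)
  · by_cases hx : x ∈ Ω
    · obtain ⟨k, hk⟩ := mem_iUnion.1 (hVU hx)
      have h1 := hle k x
      rw [indicator_of_mem hk] at h1
      exact ((ENNReal.coe_pos.2 (hδ k)).trans_le h1).ne'
    · have hx' : x ∈ Ωᶜ := hx
      beta_reduce
      rw [indicator_of_mem hx']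
      simp
  · rw [lintegral_add_left (measurable_const.indicator hΩ.measurableSet.compl),
      lintegral_indicator hΩ.measurableSet.compl, setLIntegral_const, hν.2, mul_zero, zero_add,
      lintegral_tsum fun k => (measurable_const.indicator (hVo k).measurableSet).aemeasurable]
    refine ne_top_of_le_ne_top ENNReal.one_ne_top (le_trans (ENNReal.tsum_le_tsum fun k => ?_)
      hδs.le)
    rw [lintegral_indicator (hVo k).measurableSet, setLIntegral_const, mul_comm]
    gcongr
    exact le_add_self
  · intro K hK hKc
    obtain ⟨k, hk⟩ := hKc.elim_directed_cover V hVo (hK.trans hVU) hVmono.directed_le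
    refine ⟨δ k, hδ k, fun x hx => ?_⟩
    have h1 := hle k x
    rw [indicator_of_mem (hk hx)] at h1
    exact ENNReal.toReal_mono (hfin x) h1

end Duality

section Localization

variable {n : ℕ}

/-- The distribution `Div(uσ) - u⁺ Div σ` on `Ω`, where `μ = -Div σ`. -/
def pairing {n : ℕ} (Ω : Set (Eu n)) (σ : Eu n → Eu n) (μ : Measure (Eu n)) (u φ : Eu n → ℝ) : ℝ :=
  (- ∫ x in Ω, u x * ⟪σ x, gradient φ x⟫) + (∫ x, φ x * upperRep u x ∂μ)

lemma inner_gradient (φ : Eu n → ℝ) (x v : Eu n) : ⟪v, gradient φ x⟫ = fderiv ℝ φ x v := by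
  rw [real_inner_comm, gradient, InnerProductSpace.toDual_symm_apply]

lemma IsTest.mono {V Ω : Set (Eu n)} {φ : Eu n → ℝ} (h : IsTest V φ) (hV : V ⊆ Ω) : IsTest Ω φ :=
  ⟨h.1, h.2.1, h.2.2.trans hV⟩

lemma IsTest.eq_zero {V : Set (Eu n)} {φ : Eu n → ℝ} (h : IsTest V φ) {x : Eu n} (hx : x ∉ V) :
    φ x = 0 :=
  image_eq_zero_of_notMem_tsupport fun h' => hx (h.2.2 h')

lemma IsTest.fderiv_eq_zero {V : Set (Eu n)} {φ : Eu n → ℝ} (h : IsTest V φ) {x : Eu n}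
    (hx : x ∉ V) : fderiv ℝ φ x = 0 :=
  image_eq_zero_of_notMem_tsupport fun h' => hx (h.2.2 (tsupport_fderiv_subset ℝ h'))

lemma IsTest.integrable {Ω : Set (Eu n)} {φ : Eu n → ℝ} (h : IsTest Ω φ) {ν : Measure (Eu n)}
    (hν : LocFinOn Ω ν) : Integrable φ ν := by
  rw [← integrableOn_iff_integrable_of_support_subset (subset_tsupport φ)]
  have : IsFiniteMeasure (ν.restrict (tsupport φ)) :=
    ⟨by
      rw [Measure.restrict_apply_univ]
      exact hν.1 _ h.2.2 h.2.1.isCompact⟩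
  exact h.1.continuous.integrable_of_hasCompactSupport h.2.1

lemma IsTest.integrable_fderiv {V : Set (Eu n)} {φ : Eu n → ℝ} (h : IsTest V φ) :
    Integrable (fderiv ℝ φ) :=
  (h.1.continuous_fderiv (by simp)).integrable_of_hasCompactSupport (h.2.1.fderiv (𝕜 := ℝ))

lemma IsTest.integrable_fderiv_apply {V : Set (Eu n)} {φ : Eu n → ℝ} (h : IsTest V φ)
    {σ : Eu n → Eu n} (hσ : Measurable σ) {C : ℝ} (hC : ∀ x, ‖σ x‖ ≤ C) :
    Integrable fun x => fderiv ℝ φ x (σ x) := by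
  have hc := h.1.continuous_fderiv (by simp)
  refine (h.integrable_fderiv.norm.mul_const C).mono' ?_ (ae_of_all _ fun x => ?_)
  · exact (isBoundedBilinearMap_apply (𝕜 := ℝ) (E := Eu n) (F := ℝ)).continuous.comp_aestronglyMeasurable
      (hc.aestronglyMeasurable.prodMk hσ.aestronglyMeasurable)
  · exact ((fderiv ℝ φ x).le_opNorm _).trans (by gcongr; exact hC x)

lemma setIntegral_eq_integral_of_ae_eq {F : Type*} [NormedAddCommGroup F] [NormedSpace ℝ F]
    {V Ω : Set (Eu n)} (hVΩ : V ⊆ Ω) {f g : Eu n → F}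
    (hf : ∀ x ∉ V, f x = 0) (hg : ∀ x ∉ V, g x = 0) (hfg : ∀ᵐ x ∂volume.restrict V, f x = g x) :
    ∫ x in Ω, f x = ∫ x, g x := by
  rw [setIntegral_eq_integral_of_forall_compl_eq_zero fun x hx => hf x fun h => hx (hVΩ h),
    ← setIntegral_eq_integral_of_forall_compl_eq_zero hf,
    ← setIntegral_eq_integral_of_forall_compl_eq_zero hg]
  exact integral_congr_ae hfg

/-- On a relatively compact open subset, `σ` and `u` agree a.e. with globally bounded Borel
maps. -/
lemma exists_bounded_modification {Ω K : Set (Eu n)} (hΩ : IsOpen Ω) {σ : Eu n → Eu n} {C : ℝ}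
    (hC : 0 ≤ C) (hσ : Bdd Ω σ C) {u : Eu n → ℝ} (hu : LocBddFun Ω u) (hK : IsCompact K)
    (hKΩ : K ⊆ Ω) :
    ∃ (V : Set (Eu n)) (τ : Eu n → Eu n) (v : Eu n → ℝ) (M : ℝ), IsOpen V ∧ K ⊆ V ∧
      closure V ⊆ Ω ∧ IsCompact (closure V) ∧ Measurable τ ∧ (∀ x, ‖τ x‖ ≤ C) ∧ Measurable v ∧
      (∀ x, |v x| ≤ M) ∧ (∀ᵐ x ∂volume.restrict V, σ x = τ x) ∧
      ∀ᵐ x ∂volume.restrict V, u x = v x := by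
  obtain ⟨V, hVo, hKV, hVΩ, hVc⟩ := exists_open_between_and_isCompact_closure hK hΩ hKΩ
  obtain ⟨M, hM⟩ := hu.2 _ hVΩ hVc
  have hVV : volume.restrict V ≤ volume.restrict Ω :=
    Measure.restrict_mono (subset_closure.trans hVΩ) le_rfl
  set s := hσ.1.mk σ with hs
  have hsm : Measurable s := hσ.1.stronglyMeasurable_mk.measurable
  set w := hu.1.mk u with hw
  have hwm : Measurable w := hu.1.stronglyMeasurable_mk.measurable
  refine ⟨V, {x | ‖s x‖ ≤ C}.indicator s, {x | |w x| ≤ |M|}.indicator w, |M|, hVo, hKV, hVΩ, hVc,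
    hsm.indicator (measurableSet_le hsm.norm measurable_const), fun x => ?_,
    hwm.indicator (measurableSet_le hwm.abs measurable_const), fun x => ?_, ?_, ?_⟩
  · by_cases hx : x ∈ {x | ‖s x‖ ≤ C}
    · rw [indicator_of_mem hx]
      exact hx
    · rw [indicator_of_notMem hx, norm_zero]
      exact hC
  · by_cases hx : x ∈ {x | |w x| ≤ |M|}
    · rw [indicator_of_mem hx]
      exact hx
    · rw [indicator_of_notMem hx, abs_zero]
      exact abs_nonneg M
  · filter_upwards [hVV.absolutelyContinuous.ae_le hσ.1.ae_eq_mk,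
      hVV.absolutelyContinuous.ae_le hσ.2] with x h1 h2
    have hx : x ∈ {x | ‖s x‖ ≤ C} := by
      change ‖s x‖ ≤ C
      rwa [hs, ← h1]
    rw [indicator_of_mem hx, h1]
  · filter_upwards [hVV.absolutelyContinuous.ae_le hu.1.ae_eq_mk,
      (Measure.restrict_mono subset_closure le_rfl).absolutelyContinuous.ae_le hM] with x h1 h2
    have hx : x ∈ {x | |w x| ≤ |M|} := by
      change |w x| ≤ |M|
      rw [hw, ← h1]
      exact h2.trans (le_abs_self M)
    rw [indicator_of_mem hx, h1]

lemma pairing_eq_of_ae_eq {V Ω : Set (Eu n)} (hVΩ : V ⊆ Ω) (hV : IsOpen V)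
    {σ τ : Eu n → Eu n} {u v : Eu n → ℝ} (hσ : ∀ᵐ x ∂volume.restrict V, σ x = τ x)
    (hu : ∀ᵐ x ∂volume.restrict V, u x = v x) (μ : Measure (Eu n)) {φ : Eu n → ℝ}
    (hφ : IsTest V φ) :
    pairing Ω σ μ u φ = (- ∫ x, v x * fderiv ℝ φ x (τ x))
      + ∫ x, φ x * upperRep v x ∂(μ.restrict V) := by
  rw [pairing]
  congr 1
  · congr 1
    refine setIntegral_eq_integral_of_ae_eq hVΩ (fun x hx => ?_) (fun x hx => ?_) ?_
    · rw [inner_gradient, hφ.fderiv_eq_zero hx, zero_apply, mul_zero]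
    · rw [hφ.fderiv_eq_zero hx, zero_apply, mul_zero]
    · filter_upwards [hσ, hu] with x h1 h2
      rw [inner_gradient, h1, h2]
  · rw [← setIntegral_eq_integral_of_forall_compl_eq_zero (s := V)
      (f := fun x => φ x * upperRep u x) (fun x hx => by rw [hφ.eq_zero hx, zero_mul])]
    refine setIntegral_congr_fun hV.measurableSet fun x hx => ?_
    rw [upperRep_congr hV hu hx]

lemma pairing_add_smul {Ω : Set (Eu n)} (hΩ : IsOpen Ω) {σ : Eu n → Eu n} {C : ℝ} (hC : 0 ≤ C)
    (hσ : Bdd Ω σ C) {u : Eu n → ℝ} (hu : LocBddFun Ω u) {μ : Measure (Eu n)}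
    (hμ : LocFinOn Ω μ) {φ ψ : Eu n → ℝ} (hφ : IsTest Ω φ) (hψ : IsTest Ω ψ) (c : ℝ) :
    pairing Ω σ μ u (φ + c • ψ) = pairing Ω σ μ u φ + c * pairing Ω σ μ u ψ := by
  obtain ⟨V, τ, v, M, hV, hKV, hVΩ, hVc, hτ, hτC, hv, hvM, hστ, huv⟩ :=
    exists_bounded_modification hΩ hC hσ hu (hφ.2.1.isCompact.union hψ.2.1.isCompact)
      (union_subset hφ.2.2 hψ.2.2)
  have hφV : IsTest V φ := ⟨hφ.1, hφ.2.1, subset_union_left.trans hKV⟩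
  have hψV : IsTest V ψ := ⟨hψ.1, hψ.2.1, subset_union_right.trans hKV⟩
  have hsum : IsTest V (φ + c • ψ) := by
    refine ⟨hφ.1.add (hψ.1.const_smul c), hφ.2.1.add (hψ.2.1.smul_left (f := fun _ => c)),
      (tsupport_add φ _).trans (union_subset hφV.2.2 ?_)⟩
    exact (tsupport_smul_subset_right (fun _ => c) ψ).trans hψV.2.2
  have hfin : IsFiniteMeasure (μ.restrict V) :=
    ⟨by
      rw [Measure.restrict_apply_univ]
      exact (measure_mono subset_closure).trans_lt (hμ.1 _ hVΩ hVc)⟩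
  have hVΩ' := subset_closure.trans hVΩ
  rw [pairing_eq_of_ae_eq hVΩ' hV hστ huv μ hφV, pairing_eq_of_ae_eq hVΩ' hV hστ huv μ hψV,
    pairing_eq_of_ae_eq hVΩ' hV hστ huv μ hsum]
  have hd {χ : Eu n → ℝ} (h : IsTest V χ) : Integrable fun x => v x * fderiv ℝ χ x (τ x) :=
    (h.integrable_fderiv_apply hτ hτC).bdd_mul (c := M) hv.aestronglyMeasurable
      (ae_of_all _ hvM)
  have hr {χ : Eu n → ℝ} (h : IsTest V χ) :
      Integrable (fun x => χ x * upperRep v x) (μ.restrict V) :=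
    (h.1.continuous.integrable_of_hasCompactSupport h.2.1).mul_bdd (c := M)
      (measurable_upperRep hv hvM).aestronglyMeasurable
      (ae_of_all _ fun x => abs_le.2 (upperRep_mem_Icc hvM x))
  have h1 : ∫ x, v x * fderiv ℝ (φ + c • ψ) x (τ x)
      = (∫ x, v x * fderiv ℝ φ x (τ x)) + c * ∫ x, v x * fderiv ℝ ψ x (τ x) := by
    rw [← integral_const_mul, ← integral_add (hd hφV) ((hd hψV).const_mul c)]
    congr 1
    ext x
    rw [fderiv_add (hφ.1.differentiable (by simp) x)
      ((hψ.1.differentiable (by simp) x).const_smul c),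
      fderiv_const_smul (hψ.1.differentiable (by simp) x), add_apply, smul_apply, smul_eq_mul]
    ring
  have h2 : ∫ x, (φ + c • ψ) x * upperRep v x ∂(μ.restrict V)
      = (∫ x, φ x * upperRep v x ∂(μ.restrict V))
        + c * ∫ x, ψ x * upperRep v x ∂(μ.restrict V) := by
    rw [← integral_const_mul, ← integral_add (hr hφV) ((hr hψV).const_mul c)]
    congr 1
    ext x
    simp only [Pi.add_apply, Pi.smul_apply, smul_eq_mul]
    ring
  rw [h1, h2]
  ring

lemma abs_pairing_le_of_nonneg {Ω : Set (Eu n)} (hΩ : IsOpen Ω) {σ : Eu n → Eu n} {C : ℝ}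
    (hC : 0 ≤ C) (hσ : Bdd Ω σ C) {u : Eu n → ℝ} (hu : LocBddFun Ω u) {μ : Measure (Eu n)}
    (hμ : LocFinOn Ω μ) (hrep : RepNegDiv Ω σ μ 0) {ν : Measure (Eu n)} {θ : Eu n → Eu n}
    (hν : LocFinOn Ω ν) (hgrad : HasGradMeasure Ω u ν θ) {φ : Eu n → ℝ} (hφ : IsTest Ω φ)
    (hφ0 : ∀ x, 0 ≤ φ x) : |pairing Ω σ μ u φ| ≤ C * ∫ x, φ x ∂ν := by
  obtain ⟨V, τ, v, M, hV, hKV, hVΩ, hVc, hτ, hτC, hv, hvM, hστ, huv⟩ :=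
    exists_bounded_modification hΩ hC hσ hu hφ.2.1.isCompact hφ.2.2
  have hφV : IsTest V φ := ⟨hφ.1, hφ.2.1, hKV⟩
  have hVΩ' := subset_closure.trans hVΩ
  have hfin {κ : Measure (Eu n)} (hκ : LocFinOn Ω κ) : IsFiniteMeasure (κ.restrict V) :=
    ⟨by
      rw [Measure.restrict_apply_univ]
      exact (measure_mono subset_closure).trans_lt (hκ.1 _ hVΩ hVc)⟩
  have := hfin hμ
  have := hfin hν
  have hres {ψ : Eu n → ℝ} (hψ : IsTest V ψ) (κ : Measure (Eu n)) :
      ∫ x, ψ x ∂(κ.restrict V) = ∫ x, ψ x ∂κ :=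
    setIntegral_eq_integral_of_forall_compl_eq_zero fun x hx => hψ.eq_zero hx
  rw [pairing_eq_of_ae_eq hVΩ' hV hστ huv μ hφV, ← hres hφV ν]
  refine abs_pairing_le hV hv hvM hτ hτC (fun ψ hψ => ?_) (fun ψ hψ hψ0 z => ?_) hφV hφ0
  · rw [hres hψ]
    have h1 := hrep ψ (hψ.mono hVΩ')
    rw [integral_zero_measure, sub_zero] at h1
    rw [← h1]
    symm
    refine setIntegral_eq_integral_of_ae_eq hVΩ' (fun x hx => ?_)
      (fun x hx => ?_) ?_
    · rw [inner_gradient, hψ.fderiv_eq_zero hx, zero_apply]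
    · rw [hψ.fderiv_eq_zero hx, zero_apply]
    · filter_upwards [hστ] with x h2
      rw [inner_gradient, h2]
  · have hg0 {x : Eu n} (hx : x ∉ V) : gradient ψ x = 0 := by
      rw [gradient, hψ.fderiv_eq_zero hx, map_zero]
    have hgi : Integrable fun x => v x • gradient ψ x := by
      have h1 : Integrable (gradient ψ) :=
        hψ.integrable_fderiv.norm.mono'
          ((InnerProductSpace.toDual ℝ (Eu n)).symm.continuous.comp_aestronglyMeasurable
            hψ.integrable_fderiv.aestronglyMeasurable)
          (ae_of_all _ fun x => (LinearIsometryEquiv.norm_map _ _).le)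
      exact h1.bdd_smul M hv.aestronglyMeasurable (ae_of_all _ hvM)
    have h1 : ∫ x in Ω, u x • gradient ψ x = ∫ x, v x • gradient ψ x := by
      refine setIntegral_eq_integral_of_ae_eq hVΩ' (fun x hx => ?_)
        (fun x hx => ?_) ?_
      · rw [hg0 hx, smul_zero]
      · rw [hg0 hx, smul_zero]
      · filter_upwards [huv] with x h2
        rw [h2]
    have h2 : ‖∫ x, v x • gradient ψ x‖ ≤ ∫ x, ψ x ∂(ν.restrict V) := by
      rw [← h1, hgrad.2.2 ψ (hψ.mono hVΩ'), norm_neg, hres hψ]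
      refine norm_integral_le_of_norm_le ((hψ.mono hVΩ').integrable hν) ?_
      filter_upwards [hgrad.1] with x hx
      rw [norm_smul, hx, mul_one, Real.norm_eq_abs, abs_of_nonneg (hψ0 x)]
    have h3 : ∫ x, v x * fderiv ℝ ψ x z = ⟪z, ∫ x, v x • gradient ψ x⟫ := by
      rw [← integral_inner hgi]
      congr 1
      ext x
      rw [inner_smul_right, inner_gradient]
    rw [h3]
    exact (real_inner_le_norm _ _).trans (by gcongr)

end Localization

section Representation

variable {n : ℕ}

/-- The space of test functions on `Ω`. -/
def testSpace {n : ℕ} (Ω : Set (Eu n)) : Submodule ℝ (Eu n → ℝ) where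
  carrier := {φ | IsTest Ω φ}
  zero_mem' := by
    refine ⟨contDiff_const, HasCompactSupport.zero, ?_⟩
    rw [tsupport_zero]
    exact empty_subset _
  add_mem' {φ ψ} hφ hψ :=
    ⟨hφ.1.add hψ.1, hφ.2.1.add hψ.2.1, (tsupport_add φ ψ).trans (union_subset hφ.2.2 hψ.2.2)⟩
  smul_mem' c φ hφ :=
    ⟨hφ.1.const_smul c, hφ.2.1.smul_left (f := fun _ => c),
      (tsupport_smul_subset_right (fun _ => c) φ).trans hφ.2.2⟩

/-- A linear functional on test functions bounded by `C ∫ φ dν` for `φ ≥ 0` is bounded by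
`C ∫ |φ| dν` in general. -/
lemma abs_le_integral_abs {Ω : Set (Eu n)} (hΩ : IsOpen Ω) (F : testSpace Ω →ₗ[ℝ] ℝ) {C : ℝ}
    (hC : 0 ≤ C) {ν : Measure (Eu n)} (hν : LocFinOn Ω ν)
    (hF : ∀ φ : testSpace Ω, (∀ x, 0 ≤ (φ : Eu n → ℝ) x) →
      |F φ| ≤ C * ∫ x, (φ : Eu n → ℝ) x ∂ν) (φ : testSpace Ω) :
    |F φ| ≤ C * ∫ x, |(φ : Eu n → ℝ) x| ∂ν := by
  obtain ⟨f, hf⟩ := φ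
  have hft : IsTest Ω f := hf
  obtain ⟨χ, U, hχ, hχ01, -, hKU, -, hU1⟩ := exists_cutoff hft.2.1.isCompact hΩ hft.2.2
  have key : ∀ η : ℝ, 0 < η →
      |F ⟨f, hf⟩| ≤ C * ((∫ x, |f x| ∂ν) + η * ∫ x, χ x ∂ν) := by
    intro η hη
    have hsq : IsTest Ω fun x => √(f x ^ 2 + η ^ 2) - η := by
      have hsub : Function.support (fun x => √(f x ^ 2 + η ^ 2) - η) ⊆ Function.support f := by
        intro x hx h0
        refine hx ?_
        beta_reduce
        rw [h0]
        simp [Real.sqrt_sq hη.le]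
      refine ⟨?_, hft.2.1.mono hsub, (closure_mono hsub).trans hft.2.2⟩
      exact (((hft.1.pow 2).add contDiff_const).sqrt fun x => by positivity).sub contDiff_const
    set p : testSpace Ω := ⟨_, hsq⟩ + η • ⟨χ, hχ⟩ with hp
    have hpx (x : Eu n) : (p : Eu n → ℝ) x = √(f x ^ 2 + η ^ 2) - η + η * χ x := rfl
    have hple (x : Eu n) : (p : Eu n → ℝ) x ≤ |f x| + η * χ x := by
      rw [hpx]
      have h1 : √(f x ^ 2 + η ^ 2) ≤ |f x| + η := by
        rw [Real.sqrt_le_left (by positivity)]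
        nlinarith [sq_abs (f x), abs_nonneg (f x), mul_nonneg (abs_nonneg (f x)) hη.le]
      linarith
    have hpge (x : Eu n) : |f x| ≤ (p : Eu n → ℝ) x := by
      rw [hpx]
      by_cases hx : x ∈ tsupport f
      · rw [hU1 x (hKU hx)]
        have h1 : |f x| ≤ √(f x ^ 2 + η ^ 2) := by
          rw [← Real.sqrt_sq_eq_abs]
          exact Real.sqrt_le_sqrt (by nlinarith [sq_nonneg η])
        linarith
      · rw [image_eq_zero_of_notMem_tsupport hx]
        have h1 := mul_nonneg hη.le (hχ01 x).1
        simpa [Real.sqrt_sq hη.le] using h1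
    have hadd := hF (p + ⟨f, hf⟩) fun x => by
      change 0 ≤ (p : Eu n → ℝ) x + f x
      linarith [hpge x, neg_abs_le (f x)]
    have hsub := hF (p - ⟨f, hf⟩) fun x => by
      change 0 ≤ (p : Eu n → ℝ) x - f x
      linarith [hpge x, le_abs_self (f x)]
    have hpt : IsTest Ω (p : Eu n → ℝ) := p.2
    have hpi := hpt.integrable hν
    have hfi := hft.integrable hν
    have hχi := hχ.integrable hν
    have e1 : ∫ x, ((p + ⟨f, hf⟩ : testSpace Ω) : Eu n → ℝ) x ∂ν
        = (∫ x, (p : Eu n → ℝ) x ∂ν) + ∫ x, f x ∂ν := integral_add hpi hfi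
    have e2 : ∫ x, ((p - ⟨f, hf⟩ : testSpace Ω) : Eu n → ℝ) x ∂ν
        = (∫ x, (p : Eu n → ℝ) x ∂ν) - ∫ x, f x ∂ν := integral_sub hpi hfi
    rw [e1, map_add] at hadd
    rw [e2, map_sub] at hsub
    have e3 : ∫ x, (p : Eu n → ℝ) x ∂ν ≤ (∫ x, |f x| ∂ν) + η * ∫ x, χ x ∂ν := by
      rw [← integral_const_mul, ← integral_add hfi.abs (hχi.const_mul η)]
      exact integral_mono hpi (hfi.abs.add (hχi.const_mul η)) hple
    have e4 : |F ⟨f, hf⟩| ≤ C * ∫ x, (p : Eu n → ℝ) x ∂ν := by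
      rw [abs_le] at hadd hsub ⊢
      rw [mul_add] at hadd
      rw [mul_sub] at hsub
      constructor <;> linarith [hadd.1, hadd.2, hsub.1, hsub.2]
    exact e4.trans (mul_le_mul_of_nonneg_left e3 hC)
  have hlim : Tendsto (fun η : ℝ => C * ((∫ x, |f x| ∂ν) + η * ∫ x, χ x ∂ν)) (𝓝[>] 0)
      (𝓝 (C * ((∫ x, |f x| ∂ν) + 0 * ∫ x, χ x ∂ν))) :=
    (Continuous.tendsto (by fun_prop) 0).mono_left nhdsWithin_le_nhds
  rw [zero_mul, add_zero] at hlim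
  exact ge_of_tendsto hlim (eventually_mem_nhdsWithin.mono key)

lemma integral_withDensity_div {ν : Measure (Eu n)} {w : Eu n → ℝ≥0∞} (hw : Measurable w)
    (hw0 : ∀ x, w x ≠ 0) (hw1 : ∀ x, w x ≠ ⊤) (f g : Eu n → ℝ) :
    ∫ x, f x / (w x).toReal * g x ∂(ν.withDensity w) = ∫ x, f x * g x ∂ν := by
  rw [integral_withDensity_eq_integral_toReal_smul hw (ae_of_all _ fun x => (hw1 x).lt_top)]
  congr 1
  ext x
  have h := (ENNReal.toReal_pos (hw0 x) (hw1 x)).ne'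
  rw [smul_eq_mul]
  field_simp

/-- A linear functional on test functions bounded by `C ∫ φ dν` for `φ ≥ 0` is integration
against a density `h` with respect to `ν` with `|h| ≤ C`. -/
lemma exists_density {Ω : Set (Eu n)} (hΩ : IsOpen Ω) (F : testSpace Ω →ₗ[ℝ] ℝ) {C : ℝ}
    (hC : 0 ≤ C) {ν : Measure (Eu n)} (hν : LocFinOn Ω ν)
    (hF : ∀ φ : testSpace Ω, (∀ x, 0 ≤ (φ : Eu n → ℝ) x) →
      |F φ| ≤ C * ∫ x, (φ : Eu n → ℝ) x ∂ν) :
    ∃ h : Eu n → ℝ, AEStronglyMeasurable h ν ∧ (∀ᵐ x ∂ν, |h x| ≤ C) ∧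
      ∀ φ : testSpace Ω, F φ = ∫ x, (φ : Eu n → ℝ) x * h x ∂ν := by
  obtain ⟨w, hw, hw0, hw1, hwi, hwK⟩ := exists_weight hΩ hν
  set ρ := ν.withDensity w with hρ
  have hfin : IsFiniteMeasure ρ := isFiniteMeasure_withDensity hwi
  have hac : ν ≪ ρ := withDensity_absolutelyContinuous' hw.aemeasurable (ae_of_all _ hw0)
  have hmem (φ : testSpace Ω) : MemLp (fun x => (φ : Eu n → ℝ) x / (w x).toReal) 2 ρ := by
    have hφ : IsTest Ω (φ : Eu n → ℝ) := φ.2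
    obtain ⟨B, hB⟩ := hφ.2.1.exists_bound_of_continuous hφ.1.continuous
    obtain ⟨c, hc, hcK⟩ := hwK _ hφ.2.2 hφ.2.1.isCompact
    have hB0 : 0 ≤ B := (norm_nonneg _).trans (hB 0)
    refine MemLp.of_bound (hφ.1.continuous.measurable.div hw.ennreal_toReal).aestronglyMeasurable
      (B / c) (ae_of_all _ fun x => ?_)
    by_cases hx : x ∈ tsupport (φ : Eu n → ℝ)
    · rw [norm_div, Real.norm_of_nonneg ENNReal.toReal_nonneg]
      exact div_le_div₀ hB0 (hB x) hc (hcK x hx)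
    · rw [image_eq_zero_of_notMem_tsupport hx, zero_div, norm_zero]
      positivity
  let J : testSpace Ω →ₗ[ℝ] Lp ℝ 2 ρ :=
    { toFun := fun φ => (hmem φ).toLp _
      map_add' := fun φ ψ => by
        rw [← MemLp.toLp_add]
        congr 1
        ext x
        exact add_div _ _ _
      map_smul' := fun c φ => by
        rw [RingHom.id_apply, ← MemLp.toLp_const_smul]
        congr 1
        ext x
        exact mul_div_assoc _ _ _ }
  have hJ (φ : testSpace Ω) : J φ =ᵐ[ρ] fun x => (φ : Eu n → ℝ) x / (w x).toReal :=
    (hmem φ).coeFn_toLp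
  obtain ⟨g, hg, hgC, hFg⟩ := exists_bounded_density J F hC fun φ => by
    refine ((le_abs_self _).trans (abs_le_integral_abs hΩ F hC hν hF φ)).trans_eq ?_
    congr 1
    have h1 := integral_withDensity_div (ν := ν) hw hw0 hw1 (fun x => |(φ : Eu n → ℝ) x|)
      (fun _ => 1)
    simp only [mul_one] at h1
    rw [← h1]
    refine integral_congr_ae ((hJ φ).mono fun x hx => ?_)
    beta_reduce
    rw [hx, abs_div, abs_of_nonneg ENNReal.toReal_nonneg]
  refine ⟨g, hg.mono_ac hac, hac.ae_le hgC, fun φ => ?_⟩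
  rw [hFg]
  refine Eq.trans (integral_congr_ae ((hJ φ).mono fun x hx => ?_))
    (integral_withDensity_div hw hw0 hw1 φ g)
  beta_reduce
  rw [hx]

end Representation

/-- the local pairing is a measure dominated by `‖σ‖_∞ |Du|`:
for `σ ∈ L^∞(Ω,ℝⁿ)` with `Div σ ≤ 0` (so `-Div σ = μ ≥ 0`) and
`u ∈ BV_loc(Ω) ∩ L^∞_loc(Ω)` with `|Du| = ν` (polar `θ`), the distribution
`⟨σ, Du⁺⟩(φ) = −∫ u σ·Dφ + ∫ φ u⁺ dμ` is a signed Radon measure of the form `h·ν`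
with density `|h| ≤ ‖σ‖_{L^∞} ≤ C` `ν`-a.e., i.e. `|⟨σ, Du⁺⟩| ≤ C |Du|`. -/
theorem stmt6 {n : ℕ} (Ω : Set (Eu n)) (hΩ : IsOpen Ω)
    (σ : Eu n → Eu n) (C : ℝ) (hσ : Bdd Ω σ C) (hdiv : DivNonpos Ω σ)
    (μ : Measure (Eu n)) (hμ : LocFinOn Ω μ) (hrep : RepNegDiv Ω σ μ 0)
    (u : Eu n → ℝ) (hu : LocallyIntegrableOn u Ω) (hub : LocBddFun Ω u)
    (ν : Measure (Eu n)) (θ : Eu n → Eu n) (hν : LocFinOn Ω ν)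
    (hgrad : HasGradMeasure Ω u ν θ) :
    ∃ h : Eu n → ℝ, AEStronglyMeasurable h ν ∧ (∀ᵐ x ∂ν, |h x| ≤ C) ∧
      ∀ φ : Eu n → ℝ, IsTest Ω φ →
        (- ∫ x in Ω, u x * ⟪σ x, gradient φ x⟫) + (∫ x, φ x * upperRep u x ∂μ)
          = ∫ x, φ x * h x ∂ν := by
  by_cases hC : 0 ≤ C
  · have hlin {φ ψ : Eu n → ℝ} (hφ : IsTest Ω φ) (hψ : IsTest Ω ψ) (c : ℝ) :=
      pairing_add_smul hΩ hC hσ hub hμ hφ hψ c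
    have hzero : pairing Ω σ μ u 0 = 0 := by
      have h1 := hlin (testSpace Ω).zero_mem (testSpace Ω).zero_mem 1
      rw [smul_zero, add_zero, one_mul] at h1
      linarith
    let F : testSpace Ω →ₗ[ℝ] ℝ :=
      { toFun := fun φ => pairing Ω σ μ u φ
        map_add' := fun φ ψ => by
          have h1 := hlin φ.2 ψ.2 1
          rwa [one_smul, one_mul] at h1
        map_smul' := fun c φ => by
          have h1 := hlin (testSpace Ω).zero_mem φ.2 c
          rwa [zero_add, hzero, zero_add] at h1 }
    obtain ⟨h, hm, hhC, hh⟩ := exists_density hΩ F hC hν fun φ hφ0 =>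
      abs_pairing_le_of_nonneg hΩ hC hσ hub hμ hrep hν hgrad φ.2 hφ0
    exact ⟨h, hm, hhC, fun φ hφ => hh ⟨φ, hφ⟩⟩
  · have hΩ0 : Ω = ∅ := by
      refine hΩ.measure_eq_zero_iff volume |>.1 ?_
      rw [← Measure.restrict_eq_zero, ← ae_eq_bot]
      refine eventually_false_iff_eq_bot.1 (hσ.2.mono fun x hx => hC ((norm_nonneg _).trans hx))
    have hν0 : ν = 0 := by
      have h1 := hν.2
      rwa [hΩ0, compl_empty, Measure.measure_univ_eq_zero] at h1
    refine ⟨0, aestronglyMeasurable_const, by simp [hν0], fun φ hφ => ?_⟩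
    have hφ0 (x : Eu n) : φ x = 0 := hφ.eq_zero (by simp [hΩ0])
    simp [hΩ0, hν0, hφ0]
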